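/- arXiv:1206.1210 — 3 statements merged into one kernel-verified Lean document; each statement's English description precedes it below -/
import Mathlib

section
/- There exists a universal constant c > 0 such that for every n ≥ 1 and every pair of increasing continuously differentiable functions f, g : ℝ^n → [−1, 1], one has E_μ[fg] − E_μ[f]·E_μ[g] ≥ c·∑_{i=1}^n [E_μ[∂_i f]·E_μ[∂_i g]] / √(log(e/E_μ[∂_i f])·log(e/E_μ[∂_i g])). -/
open MeasureTheory ProbabilityTheory Filter Pointwise

noncomputable section

/-- The standard Gaussian measure on `ℝ`. -/
def stdGaussian : Measure ℝ := gaussianReal 0 1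

/-- The `n`-fold product of the standard Gaussian measure on `ℝⁿ`. -/
def gaussianPi (n : ℕ) : Measure (Fin n → ℝ) := Measure.pi fun _ => stdGaussian

/-- Lower Minkowski content of a set `S ⊆ ℝ` w.r.t. the standard Gaussian measure. -/
def minkContent (S : Set ℝ) : ℝ :=
  Filter.liminf
    (fun r : ℝ =>
      ((stdGaussian (S + Set.Icc (-r) r)).toReal - (stdGaussian S).toReal) / r)
    (nhdsWithin 0 (Set.Ioi 0))

/-- The restriction of `A` along the fiber of `x` in the `i`-th direction. -/
def fiber {n : ℕ} (A : Set (Fin n → ℝ)) (i : Fin n) (x : Fin n → ℝ) : Set ℝ :=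
  {y : ℝ | Function.update x i y ∈ A}

/-- The geometric influence of coordinate `i` on `A`. -/
def geomInfluence {n : ℕ} (A : Set (Fin n → ℝ)) (i : Fin n) : ℝ :=
  ∫ x, minkContent (fiber A i x) ∂(gaussianPi n)

/-- A set is increasing if its indicator is nondecreasing in each coordinate. -/
def IncreasingSet {n : ℕ} (A : Set (Fin n → ℝ)) : Prop :=
  ∀ ⦃x y : Fin n → ℝ⦄, x ≤ y → x ∈ A → y ∈ A

end


noncomputable section

/-- The `i`-th partial derivative of `f : ℝⁿ → ℝ` at `x`. -/
def pderiv {n : ℕ} (f : (Fin n → ℝ) → ℝ) (i : Fin n) (x : Fin n → ℝ) : ℝ :=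
  fderiv ℝ f x (Pi.single i 1)

end

open MeasureTheory ProbabilityTheory Filter Pointwise
open scoped Topology

namespace GT

instance : IsProbabilityMeasure (_root_.stdGaussian) := by
  unfold _root_.stdGaussian; infer_instance

instance (n : ℕ) : IsProbabilityMeasure (gaussianPi n) := by
  unfold gaussianPi; infer_instance

lemma gaussianPi_eq_map (n : ℕ) : gaussianPi n =
    (ProbabilityTheory.stdGaussian (EuclideanSpace ℝ (Fin n))).map
      (EuclideanSpace.equiv (Fin n) ℝ) := by
  rw [← map_pi_eq_stdGaussian, Measure.map_map (by fun_prop) (by fun_prop)]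
  have : ((EuclideanSpace.equiv (Fin n) ℝ) : EuclideanSpace ℝ (Fin n) → (Fin n → ℝ)) ∘
      (WithLp.toLp 2) = id := by
    ext x i; simp [EuclideanSpace.equiv]
  rw [this, Measure.map_id]; rfl

instance (n : ℕ) : IsGaussian (gaussianPi n) := by
  rw [gaussianPi_eq_map]; infer_instance

lemma gaussianPi_mean (n : ℕ) : ∫ x, x ∂(gaussianPi n) = 0 := by
  rw [gaussianPi_eq_map, integral_map (by fun_prop) (by fun_prop)]
  have := (EuclideanSpace.equiv (Fin n) ℝ).toContinuousLinearMap.integral_comp_comm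
    (φ := fun x => x) (μ := ProbabilityTheory.stdGaussian (EuclideanSpace ℝ (Fin n)))
    IsGaussian.integrable_id
  simp only [integral_id_stdGaussian, map_zero] at this
  exact this

lemma rot_mp (n : ℕ) (θ : ℝ) : MeasurePreserving
    (fun p : (Fin n → ℝ) × (Fin n → ℝ) =>
      (Real.cos θ • p.1 + Real.sin θ • p.2, -Real.sin θ • p.1 + Real.cos θ • p.2))
    ((gaussianPi n).prod (gaussianPi n)) ((gaussianPi n).prod (gaussianPi n)) :=
  ⟨by fun_prop, IsGaussian.map_rotation_eq_self (by simpa using gaussianPi_mean n) θ⟩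

lemma update_mp (n : ℕ) (i : Fin n) : MeasurePreserving
    (fun p : (Fin n → ℝ) × ℝ => Function.update p.1 i p.2)
    ((gaussianPi n).prod _root_.stdGaussian) (gaussianPi n) := by
  have hm : Measurable (fun p : (Fin n → ℝ) × ℝ => Function.update p.1 i p.2) := by
    apply Continuous.measurable
    fun_prop
  refine ⟨hm, ?_⟩
  symm
  refine Measure.pi_eq fun s hs => ?_
  rw [Measure.map_apply hm (MeasurableSet.univ_pi hs)]
  have : (fun p : (Fin n → ℝ) × ℝ => Function.update p.1 i p.2) ⁻¹' (Set.univ.pi s)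
      = (Set.univ.pi (Function.update s i Set.univ)) ×ˢ s i := by
    ext p
    simp only [Set.mem_preimage, Set.mem_pi, Set.mem_univ, true_implies, Set.mem_prod]
    constructor
    · intro h
      refine ⟨fun j => ?_, by simpa using h i⟩
      by_cases hj : j = i
      · subst hj; simp
      · simpa [hj] using h j
    · rintro ⟨h1, h2⟩ j
      by_cases hj : j = i
      · subst hj; simpa using h2
      · simpa [hj] using h1 j
  rw [this, Measure.prod_prod, gaussianPi, Measure.pi_pi]
  rw [← Finset.mul_prod_erase _ _ (Finset.mem_univ i),
    ← Finset.mul_prod_erase Finset.univ (fun j => _root_.stdGaussian (s j)) (Finset.mem_univ i)]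
  simp only [Function.update_self, measure_univ, one_mul]
  rw [mul_comm]
  congr 1
  refine Finset.prod_congr rfl fun j hj => ?_
  rw [Function.update_of_ne (Finset.ne_of_mem_erase hj)]

lemma bdd_int {α : Type*} [TopologicalSpace α] [MeasurableSpace α] [OpensMeasurableSpace α]
    [SecondCountableTopologyEither α ℝ] (μ : Measure α) [IsFiniteMeasure μ] {f : α → ℝ}
    (hf : Continuous f) {C : ℝ} (hC : ∀ x, |f x| ≤ C) : Integrable f μ :=
  Integrable.of_bound hf.aestronglyMeasurable C (Eventually.of_forall hC)

lemma norm_int (n : ℕ) : Integrable (fun x : Fin n → ℝ => ‖x‖) (gaussianPi n) :=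
  (IsGaussian.integrable_id (μ := gaussianPi n)).norm

lemma coord_int (n : ℕ) (i : Fin n) : Integrable (fun x : Fin n → ℝ => x i) (gaussianPi n) := by
  refine (norm_int n).mono' (continuous_apply i).aestronglyMeasurable (Eventually.of_forall fun x => norm_le_pi_norm x i)

lemma coord_mul_int {n : ℕ} (i : Fin n) {f : (Fin n → ℝ) → ℝ} (hf : Continuous f) {C : ℝ}
    (hC : ∀ x, |f x| ≤ C) : Integrable (fun x : Fin n → ℝ => x i * f x) (gaussianPi n) :=
  (coord_int n i).mul_bdd (c := C) hf.aestronglyMeasurable (Eventually.of_forall hC)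

lemma std_integral (f : ℝ → ℝ) : ∫ t, f t ∂_root_.stdGaussian =
    ∫ t, gaussianPDFReal 0 1 t * f t := by
  unfold _root_.stdGaussian
  rw [integral_gaussianReal_eq_integral_smul one_ne_zero]; rfl

lemma std_integrable_iff (f : ℝ → ℝ) : Integrable f _root_.stdGaussian ↔
    Integrable (fun t => gaussianPDFReal 0 1 t * f t) := by
  unfold _root_.stdGaussian
  rw [gaussianReal_of_var_ne_zero _ one_ne_zero]
  rw [integrable_withDensity_iff_integrable_smul₀' (by fun_prop) (by simp [gaussianPDF_lt_top])]
  simp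

lemma pdf_eq (t : ℝ) : gaussianPDFReal 0 1 t = (√(2 * Real.pi))⁻¹ * Real.exp (-t ^ 2 / 2) := by
  simp [gaussianPDFReal]

lemma pdf_deriv (t : ℝ) : HasDerivAt (gaussianPDFReal 0 1) (-t * gaussianPDFReal 0 1 t) t := by
  have h : gaussianPDFReal 0 1 = fun t => (√(2 * Real.pi))⁻¹ * Real.exp (-t ^ 2 / 2) := by
    ext t; exact pdf_eq t
  rw [h]
  have h1 : HasDerivAt (fun t : ℝ => -t ^ 2 / 2) (-t) t := by
    exact ((hasDerivAt_pow 2 t).neg.div_const 2).congr_deriv (by simp; ring)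
  exact (h1.exp.const_mul (√(2 * Real.pi))⁻¹).congr_deriv (by ring)

lemma pdf_tendsto (l : Filter ℝ) (hl : Tendsto (fun t : ℝ => t ^ 2) l atTop) :
    Tendsto (gaussianPDFReal 0 1) l (𝓝 0) := by
  have h : gaussianPDFReal 0 1 = fun t => (√(2 * Real.pi))⁻¹ * Real.exp (-(t ^ 2 / 2)) := by
    ext t; rw [pdf_eq]; ring_nf
  rw [h]
  have := (Real.tendsto_exp_neg_atTop_nhds_zero.comp (hl.atTop_div_const (two_pos))).const_mul
    (√(2 * Real.pi))⁻¹
  simpa using this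

/-- One-dimensional Gaussian integration by parts. -/
lemma ibp1 {F F' : ℝ → ℝ} (hF : ∀ t, HasDerivAt F (F' t) t) {C : ℝ} (hC : ∀ t, |F t| ≤ C)
    (hIntg : Integrable F' _root_.stdGaussian) :
    ∫ t, F' t ∂_root_.stdGaussian = ∫ t, t * F t ∂_root_.stdGaussian := by
  have hcont : Continuous F := continuous_iff_continuousAt.2 fun t => (hF t).continuousAt
  have hint2 : Integrable (fun t => t * F t) _root_.stdGaussian := by
    have h1 : Integrable (fun t : ℝ => t) _root_.stdGaussian := by
      unfold _root_.stdGaussian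
      exact IsGaussian.integrable_id
    exact h1.mul_bdd (c := C) hcont.aestronglyMeasurable (Eventually.of_forall hC)
  rw [← sub_eq_zero, ← integral_sub hIntg hint2, std_integral]
  have hd : ∀ t, HasDerivAt (fun t => gaussianPDFReal 0 1 t * F t)
      (gaussianPDFReal 0 1 t * (F' t - t * F t)) t := by
    intro t
    exact ((pdf_deriv t).mul (hF t)).congr_deriv (by ring)
  have ht : ∀ l : Filter ℝ, Tendsto (fun t : ℝ => t ^ 2) l atTop →
      Tendsto (fun t => gaussianPDFReal 0 1 t * F t) l (𝓝 0) := by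
    intro l hl
    have := (pdf_tendsto l hl).mul_const C
    rw [zero_mul] at this
    refine squeeze_zero_norm (fun t => ?_) this
    rw [norm_mul, Real.norm_of_nonneg (gaussianPDFReal_nonneg _ _ _)]
    exact mul_le_mul_of_nonneg_left (hC t) (gaussianPDFReal_nonneg _ _ _)
  have := integral_of_hasDerivAt_of_tendsto hd
    ((std_integrable_iff _).1 (hIntg.sub hint2))
    (ht atBot (by simpa [Function.comp_def] using
      (tendsto_pow_atTop (α := ℝ) two_ne_zero).comp tendsto_neg_atBot_atTop))
    (ht atTop (tendsto_pow_atTop two_ne_zero))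
  simpa using this

lemma fiber_deriv {n : ℕ} {f : (Fin n → ℝ) → ℝ} (hf : Differentiable ℝ f) (i : Fin n)
    (x : Fin n → ℝ) (t : ℝ) :
    HasDerivAt (fun t => f (Function.update x i t)) (pderiv f i (Function.update x i t)) t := by
  have h1 := (hf (Function.update x i t)).hasFDerivAt
  exact h1.comp_hasDerivAt t (hasDerivAt_update x i t)

lemma integral_update {n : ℕ} (i : Fin n) {f : (Fin n → ℝ) → ℝ} (hf : Integrable f (gaussianPi n)) :
    ∫ x, f x ∂(gaussianPi n) =
      ∫ x, ∫ t, f (Function.update x i t) ∂_root_.stdGaussian ∂(gaussianPi n) := by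
  have hmp := update_mp n i
  rw [← integral_prod (f := fun p : (Fin n → ℝ) × ℝ => f (Function.update p.1 i p.2))
    (hmp.integrable_comp_of_integrable hf)]
  rw [← hmp.map_eq] at hf
  conv_lhs => rw [← hmp.map_eq]
  exact integral_map hmp.measurable.aemeasurable hf.aestronglyMeasurable

/-- Gaussian integration by parts. -/
lemma ibp {n : ℕ} (i : Fin n) {f : (Fin n → ℝ) → ℝ} (hf : Differentiable ℝ f) {C : ℝ}
    (hC : ∀ x, |f x| ≤ C) (hIntg : Integrable (pderiv f i) (gaussianPi n)) :
    ∫ x, pderiv f i x ∂(gaussianPi n) = ∫ x, x i * f x ∂(gaussianPi n) := by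
  rw [integral_update i hIntg, integral_update i (coord_mul_int i hf.continuous hC)]
  have := ((update_mp n i).integrable_comp_of_integrable hIntg).prod_right_ae
  refine integral_congr_ae ?_
  filter_upwards [this] with x hx
  rw [ibp1 (fiber_deriv hf i x) (fun t => hC _) hx]
  simp

end GT

open MeasureTheory ProbabilityTheory Filter Pointwise
open scoped Topology

namespace GT

/-- `C¹` functions, bounded together with their derivative. -/
structure Nice {n : ℕ} (f : (Fin n → ℝ) → ℝ) : Prop where
  cd : ContDiff ℝ 1 f
  bd : ∃ C, ∀ x, |f x| ≤ C
  dbd : ∃ K, ∀ x, ‖fderiv ℝ f x‖ ≤ K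

lemma mollify {n : ℕ} {f : (Fin n → ℝ) → ℝ} (hf : Continuous f) {l u : ℝ}
    (hlu : ∀ x, f x ∈ Set.Icc l u) :
    ∃ F : ℕ → (Fin n → ℝ) → ℝ, (∀ k, Nice (F k)) ∧ (∀ k x, F k x ∈ Set.Icc l u) ∧
      (∀ x, Tendsto (fun k => F k x) atTop (𝓝 (f x))) ∧ (Monotone f → ∀ k, Monotone (F k)) := by
  let φ : ℕ → ContDiffBump (0 : Fin n → ℝ) := fun k =>
    ⟨1 / (2 * ((k : ℝ) + 1)), 1 / ((k : ℝ) + 1), by positivity, by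
      apply one_div_lt_one_div_of_lt <;> [positivity; linarith [k.cast_nonneg (α := ℝ)]]⟩
  let F : ℕ → (Fin n → ℝ) → ℝ := fun k =>
    convolution ((φ k).normed volume) f (ContinuousLinearMap.lsmul ℝ ℝ) volume
  have hbd : ∀ x, |f x| ≤ max |l| |u| := fun x => abs_le_max_abs_abs (hlu x).1 (hlu x).2
  have hF : ∀ k x, F k x = ∫ t, (φ k).normed volume t * f (x - t) := fun k x => by
    simp [F, convolution]
  have hIntg : ∀ k x, Integrable (fun t => (φ k).normed volume t * f (x - t)) := fun k x =>
    ((φ k).integrable_normed (μ := volume)).mul_bdd (c := max |l| |u|)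
      (by fun_prop) (Eventually.of_forall fun t => hbd _)
  have hconst : ∀ k (c : ℝ), ∫ t, (φ k).normed volume t * c = c := fun k c => by
    rw [integral_mul_const, (φ k).integral_normed, one_mul]
  have hrange : ∀ k x, F k x ∈ Set.Icc l u := by
    intro k x
    rw [hF]
    constructor
    · conv_lhs => rw [← hconst k l]
      exact integral_mono (((φ k).integrable_normed (μ := volume)).mul_const _) (hIntg k x)
        fun t => mul_le_mul_of_nonneg_left (hlu _).1 ((φ k).nonneg_normed t)
    · conv_rhs => rw [← hconst k u]
      exact integral_mono (hIntg k x) (((φ k).integrable_normed (μ := volume)).mul_const _)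
        fun t => mul_le_mul_of_nonneg_left (hlu _).2 ((φ k).nonneg_normed t)
  have hloc : LocallyIntegrable f volume := hf.locallyIntegrable
  refine ⟨F, fun k => ⟨?_, ⟨max |l| |u|, fun x =>
    abs_le_max_abs_abs (hrange k x).1 (hrange k x).2⟩, ?_⟩, hrange, ?_, ?_⟩
  · exact ((φ k).hasCompactSupport_normed (μ := volume)).contDiff_convolution_left _ ((φ k).contDiff_normed (μ := volume)) hloc
  · refine ⟨∫ t, ‖fderiv ℝ ((φ k).normed volume) t‖ * max |l| |u|, fun x => ?_⟩
    have hd := ((φ k).hasCompactSupport_normed (μ := volume)).hasFDerivAt_convolution_left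
      (ContinuousLinearMap.lsmul ℝ ℝ) ((φ k).contDiff_normed (μ := volume) (n := 1)) hloc x
    rw [hd.fderiv, convolution]
    have hi : Integrable (fun t => ‖fderiv ℝ ((φ k).normed volume) t‖ * max |l| |u|) := by
      apply Integrable.mul_const
      apply Integrable.norm
      apply Continuous.integrable_of_hasCompactSupport
      · exact ((φ k).contDiff_normed (μ := volume) (n := 1)).continuous_fderiv one_ne_zero
      · exact ((φ k).hasCompactSupport_normed (μ := volume)).fderiv ℝ
    refine norm_integral_le_of_norm_le hi (Eventually.of_forall fun t => ?_)
    refine ContinuousLinearMap.opNorm_le_bound _ (by positivity) fun v => ?_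
    simp only [ContinuousLinearMap.precompL_apply, ContinuousLinearMap.lsmul_apply, norm_smul]
    calc _ ≤ (‖fderiv ℝ ((φ k).normed volume) t‖ * ‖v‖) * max |l| |u| :=
        mul_le_mul (ContinuousLinearMap.le_opNorm _ _) (hbd _) (abs_nonneg _) (by positivity)
      _ = _ := by ring
  · intro x
    refine ContDiffBump.convolution_tendsto_right_of_continuous ?_ hf x
    exact tendsto_one_div_add_atTop_nhds_zero_nat
  · intro hm k x y hxy
    rw [hF, hF]
    exact integral_mono (hIntg k x) (hIntg k y) fun t =>
      mul_le_mul_of_nonneg_left (hm (sub_le_sub_right hxy t)) ((φ k).nonneg_normed t)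

variable {n : ℕ}

/-- product Gaussian measure on pairs -/
noncomputable abbrev γ2 (n : ℕ) : Measure ((Fin n → ℝ) × (Fin n → ℝ)) :=
  (gaussianPi n).prod (gaussianPi n)

/-- the noise bilinear form -/
noncomputable def BB (θ : ℝ) (p q : (Fin n → ℝ) → ℝ) : ℝ :=
  ∫ z, p z.1 * q (Real.cos θ • z.1 + Real.sin θ • z.2) ∂(γ2 n)

lemma Nice.pcont {f : (Fin n → ℝ) → ℝ} (hf : Nice f) (i : Fin n) : Continuous (pderiv f i) := by
  have := hf.cd.continuous_fderiv one_ne_zero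
  unfold pderiv
  fun_prop

lemma Nice.pbd {f : (Fin n → ℝ) → ℝ} (hf : Nice f) : ∃ K, 0 ≤ K ∧ ∀ i x, |pderiv f i x| ≤ K := by
  obtain ⟨K, hK⟩ := hf.dbd
  refine ⟨K, (norm_nonneg _).trans (hK 0), fun i x => ?_⟩
  refine ((fderiv ℝ f x).le_opNorm _).trans ?_
  rw [Pi.norm_single]
  simpa using hK x

lemma Nice.diff {f : (Fin n → ℝ) → ℝ} (hf : Nice f) : Differentiable ℝ f :=
  hf.cd.differentiable one_ne_zero

lemma Nice.ibp {f : (Fin n → ℝ) → ℝ} (hf : Nice f) (i : Fin n) :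
    ∫ x, pderiv f i x ∂(gaussianPi n) = ∫ x, x i * f x ∂(gaussianPi n) := by
  obtain ⟨C, hC⟩ := hf.bd
  obtain ⟨K, hK0, hK⟩ := hf.pbd
  exact GT.ibp i hf.diff hC (bdd_int _ (hf.pcont i) (hK i))

lemma Nice.aff {f : (Fin n → ℝ) → ℝ} (hf : Nice f) (y : Fin n → ℝ) (s : ℝ) :
    Nice (fun z => f (y + s • z)) := by
  obtain ⟨C, hC⟩ := hf.bd
  obtain ⟨K, hK⟩ := hf.dbd
  have hder : ∀ x, HasFDerivAt (fun z => f (y + s • z)) (s • fderiv ℝ f (y + s • x)) x := by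
    intro x
    have h1 : HasFDerivAt (fun z : Fin n → ℝ => y + s • z)
        (s • ContinuousLinearMap.id ℝ (Fin n → ℝ)) x :=
      ((hasFDerivAt_id x).const_smul s).const_add y
    refine ((hf.diff (y + s • x)).hasFDerivAt.comp x h1).congr_fderiv ?_
    ext v; simp
  refine ⟨hf.cd.comp (by fun_prop), ⟨C, fun x => hC _⟩, ⟨|s| * K, fun x => ?_⟩⟩
  rw [(hder x).fderiv, norm_smul]
  exact mul_le_mul_of_nonneg_left (hK _) (norm_nonneg _)

lemma pderiv_aff {f : (Fin n → ℝ) → ℝ} (hf : Nice f) (y : Fin n → ℝ) (s : ℝ) (i : Fin n)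
    (x : Fin n → ℝ) : pderiv (fun z => f (y + s • z)) i x = s * pderiv f i (y + s • x) := by
  have h1 : HasFDerivAt (fun z : Fin n → ℝ => y + s • z)
      (s • ContinuousLinearMap.id ℝ (Fin n → ℝ)) x :=
    ((hasFDerivAt_id x).const_smul s).const_add y
  have := (hf.diff (y + s • x)).hasFDerivAt.comp x h1
  unfold pderiv
  rw [show (fun z => f (y + s • z)) = f ∘ (fun z => y + s • z) from rfl, this.fderiv]
  simp

lemma rot_integral (θ : ℝ) {Φ : (Fin n → ℝ) × (Fin n → ℝ) → ℝ} (hΦ : Continuous Φ) :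
    ∫ p, Φ p ∂(γ2 n) = ∫ p : (Fin n → ℝ) × (Fin n → ℝ), Φ (Real.cos θ • p.1 + Real.sin θ • p.2,
      -Real.sin θ • p.1 + Real.cos θ • p.2) ∂(γ2 n) := by
  have hmp := rot_mp n θ
  conv_lhs => rw [γ2, ← hmp.map_eq]
  exact integral_map hmp.measurable.aemeasurable hΦ.aestronglyMeasurable

lemma norm2_int (n : ℕ) : Integrable (fun p : (Fin n → ℝ) × (Fin n → ℝ) => ‖p.1‖ + ‖p.2‖) (γ2 n) :=
  ((norm_int n).comp_fst _).add ((norm_int n).comp_snd _)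

lemma fderiv_sum (g : (Fin n → ℝ) → ℝ) (y w : Fin n → ℝ) :
    fderiv ℝ g y w = ∑ i, w i * pderiv g i y := by
  conv_lhs => rw [pi_eq_sum_univ' w]
  simp [pderiv]

lemma hasDeriv_BB {f g : (Fin n → ℝ) → ℝ} (hf : Nice f) (hg : Nice g) (θ : ℝ) :
    HasDerivAt (fun θ => BB θ f g)
      (-Real.sin θ * ∑ i, BB θ (pderiv f i) (pderiv g i)) θ := by
  obtain ⟨C, hC⟩ := hf.bd
  obtain ⟨C', hC'⟩ := hg.bd
  obtain ⟨K, hK⟩ := hg.dbd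
  obtain ⟨L, hL0, hL⟩ := hf.pbd
  obtain ⟨L', hL0', hL'⟩ := hg.pbd
  have hC0 : 0 ≤ C := (abs_nonneg _).trans (hC 0)
  have hK0 : 0 ≤ K := (norm_nonneg _).trans (hK 0)
  have hfc := hf.cd.continuous
  have hgc := hg.cd.continuous
  have hgc' := hg.cd.continuous_fderiv one_ne_zero
  have step1 : HasDerivAt (fun θ => BB θ f g)
      (∫ z, f z.1 * fderiv ℝ g (Real.cos θ • z.1 + Real.sin θ • z.2)
        (-Real.sin θ • z.1 + Real.cos θ • z.2) ∂(γ2 n)) θ := by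
    unfold BB
    refine (hasDerivAt_integral_of_dominated_loc_of_deriv_le
      (F := fun θ (z : (Fin n → ℝ) × (Fin n → ℝ)) =>
        f z.1 * g (Real.cos θ • z.1 + Real.sin θ • z.2))
      (F' := fun θ (z : (Fin n → ℝ) × (Fin n → ℝ)) =>
        f z.1 * fderiv ℝ g (Real.cos θ • z.1 + Real.sin θ • z.2)
        (-Real.sin θ • z.1 + Real.cos θ • z.2))
      (bound := fun z => C * (K * (‖z.1‖ + ‖z.2‖))) (Filter.univ_mem) ?_ ?_ ?_ ?_ ?_ ?_).2
    · exact Eventually.of_forall fun t => by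
        apply Continuous.aestronglyMeasurable; fun_prop
    · refine bdd_int _ (by fun_prop) (C := C * C') fun z => ?_
      rw [abs_mul]
      exact mul_le_mul (hC _) (hC' _) (abs_nonneg _) hC0
    · apply Continuous.aestronglyMeasurable
      fun_prop
    · refine Eventually.of_forall fun z t _ => ?_
      rw [norm_mul]
      refine mul_le_mul (hC _) ?_ (norm_nonneg _) hC0
      refine (ContinuousLinearMap.le_opNorm _ _).trans ?_
      refine mul_le_mul (hK _) ?_ (norm_nonneg _) hK0
      refine (norm_add_le _ _).trans ?_
      rw [norm_smul, norm_smul]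
      refine add_le_add ?_ ?_
      · refine mul_le_of_le_one_left (norm_nonneg _) ?_
        simpa using Real.abs_sin_le_one t
      · exact mul_le_of_le_one_left (norm_nonneg _) (Real.abs_cos_le_one t)
    · exact ((norm2_int n).const_mul K).const_mul C
    · refine Eventually.of_forall fun z t _ => ?_
      have h1 : HasDerivAt (fun t => Real.cos t • z.1 + Real.sin t • z.2)
          (-Real.sin t • z.1 + Real.cos t • z.2) t :=
        ((Real.hasDerivAt_cos t).smul_const z.1).add ((Real.hasDerivAt_sin t).smul_const z.2)
      exact ((hg.diff _).hasFDerivAt.comp_hasDerivAt t h1).const_mul _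
  convert step1 using 1
  have key : ∀ x z : Fin n → ℝ, Real.cos θ • (Real.cos θ • x + Real.sin θ • z) +
      (-Real.sin θ) • (-Real.sin θ • x + Real.cos θ • z) = x := by
    intro x z
    ext i
    simp only [Pi.add_apply, Pi.smul_apply, smul_eq_mul]
    linear_combination (x i) * Real.sin_sq_add_cos_sq θ
  have e1 : ∫ z, f z.1 * fderiv ℝ g (Real.cos θ • z.1 + Real.sin θ • z.2)
        (-Real.sin θ • z.1 + Real.cos θ • z.2) ∂(γ2 n) =
      ∫ z, f (Real.cos θ • z.1 + (-Real.sin θ) • z.2) * fderiv ℝ g z.1 z.2 ∂(γ2 n) := by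
    rw [rot_integral θ (Φ := fun z => f (Real.cos θ • z.1 + (-Real.sin θ) • z.2) *
      fderiv ℝ g z.1 z.2) (by fun_prop)]
    simp only [key]
  have e2 : ∀ i, BB θ (pderiv f i) (pderiv g i) =
      ∫ z, pderiv f i (Real.cos θ • z.1 + (-Real.sin θ) • z.2) * pderiv g i z.1 ∂(γ2 n) := by
    intro i
    have := hf.pcont i
    have := hg.pcont i
    rw [rot_integral θ (Φ := fun z => pderiv f i (Real.cos θ • z.1 + (-Real.sin θ) • z.2) *
      pderiv g i z.1) (by fun_prop)]
    simp only [key, BB]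
  have hcoord : ∀ i, Integrable (fun z : (Fin n → ℝ) × (Fin n → ℝ) =>
      z.2 i * (f (Real.cos θ • z.1 + (-Real.sin θ) • z.2) * pderiv g i z.1)) (γ2 n) := by
    intro i
    have := hg.pcont i
    refine ((coord_int n i).comp_snd (gaussianPi n)).mul_bdd (c := C * L')
      (by apply Continuous.aestronglyMeasurable; fun_prop) (Eventually.of_forall fun z => ?_)
    rw [norm_mul]
    exact mul_le_mul (hC _) (hL' _ _) (norm_nonneg _) hC0
  rw [e1]
  simp only [fderiv_sum, Finset.mul_sum]
  rw [show (fun z : (Fin n → ℝ) × (Fin n → ℝ) => ∑ i, f (Real.cos θ • z.1 + (-Real.sin θ) • z.2) *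
      (z.2 i * pderiv g i z.1)) = fun z => ∑ i, z.2 i *
      (f (Real.cos θ • z.1 + (-Real.sin θ) • z.2) * pderiv g i z.1) from by
    ext z; refine Finset.sum_congr rfl fun i _ => ?_; ring]
  rw [integral_finsetSum _ fun i _ => hcoord i]
  refine Finset.sum_congr rfl fun i _ => ?_
  have := hf.pcont i
  have := hg.pcont i
  rw [e2, integral_prod _ (hcoord i), integral_prod, ← integral_const_mul]
  · refine integral_congr_ae (Eventually.of_forall fun y => ?_)
    simp only
    rw [integral_mul_const]
    have h3 := (hf.aff (Real.cos θ • y) (-Real.sin θ)).ibp i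
    simp only [pderiv_aff hf] at h3
    rw [integral_const_mul] at h3
    rw [← mul_assoc, h3, ← integral_mul_const]
    refine integral_congr_ae (Eventually.of_forall fun w => ?_)
    simp only
    ring
  · refine bdd_int _ (by fun_prop) (C := L * L') fun z => ?_
    rw [abs_mul]
    exact mul_le_mul (hL _ _) (hL' _ _) (abs_nonneg _) hL0

end GT

open MeasureTheory ProbabilityTheory Filter Pointwise
open scoped Topology

namespace GT
variable {n : ℕ}

/-- noise operator -/
noncomputable def TT (α : ℝ) (u : (Fin n → ℝ) → ℝ) (w : Fin n → ℝ) : ℝ :=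
  ∫ z, u (Real.cos α • w + Real.sin α • z) ∂(gaussianPi n)

lemma TT_bd (α : ℝ) {u : (Fin n → ℝ) → ℝ} {C : ℝ} (hC : ∀ x, |u x| ≤ C) (w : Fin n → ℝ) :
    |TT α u w| ≤ C := by
  have := norm_integral_le_of_norm_le_const (μ := gaussianPi n)
    (f := fun z => u (Real.cos α • w + Real.sin α • z)) (C := C)
    (Eventually.of_forall fun z => hC _)
  simpa [TT] using this

lemma TT_cont (α : ℝ) {u : (Fin n → ℝ) → ℝ} (hu : Continuous u) {C : ℝ} (hC : ∀ x, |u x| ≤ C) :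
    Continuous (TT α u) := by
  unfold TT
  refine continuous_of_dominated (bound := fun _ => C) (fun w => ?_)
    (fun w => Eventually.of_forall fun z => hC _) (integrable_const _)
    (Eventually.of_forall fun z => by fun_prop)
  apply Continuous.aestronglyMeasurable; fun_prop

lemma rot_fst (φ : ℝ) {ψ : (Fin n → ℝ) → ℝ} (hψ : Continuous ψ) :
    ∫ p, ψ (Real.cos φ • p.1 + Real.sin φ • p.2) ∂(γ2 n) = ∫ x, ψ x ∂(gaussianPi n) := by
  have := rot_integral (n := n) φ (Φ := fun p => ψ p.1) (by fun_prop)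
  simp only at this
  rw [← this, integral_fun_fst]
  simp

lemma conv_lemma {A B S : ℝ} (hS : 0 < S) (hB : 0 ≤ B) (h : A ^ 2 + B ^ 2 = S ^ 2)
    {q : (Fin n → ℝ) → ℝ} (hq : Continuous q) (a : Fin n → ℝ) :
    ∫ p, q (a + (A • p.1 + B • p.2)) ∂(γ2 n) = ∫ z, q (a + S • z) ∂(gaussianPi n) := by
  have hAS : A ^ 2 ≤ S ^ 2 := by nlinarith
  have hA := abs_le_of_sq_le_sq' hAS hS.le
  have hc : Real.cos (Real.arccos (A / S)) = A / S := by
    apply Real.cos_arccos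
    · rw [le_div_iff₀ hS]; linarith [hA.1]
    · rw [div_le_iff₀ hS]; linarith [hA.2]
  have hs : Real.sin (Real.arccos (A / S)) = B / S := by
    have h0 : 1 - (A / S) ^ 2 = (B / S) ^ 2 := by
      field_simp; linarith
    rw [Real.sin_arccos, h0, Real.sqrt_sq (by positivity)]
  rw [← rot_fst (Real.arccos (A / S)) (ψ := fun z => q (a + S • z)) (by fun_prop), hc, hs]
  congr 1; ext p; congr 2
  rw [smul_add, smul_smul, smul_smul, mul_div_cancel₀ _ hS.ne', mul_div_cancel₀ _ hS.ne']

lemma semigroup {α β θ : ℝ} (hθ : 0 < Real.sin θ) (hβ : 0 ≤ Real.sin β)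
    (h : Real.cos θ = Real.cos α * Real.cos β) {p q : (Fin n → ℝ) → ℝ}
    (hp : Continuous p) (hq : Continuous q) {C D : ℝ} (hC : ∀ x, |p x| ≤ C) (hD : ∀ x, |q x| ≤ D) :
    ∫ w, TT α p w * TT β q w ∂(gaussianPi n) = BB θ p q := by
  have hC0 : 0 ≤ C := (abs_nonneg _).trans (hC 0)
  have hQ := TT_cont β hq hD
  have hQb := TT_bd β hD
  have key : ∀ x z : Fin n → ℝ, Real.cos α • (Real.cos α • x + Real.sin α • z) +
      (-Real.sin α) • (-Real.sin α • x + Real.cos α • z) = x := by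
    intro x z
    ext i
    simp only [Pi.add_apply, Pi.smul_apply, smul_eq_mul]
    linear_combination (x i) * Real.sin_sq_add_cos_sq α
  have e1 : ∫ w, TT α p w * TT β q w ∂(gaussianPi n) =
      ∫ z, p (Real.cos α • z.1 + Real.sin α • z.2) * TT β q z.1 ∂(γ2 n) := by
    rw [integral_prod]
    · refine integral_congr_ae (Eventually.of_forall fun w => ?_)
      simp only
      rw [integral_mul_const]; rfl
    · refine bdd_int _ (by fun_prop) (C := C * D) fun z => ?_
      rw [abs_mul]
      exact mul_le_mul (hC _) (hQb _) (abs_nonneg _) hC0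
  have e2 := rot_integral (n := n) α
    (Φ := fun z => p z.1 * TT β q (Real.cos α • z.1 + (-Real.sin α) • z.2)) (by fun_prop)
  simp only [key] at e2
  rw [e1, ← e2, BB, integral_prod, integral_prod]
  · refine integral_congr_ae (Eventually.of_forall fun x => ?_)
    simp only
    rw [integral_const_mul, integral_const_mul]
    congr 1
    have := conv_lemma (n := n) (A := -(Real.cos β * Real.sin α)) (B := Real.sin β) hθ hβ
      (by
        have h1 := Real.sin_sq_add_cos_sq α
        have h2 := Real.sin_sq_add_cos_sq β
        have h3 := Real.sin_sq_add_cos_sq θ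
        rw [h] at h3
        nlinarith) hq (Real.cos θ • x)
    rw [← this, integral_prod]
    · refine integral_congr_ae (Eventually.of_forall fun y => ?_)
      simp only [TT]
      refine integral_congr_ae (Eventually.of_forall fun z => ?_)
      simp only
      congr 1
      ext i
      simp only [Pi.add_apply, Pi.smul_apply, smul_eq_mul, h]
      ring
    · exact bdd_int _ (by fun_prop) (C := D) fun z => hD _
  · refine bdd_int _ (by fun_prop) (C := C * D) fun z => ?_
    rw [abs_mul]
    exact mul_le_mul (hC _) (hD _) (abs_nonneg _) hC0
  · refine bdd_int _ (by fun_prop) (C := C * D) fun z => ?_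
    rw [abs_mul]
    exact mul_le_mul (hC _) (hQb _) (abs_nonneg _) hC0

lemma TT_integral (α : ℝ) {u : (Fin n → ℝ) → ℝ} (hu : Continuous u) {C : ℝ}
    (hC : ∀ x, |u x| ≤ C) : ∫ w, TT α u w ∂(gaussianPi n) = ∫ x, u x ∂(gaussianPi n) := by
  rw [← rot_fst α hu, integral_prod]
  · rfl
  · exact bdd_int _ (by fun_prop) (C := C) fun z => hC _

lemma exp_lin (a : Fin n → ℝ) :
    Integrable (fun z : Fin n → ℝ => Real.exp (∑ i, a i * z i)) (gaussianPi n) ∧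
    ∫ z, Real.exp (∑ i, a i * z i) ∂(gaussianPi n) = Real.exp ((∑ i, a i ^ 2) / 2) := by
  simp only [Real.exp_sum]
  constructor
  · unfold gaussianPi _root_.stdGaussian
    exact Integrable.fintype_prod fun i => integrable_exp_mul_gaussianReal (a i)
  · unfold gaussianPi _root_.stdGaussian
    rw [integral_fintype_prod_eq_prod (fun i t => Real.exp (a i * t)), Finset.sum_div, Real.exp_sum]
    refine Finset.prod_congr rfl fun i _ => ?_
    have := congrFun (mgf_id_gaussianReal (μ := 0) (v := 1)) (a i)
    simpa [mgf] using this

lemma level_one {U : (Fin n → ℝ) → ℝ} (hU : Continuous U) (h0 : ∀ x, 0 ≤ U x) (h1 : ∀ x, U x ≤ 1) :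
    ∑ i, (∫ z, z i * U z ∂(gaussianPi n)) ^ 2 ≤
      2 * (∫ z, U z ∂(gaussianPi n)) ^ 2 * Real.log (1 / ∫ z, U z ∂(gaussianPi n)) := by
  have hb : ∀ x, |U x| ≤ 1 := fun x => by rw [abs_of_nonneg (h0 x)]; exact h1 x
  have hUi := bdd_int (gaussianPi n) hU hb
  have hci := fun i => coord_mul_int i hU hb
  set m := ∫ z, U z ∂(gaussianPi n) with hm
  set v : Fin n → ℝ := fun i => ∫ z, z i * U z ∂(gaussianPi n) with hv
  have hm0 : 0 ≤ m := integral_nonneg h0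
  rcases hm0.eq_or_lt with hz | hpos
  · have : U =ᵐ[gaussianPi n] 0 := (integral_eq_zero_iff_of_nonneg h0 hUi).1 hz.symm
    have hv0 : ∀ i, ∫ z, z i * U z ∂(gaussianPi n) = 0 := by
      intro i
      rw [← integral_zero (Fin n → ℝ) ℝ (μ := gaussianPi n)]
      refine integral_congr_ae ?_
      filter_upwards [this] with z hz
      simp [hz]
    simp [hv0, ← hz]
  set S := ∑ i, (v i) ^ 2 with hS
  have hLU : ∫ z, (∑ i, (v i / m) * z i) * U z ∂(gaussianPi n) = S / m := by
    simp only [Finset.sum_mul, mul_assoc]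
    rw [integral_finsetSum _ fun i _ => (hci i).const_mul _]
    simp only [integral_const_mul]
    rw [hS, Finset.sum_div]
    refine Finset.sum_congr rfl fun i _ => ?_
    simp only [hv]; ring
  have hLUi : Integrable (fun z => (∑ i, (v i / m) * z i) * U z) (gaussianPi n) := by
    simp only [Finset.sum_mul, mul_assoc]
    exact integrable_finsetSum _ fun i _ => (hci i).const_mul _
  obtain ⟨hE1, hE2⟩ := exp_lin (n := n) (fun i => v i / m)
  set c := S / (2 * m ^ 2) + Real.log (1 / m) with hc
  have hineq : S / m ≤ ∫ z, (Real.exp (-c) * Real.exp (∑ i, v i / m * z i) + (c - 1) * U z)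
      ∂(gaussianPi n) := by
    rw [← hLU]
    refine integral_mono hLUi ((hE1.const_mul _).add (hUi.const_mul _)) fun z => ?_
    simp only
    rw [← Real.exp_add]
    set L := ∑ i, v i / m * z i
    have h2 := Real.add_one_le_exp (-c + L)
    have h3 := Real.exp_pos (-c + L)
    nlinarith [h0 z, h1 z, mul_le_mul_of_nonneg_right h2 (h0 z), mul_le_mul_of_nonneg_left (h1 z) h3.le]
  rw [integral_add (hE1.const_mul _) (hUi.const_mul _), integral_const_mul, integral_const_mul, hE2,
    ← Real.exp_add, ← hm] at hineq
  have hs : (∑ i, (v i / m) ^ 2) / 2 = S / (2 * m ^ 2) := by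
    simp only [div_pow]
    rw [← Finset.sum_div, hS, div_div, mul_comm]
  have he : Real.exp (-c + S / (2 * m ^ 2)) = m := by
    rw [hc, one_div, Real.log_inv]
    rw [show -(S / (2 * m ^ 2) + -Real.log m) + S / (2 * m ^ 2) = Real.log m by ring,
      Real.exp_log hpos]
  rw [hs, he] at hineq
  have h5 : S / m ≤ m * c := by linarith
  rw [hc, div_le_iff₀ hpos] at h5
  have h6 : m * (S / (2 * m ^ 2) + Real.log (1 / m)) * m = S / 2 + m ^ 2 * Real.log (1 / m) := by
    field_simp
  rw [h6] at h5
  linarith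

lemma BB_pi_half {p q : (Fin n → ℝ) → ℝ} :
    BB (Real.pi / 2) p q = (∫ x, p x ∂(gaussianPi n)) * ∫ x, q x ∂(gaussianPi n) := by
  simp only [BB, Real.cos_pi_div_two, Real.sin_pi_div_two, zero_smul, one_smul, zero_add]
  exact integral_prod_mul p q

lemma BB_zero {p q : (Fin n → ℝ) → ℝ} :
    BB 0 p q = ∫ x, p x * q x ∂(gaussianPi n) := by
  simp only [BB, Real.cos_zero, Real.sin_zero, zero_smul, one_smul, add_zero]
  rw [integral_fun_fst (fun x => p x * q x)]
  simp

lemma log_aux {m μ : ℝ} (hm : 0 ≤ m) (hμ : 0 < μ) :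
    m ^ 2 * Real.log (1 / m) ≤ m ^ 2 * Real.log (1 / μ) + μ * m - m ^ 2 := by
  rcases hm.eq_or_lt with h | h
  · simp [← h]
  have h1 := Real.log_le_sub_one_of_pos (div_pos hμ h)
  rw [Real.log_div hμ.ne' h.ne'] at h1
  rw [one_div, one_div, Real.log_inv, Real.log_inv]
  have h2 := mul_le_mul_of_nonneg_left h1 (sq_nonneg m)
  have h3 : m ^ 2 * (μ / m - 1) = μ * m - m ^ 2 := by field_simp
  rw [h3] at h2
  linarith

lemma hyper_nice {u : (Fin n → ℝ) → ℝ} (hu : Nice u) (h0 : ∀ x, 0 ≤ u x) (h1 : ∀ x, u x ≤ 1)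
    (hμ : 0 < ∫ x, u x ∂(gaussianPi n)) {θ : ℝ} (hθ : θ ∈ Set.Icc (Real.pi / 3) (Real.pi / 2)) :
    BB θ u u ≤ (∫ x, u x ∂(gaussianPi n)) ^ 2 *
      Real.exp (4 * Real.log (1 / ∫ x, u x ∂(gaussianPi n)) * Real.cos θ) := by
  have hb : ∀ x, |u x| ≤ 1 := fun x => by rw [abs_of_nonneg (h0 x)]; exact h1 x
  have huc := hu.cd.continuous
  set μ := ∫ x, u x ∂(gaussianPi n) with hμd
  set L := Real.log (1 / μ) with hL
  obtain ⟨K, hK0, hK⟩ := hu.pbd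
  have hpi := Real.pi_pos
  have main : ∀ θ ∈ Set.Icc (Real.pi / 3) (Real.pi / 2),
      ∑ i, BB θ (pderiv u i) (pderiv u i) ≤ 4 * L * BB θ u u := by
    intro θ hθ
    have hs : 0 < Real.sin θ := Real.sin_pos_of_pos_of_lt_pi (by linarith [hθ.1]) (by linarith [hθ.2])
    have hc0 : 0 ≤ Real.cos θ := Real.cos_nonneg_of_mem_Icc ⟨by linarith [hθ.1], hθ.2⟩
    have hc1 : Real.cos θ ≤ 1 / 2 := by
      rw [← Real.cos_pi_div_three]
      exact Real.cos_le_cos_of_nonneg_of_le_pi (by linarith) (by linarith [hθ.2]) hθ.1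
    set α := Real.arccos (√(Real.cos θ)) with hα
    have hcα : Real.cos α = √(Real.cos θ) :=
      Real.cos_arccos (by linarith [Real.sqrt_nonneg (Real.cos θ)])
        (Real.sqrt_le_one.2 (by linarith))
    have hcc : Real.cos θ = Real.cos α * Real.cos α := by rw [hcα, Real.mul_self_sqrt hc0]
    have hsα : 0 ≤ Real.sin α := Real.sin_nonneg_of_mem_Icc ⟨Real.arccos_nonneg _, Real.arccos_le_pi _⟩
    have hsα2 : 1 / 2 ≤ Real.sin α ^ 2 := by
      have := Real.sin_sq_add_cos_sq α
      nlinarith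
    have hN := semigroup hs hsα hcc huc huc hb hb
    have hD := fun i => semigroup hs hsα hcc (hu.pcont i) (hu.pcont i) (hK i) (hK i)
    have hTi := TT_integral α huc hb
    have hTc := TT_cont α huc hb
    have hTb := TT_bd α hb
    have hTDc := fun i => TT_cont α (hu.pcont i) (hK i)
    have hTDb := fun i => TT_bd α (hK i)
    have hT0 : ∀ w, 0 ≤ TT α u w := fun w => integral_nonneg fun z => h0 _
    have hi1 : Integrable (TT α u) (gaussianPi n) := bdd_int _ hTc hTb
    have hi2 : Integrable (fun w => TT α u w * TT α u w) (gaussianPi n) :=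
      bdd_int _ (by fun_prop) (C := 1 * 1) fun w => by
        rw [abs_mul]; exact mul_le_mul (hTb w) (hTb w) (abs_nonneg _) zero_le_one
    have hi3 : ∀ i, Integrable (fun w => TT α (pderiv u i) w * TT α (pderiv u i) w)
        (gaussianPi n) := fun i => by
      have := hTDc i
      exact bdd_int _ (by fun_prop) (C := K * K) fun w => by
        rw [abs_mul]; exact mul_le_mul (hTDb i w) (hTDb i w) (abs_nonneg _) hK0
    have hpt : ∀ w, ∑ i, TT α (pderiv u i) w * TT α (pderiv u i) w ≤
        4 * (L * (TT α u w * TT α u w) + μ * TT α u w - TT α u w * TT α u w) := by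
      intro w
      have hl := level_one (U := fun z => u (Real.cos α • w + Real.sin α • z)) (by fun_prop)
        (fun _ => h0 _) (fun _ => h1 _)
      have hv : ∀ i, ∫ z, z i * u (Real.cos α • w + Real.sin α • z) ∂(gaussianPi n) =
          Real.sin α * TT α (pderiv u i) w := by
        intro i
        rw [← (hu.aff (Real.cos α • w) (Real.sin α)).ibp i]
        simp only [pderiv_aff hu]
        rw [integral_const_mul]; rfl
      simp only [hv] at hl
      change _ ≤ 2 * (TT α u w) ^ 2 * Real.log (1 / TT α u w) at hl
      have h7 : ∑ i, (Real.sin α * TT α (pderiv u i) w) ^ 2 =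
          Real.sin α ^ 2 * ∑ i, TT α (pderiv u i) w * TT α (pderiv u i) w := by
        rw [Finset.mul_sum]
        refine Finset.sum_congr rfl fun i _ => by ring
      rw [h7] at hl
      have h8 : 0 ≤ ∑ i, TT α (pderiv u i) w * TT α (pderiv u i) w :=
        Finset.sum_nonneg fun i _ => mul_self_nonneg _
      have h9 := log_aux (hT0 w) hμ
      nlinarith [mul_le_mul_of_nonneg_right hsα2 h8]
    have hsum : ∑ i, BB θ (pderiv u i) (pderiv u i) =
        ∫ w, ∑ i, TT α (pderiv u i) w * TT α (pderiv u i) w ∂(gaussianPi n) := by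
      rw [integral_finsetSum _ fun i _ => hi3 i]
      exact Finset.sum_congr rfl fun i _ => (hD i).symm
    have j1 : Integrable (fun w => L * (TT α u w * TT α u w) + μ * TT α u w) (gaussianPi n) :=
      (hi2.const_mul _).add (hi1.const_mul _)
    have j2 : Integrable (fun w => 4 * (L * (TT α u w * TT α u w) + μ * TT α u w -
        TT α u w * TT α u w)) (gaussianPi n) := (j1.sub hi2).const_mul _
    have j3 : Integrable (fun w => TT α u w * TT α u w - 2 * μ * TT α u w) (gaussianPi n) :=
      hi2.sub (hi1.const_mul _)
    have hIntg : ∫ w, 4 * (L * (TT α u w * TT α u w) + μ * TT α u w - TT α u w * TT α u w)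
        ∂(gaussianPi n) = 4 * (L * BB θ u u + μ * μ - BB θ u u) := by
      rw [integral_const_mul, integral_sub j1 hi2,
        integral_add (hi2.const_mul _) (hi1.const_mul _), integral_const_mul, integral_const_mul,
        hN, hTi]
    have hvar : μ * μ ≤ BB θ u u := by
      have h10 : 0 ≤ ∫ w, (TT α u w * TT α u w - 2 * μ * TT α u w + μ * μ) ∂(gaussianPi n) :=
        integral_nonneg fun w => by
          simp only [Pi.zero_apply]
          nlinarith [sq_nonneg (TT α u w - μ)]
      rw [integral_add j3 (integrable_const _),
        integral_sub hi2 (hi1.const_mul _), integral_const_mul, hN, hTi] at h10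
      simp at h10
      linarith
    rw [hsum]
    refine (integral_mono (integrable_finsetSum _ fun i _ => hi3 i)
      j2 hpt).trans ?_
    rw [hIntg]
    linarith
  have hder : ∀ θ, HasDerivAt (fun θ => BB θ u u * Real.exp (-(4 * L * Real.cos θ)))
      ((-Real.sin θ * ∑ i, BB θ (pderiv u i) (pderiv u i)) * Real.exp (-(4 * L * Real.cos θ)) +
        BB θ u u * (Real.exp (-(4 * L * Real.cos θ)) * (4 * L * Real.sin θ))) θ := by
    intro θ
    refine (hasDeriv_BB hu hu θ).mul (HasDerivAt.exp ?_)
    exact (((Real.hasDerivAt_cos θ).const_mul (4 * L)).neg).congr_deriv (by ring)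
  have hmono : MonotoneOn (fun θ => BB θ u u * Real.exp (-(4 * L * Real.cos θ)))
      (Set.Icc (Real.pi / 3) (Real.pi / 2)) := by
    refine monotoneOn_of_deriv_nonneg (convex_Icc _ _) (fun t _ => (hder t).continuousAt.continuousWithinAt)
      (fun t _ => (hder t).differentiableAt.differentiableWithinAt) fun t ht => ?_
    rw [interior_Icc] at ht
    have ht' := Set.Ioo_subset_Icc_self ht
    rw [(hder t).deriv]
    have h11 := main t ht'
    have hs : 0 < Real.sin t := Real.sin_pos_of_pos_of_lt_pi (by linarith [ht.1]) (by linarith [ht.2])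
    have he := Real.exp_pos (-(4 * L * Real.cos t))
    have := mul_nonneg (mul_nonneg hs.le he.le) (sub_nonneg.2 h11)
    nlinarith
  have := hmono hθ ⟨by linarith, le_rfl⟩ hθ.2
  simp only [BB_pi_half, Real.cos_pi_div_two, mul_zero, neg_zero, Real.exp_zero, mul_one] at this
  rw [Real.exp_neg, ← div_eq_mul_inv, div_le_iff₀ (Real.exp_pos _)] at this
  rw [← hμd] at this
  rw [sq]; exact this

lemma BB_tendsto (θ : ℝ) {F G : ℕ → (Fin n → ℝ) → ℝ} {f g : (Fin n → ℝ) → ℝ}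
    (hF : ∀ k, Continuous (F k)) (hG : ∀ k, Continuous (G k)) {C D : ℝ}
    (hC : ∀ k x, |F k x| ≤ C) (hD : ∀ k x, |G k x| ≤ D)
    (hFf : ∀ x, Tendsto (fun k => F k x) atTop (𝓝 (f x)))
    (hGg : ∀ x, Tendsto (fun k => G k x) atTop (𝓝 (g x))) :
    Tendsto (fun k => BB θ (F k) (G k)) atTop (𝓝 (BB θ f g)) := by
  refine tendsto_integral_of_dominated_convergence (fun _ => C * D) (fun k => ?_)
    (integrable_const _) (fun k => Eventually.of_forall fun z => ?_)
    (Eventually.of_forall fun z => (hFf _).mul (hGg _))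
  · have := hF k
    have := hG k
    apply Continuous.aestronglyMeasurable; fun_prop
  · rw [norm_mul]
    exact mul_le_mul (hC _ _) (hD _ _) (abs_nonneg _) ((abs_nonneg _).trans (hC k 0))

lemma int_tendsto {F : ℕ → (Fin n → ℝ) → ℝ} {f : (Fin n → ℝ) → ℝ}
    (hF : ∀ k, Continuous (F k)) {C : ℝ} (hC : ∀ k x, |F k x| ≤ C)
    (hFf : ∀ x, Tendsto (fun k => F k x) atTop (𝓝 (f x))) :
    Tendsto (fun k => ∫ x, F k x ∂(gaussianPi n)) atTop (𝓝 (∫ x, f x ∂(gaussianPi n))) :=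
  tendsto_integral_of_dominated_convergence (fun _ => C) (fun k => (hF k).aestronglyMeasurable)
    (integrable_const _) (fun k => Eventually.of_forall fun z => hC _ _)
    (Eventually.of_forall fun z => hFf z)

lemma hyper {u : (Fin n → ℝ) → ℝ} (hu : Continuous u) (h0 : ∀ x, 0 ≤ u x) (h1 : ∀ x, u x ≤ 1)
    (hμ : 0 < ∫ x, u x ∂(gaussianPi n)) {θ : ℝ} (hθ : θ ∈ Set.Icc (Real.pi / 3) (Real.pi / 2)) :
    BB θ u u ≤ (∫ x, u x ∂(gaussianPi n)) ^ 2 *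
      Real.exp (4 * Real.log (1 / ∫ x, u x ∂(gaussianPi n)) * Real.cos θ) := by
  obtain ⟨F, hF, hFr, hFt, -⟩ := mollify hu (l := 0) (u := 1) fun x => ⟨h0 x, h1 x⟩
  have hb : ∀ k x, |F k x| ≤ 1 := fun k x => by
    rw [abs_of_nonneg (hFr k x).1]; exact (hFr k x).2
  have hFc := fun k => (hF k).cd.continuous
  have t1 := BB_tendsto θ hFc hFc hb hb hFt hFt
  have t2 := int_tendsto hFc hb hFt
  have t3 : Tendsto (fun k => (∫ x, F k x ∂(gaussianPi n)) ^ 2 *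
      Real.exp (4 * Real.log (1 / ∫ x, F k x ∂(gaussianPi n)) * Real.cos θ)) atTop
      (𝓝 ((∫ x, u x ∂(gaussianPi n)) ^ 2 *
      Real.exp (4 * Real.log (1 / ∫ x, u x ∂(gaussianPi n)) * Real.cos θ))) := by
    refine (t2.pow 2).mul ?_
    refine (Real.continuous_exp.tendsto _).comp ?_
    refine Tendsto.mul_const _ (Tendsto.const_mul _ ?_)
    exact (tendsto_const_nhds.div t2 hμ.ne').log (by positivity)
  refine le_of_tendsto_of_tendsto t1 t3 ?_
  filter_upwards [t2.eventually (lt_mem_nhds hμ)] with k hk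
  exact hyper_nice (hF k) (fun x => (hFr k x).1) (fun x => (hFr k x).2) hk hθ

set_option maxHeartbeats 2000000 in
/-- Noise stability lower bound for two functions with small correlation. -/
lemma stab {u v : (Fin n → ℝ) → ℝ} (hu : Continuous u) (hv : Continuous v)
    (hu0 : ∀ x, 0 ≤ u x) (hu1 : ∀ x, u x ≤ 1) (hv0 : ∀ x, 0 ≤ v x) (hv1 : ∀ x, v x ≤ 1)
    (hμ : 0 < ∫ x, u x ∂(gaussianPi n)) (hν : 0 < ∫ x, v x ∂(gaussianPi n))
    {a b θ : ℝ} (ha : 1 ≤ a) (hb : 1 ≤ b)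
    (hla : Real.log (1 / ∫ x, u x ∂(gaussianPi n)) ≤ a ^ 2)
    (hlb : Real.log (1 / ∫ x, v x ∂(gaussianPi n)) ≤ b ^ 2)
    (hθ : θ ∈ Set.Icc 0 (Real.pi / 2)) (hc : Real.cos θ ≤ 1 / (16 * (a * b))) :
    (∫ x, u x ∂(gaussianPi n)) * (∫ x, v x ∂(gaussianPi n)) / 2 ≤ BB θ u v := by
  have hpi := Real.pi_pos
  have hub : ∀ x, |u x| ≤ 1 := fun x => by rw [abs_of_nonneg (hu0 x)]; exact hu1 x
  have hvb : ∀ x, |v x| ≤ 1 := fun x => by rw [abs_of_nonneg (hv0 x)]; exact hv1 x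
  set μ := ∫ x, u x ∂(gaussianPi n) with hμd
  set ν := ∫ x, v x ∂(gaussianPi n) with hνd
  have hab : 1 ≤ a * b := one_le_mul_of_one_le_of_one_le ha hb
  have hc0 : 0 ≤ Real.cos θ := Real.cos_nonneg_of_mem_Icc ⟨by linarith [hθ.1], hθ.2⟩
  have hcm : Real.cos θ * (a * b) ≤ 1 / 16 := by
    rw [le_div_iff₀ (by positivity)] at hc
    linarith
  have hs : 0 < Real.sin θ := by
    have h1 := Real.sin_sq_add_cos_sq θ
    have h2 : 0 ≤ Real.sin θ := Real.sin_nonneg_of_mem_Icc ⟨hθ.1, by linarith [hθ.2]⟩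
    have h3 : Real.cos θ ≤ 1 / 16 := by nlinarith
    rcases h2.eq_or_lt with h | h
    · rw [← h] at h1; nlinarith
    · exact h
  -- general one-function bound
  have one : ∀ (w : (Fin n → ℝ) → ℝ) (hw : Continuous w) (hw0 : ∀ x, 0 ≤ w x) (hw1 : ∀ x, w x ≤ 1)
      (hω : 0 < ∫ x, w x ∂(gaussianPi n)) (d r : ℝ) (hd : 1 ≤ d)
      (hld : Real.log (1 / ∫ x, w x ∂(gaussianPi n)) ≤ d ^ 2) (hr0 : 0 ≤ r)
      (hr : r ^ 2 * d ^ 2 ≤ 1 / 16),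
      ∫ x, TT (Real.arccos r) w x * TT (Real.arccos r) w x ∂(gaussianPi n) ≤
        3 / 2 * (∫ x, w x ∂(gaussianPi n)) ^ 2 := by
    intro w hw hw0 hw1 hω d r hd hld hr0 hr
    have hwb : ∀ x, |w x| ≤ 1 := fun x => by rw [abs_of_nonneg (hw0 x)]; exact hw1 x
    have hr2 : r ^ 2 ≤ 1 / 16 := by
      nlinarith [mul_le_mul_of_nonneg_left (one_le_pow₀ hd : 1 ≤ d ^ 2) (sq_nonneg r)]
    have hr1 : r ≤ 1 := by nlinarith
    have hcr : Real.cos (Real.arccos r) = r := Real.cos_arccos (by linarith) hr1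
    have hcr2 : Real.cos (Real.arccos (r ^ 2)) = r ^ 2 :=
      Real.cos_arccos (by nlinarith) (by linarith)
    have hmem : Real.arccos (r ^ 2) ∈ Set.Icc (Real.pi / 3) (Real.pi / 2) := by
      constructor
      · by_contra hcon
        push Not at hcon
        have := Real.cos_lt_cos_of_nonneg_of_le_pi (Real.arccos_nonneg (r ^ 2))
          (by linarith) hcon
        rw [hcr2, Real.cos_pi_div_three] at this
        linarith
      · exact Real.arccos_le_pi_div_two.2 (sq_nonneg r)
    rw [semigroup (θ := Real.arccos (r ^ 2))
      (Real.sin_pos_of_pos_of_lt_pi (by linarith [hmem.1]) (by linarith [hmem.2]))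
      (Real.sin_nonneg_of_mem_Icc ⟨Real.arccos_nonneg _, Real.arccos_le_pi _⟩)
      (by rw [hcr, hcr2, sq]) hw hw hwb hwb]
    refine (hyper hw hw0 hw1 hω hmem).trans ?_
    rw [hcr2, mul_comm]
    refine mul_le_mul_of_nonneg_right ?_ (sq_nonneg _)
    have h14 : Real.exp (1 / 4 : ℝ) ≤ 3 / 2 := by
      have := Real.exp_bound_div_one_sub_of_interval (x := 1 / 4) (by norm_num) (by norm_num)
      linarith
    refine le_trans (Real.exp_le_exp.2 ?_) h14
    nlinarith [mul_le_mul_of_nonneg_right hld (sq_nonneg r)]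
  have ha0 : 0 < a := by linarith
  have hb0 : 0 < b := by linarith
  set r := √(Real.cos θ * b / a) with hr
  set s := √(Real.cos θ * a / b) with hs'
  have hr2 : r ^ 2 = Real.cos θ * b / a := Real.sq_sqrt (by positivity)
  have hs2 : s ^ 2 = Real.cos θ * a / b := Real.sq_sqrt (by positivity)
  have hra : r ^ 2 * a ^ 2 ≤ 1 / 16 := by
    rw [hr2]; refine le_trans (le_of_eq ?_) hcm; field_simp
  have hsb : s ^ 2 * b ^ 2 ≤ 1 / 16 := by
    rw [hs2]; refine le_trans (le_of_eq ?_) hcm; field_simp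
  have hr0 : 0 ≤ r := Real.sqrt_nonneg _
  have hs0 : 0 ≤ s := Real.sqrt_nonneg _
  have hr2' : r ^ 2 ≤ 1 / 16 := by
    nlinarith [mul_le_mul_of_nonneg_left (one_le_pow₀ ha : 1 ≤ a ^ 2) (sq_nonneg r)]
  have hs2' : s ^ 2 ≤ 1 / 16 := by
    nlinarith [mul_le_mul_of_nonneg_left (one_le_pow₀ hb : 1 ≤ b ^ 2) (sq_nonneg s)]
  have hr1 : r ≤ 1 := by clear_value r s; nlinarith
  have hs1 : s ≤ 1 := by clear_value r s; nlinarith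
  have hrs : Real.cos θ = r * s := by
    rw [hr, hs', ← Real.sqrt_mul (by positivity)]
    rw [show Real.cos θ * b / a * (Real.cos θ * a / b) = Real.cos θ ^ 2 by field_simp,
      Real.sqrt_sq hc0]
  have A := one u hu hu0 hu1 hμ a r ha hla hr0 hra
  have B := one v hv hv0 hv1 hν b s hb hlb hs0 hsb
  have hsg := semigroup (α := Real.arccos r) (β := Real.arccos s) hs
    (Real.sin_nonneg_of_mem_Icc ⟨Real.arccos_nonneg _, Real.arccos_le_pi _⟩)
    (by rw [Real.cos_arccos (by linarith) hr1, Real.cos_arccos (by linarith) hs1, hrs])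
    hu hv hub hvb
  rw [← hsg]
  have iu := TT_integral (Real.arccos r) hu hub
  have iv := TT_integral (Real.arccos s) hv hvb
  have cu := TT_cont (Real.arccos r) hu hub
  have cv := TT_cont (Real.arccos s) hv hvb
  have bu := TT_bd (Real.arccos r) hub
  have bv := TT_bd (Real.arccos s) hvb
  rw [← hμd] at iu A
  rw [← hνd] at iv B
  set P := TT (Real.arccos r) u
  set Q := TT (Real.arccos s) v
  have mulb : ∀ {p q : (Fin n → ℝ) → ℝ}, Continuous p → Continuous q → (∀ x, |p x| ≤ 1) →
      (∀ x, |q x| ≤ 1) → Integrable (fun x => p x * q x) (gaussianPi n) := by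
    intro p q hp hq h1 h2
    refine bdd_int _ (by fun_prop) (C := 1 * 1) fun x => ?_
    rw [abs_mul]; exact mul_le_mul (h1 x) (h2 x) (abs_nonneg _) zero_le_one
  have iP := bdd_int (gaussianPi n) cu bu
  have iQ := bdd_int (gaussianPi n) cv bv
  have iPP := mulb cu cu bu bu
  have iQQ := mulb cv cv bv bv
  have iPQ := mulb cu cv bu bv
  -- 0 ≤ ∫ (ν (P - μ) + μ (Q - ν))²
  have hnn : 0 ≤ ∫ x, (ν ^ 2 * (P x * P x) + μ ^ 2 * (Q x * Q x) + 2 * μ * ν * (P x * Q x)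
      - 4 * μ * ν ^ 2 * P x - 4 * μ ^ 2 * ν * Q x + 4 * μ ^ 2 * ν ^ 2) ∂(gaussianPi n) :=
    integral_nonneg fun x => by
      simp only [Pi.zero_apply]
      nlinarith [sq_nonneg (ν * (P x - μ) + μ * (Q x - ν))]
  have k1 : Integrable (fun x => ν ^ 2 * (P x * P x) + μ ^ 2 * (Q x * Q x)) (gaussianPi n) :=
    (iPP.const_mul _).add (iQQ.const_mul _)
  have k2 : Integrable (fun x => ν ^ 2 * (P x * P x) + μ ^ 2 * (Q x * Q x) +
      2 * μ * ν * (P x * Q x)) (gaussianPi n) := k1.add (iPQ.const_mul _)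
  have k3 : Integrable (fun x => ν ^ 2 * (P x * P x) + μ ^ 2 * (Q x * Q x) +
      2 * μ * ν * (P x * Q x) - 4 * μ * ν ^ 2 * P x) (gaussianPi n) := k2.sub (iP.const_mul _)
  have k4 : Integrable (fun x => ν ^ 2 * (P x * P x) + μ ^ 2 * (Q x * Q x) +
      2 * μ * ν * (P x * Q x) - 4 * μ * ν ^ 2 * P x - 4 * μ ^ 2 * ν * Q x) (gaussianPi n) :=
    k3.sub (iQ.const_mul _)
  rw [integral_add k4 (integrable_const _), integral_sub k3 (iQ.const_mul _),
    integral_sub k2 (iP.const_mul _), integral_add k1 (iPQ.const_mul _),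
    integral_add (iPP.const_mul _) (iQQ.const_mul _)] at hnn
  simp only [integral_const_mul, iu, iv, integral_const, probReal_univ, smul_eq_mul, one_mul] at hnn
  have hμν : 0 < μ * ν := mul_pos hμ hν
  have h20 := mul_le_mul_of_nonneg_left A (sq_nonneg ν)
  have h21 := mul_le_mul_of_nonneg_left B (sq_nonneg μ)
  have h22 : 0 ≤ (μ * ν) * (2 * (∫ x, P x * Q x ∂(gaussianPi n)) - μ * ν) := by nlinarith
  have h23 := nonneg_of_mul_nonneg_right h22 hμν
  linarith

end GT

open MeasureTheory ProbabilityTheory Filter Pointwise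
open scoped Topology

namespace GT
variable {n : ℕ}

lemma pdf_le (t : ℝ) : gaussianPDFReal 0 1 t ≤ 1 / 2 * Real.exp (-t ^ 2 / 2) := by
  rw [pdf_eq]
  refine mul_le_mul_of_nonneg_right ?_ (Real.exp_pos _).le
  rw [one_div]
  apply inv_anti₀ (by norm_num)
  apply Real.le_sqrt_of_sq_le
  nlinarith [Real.pi_gt_three]

lemma line_int {h p : ℝ → ℝ} (hh : ∀ t, HasDerivAt h (p t) t) (hp : Continuous p)
    (hp0 : ∀ t, 0 ≤ p t) (hb : ∀ t, |h t| ≤ 1) : Integrable p ∧ ∫ t, p t ≤ 2 := by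
  have hI : ∀ k : ℕ, ∫ t in (-(k : ℝ))..(k : ℝ), p t ≤ 2 := by
    intro k
    rw [intervalIntegral.integral_eq_sub_of_hasDerivAt (fun t _ => hh t)
      (hp.intervalIntegrable _ _)]
    have := abs_le.1 (hb k)
    have := abs_le.1 (hb (-k))
    linarith
  have ha : Tendsto (fun k : ℕ => -(k : ℝ)) atTop atBot :=
    tendsto_neg_atTop_atBot.comp tendsto_natCast_atTop_atTop
  have hb' : Tendsto (fun k : ℕ => (k : ℝ)) atTop atTop := tendsto_natCast_atTop_atTop
  have hIntg : Integrable p := by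
    refine integrable_of_intervalIntegral_norm_bounded 2
      (fun k => (hp.integrableOn_Icc).mono_set Set.Ioc_subset_Icc_self) ha hb'
      (Eventually.of_forall fun k => ?_)
    simp only [Real.norm_eq_abs, abs_of_nonneg (hp0 _)]
    exact hI k
  exact ⟨hIntg, le_of_tendsto (intervalIntegral_tendsto_integral hIntg ha hb')
    (Eventually.of_forall hI)⟩

lemma line_bd {h p : ℝ → ℝ} (hh : ∀ t, HasDerivAt h (p t) t) (hp : Continuous p)
    (hp0 : ∀ t, 0 ≤ p t) (hb : ∀ t, |h t| ≤ 1) {K : ℝ} (hK : ∀ t, |p t| ≤ K) :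
    ∫ t, p t ∂_root_.stdGaussian ≤ 1 := by
  obtain ⟨h1, h2⟩ := line_int hh hp hp0 hb
  have hi := (std_integrable_iff p).1 (bdd_int _ hp hK)
  rw [std_integral]
  calc _ ≤ ∫ t, 1 / 2 * p t := by
        refine integral_mono hi (h1.const_mul _) fun t => mul_le_mul_of_nonneg_right ?_ (hp0 t)
        refine (pdf_le t).trans ?_
        have : Real.exp (-t ^ 2 / 2) ≤ 1 := Real.exp_le_one_iff.2 (by nlinarith [sq_nonneg t])
        linarith
    _ ≤ 1 := by rw [integral_const_mul]; linarith

lemma line_tail {h p : ℝ → ℝ} (hh : ∀ t, HasDerivAt h (p t) t) (hp : Continuous p)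
    (hp0 : ∀ t, 0 ≤ p t) (hb : ∀ t, |h t| ≤ 1) {K : ℝ} (hK : ∀ t, |p t| ≤ K) {M : ℝ} (hM : 0 ≤ M) :
    ∫ t, p t ∂_root_.stdGaussian ≤
      ∫ t in Set.Icc (-M) M, p t ∂_root_.stdGaussian + Real.exp (-M ^ 2 / 2) := by
  obtain ⟨h1, h2⟩ := line_int hh hp hp0 hb
  have hi0 : Integrable p _root_.stdGaussian := bdd_int _ hp hK
  have hi := (std_integrable_iff p).1 hi0
  have hj := (std_integrable_iff _).1 (hi0.indicator (measurableSet_Icc (a := -M) (b := M)))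
  rw [← integral_indicator measurableSet_Icc, std_integral, std_integral]
  have hE := Real.exp_pos (-M ^ 2 / 2)
  calc _ ≤ ∫ t, (gaussianPDFReal 0 1 t * (Set.Icc (-M) M).indicator p t +
          Real.exp (-M ^ 2 / 2) / 2 * p t) := by
        refine integral_mono hi (hj.add (h1.const_mul _)) fun t => ?_
        simp only
        by_cases ht : t ∈ Set.Icc (-M) M
        · rw [Set.indicator_of_mem ht]
          have := mul_nonneg hE.le (hp0 t)
          linarith
        · rw [Set.indicator_of_notMem ht, mul_zero, zero_add]
          refine mul_le_mul_of_nonneg_right ?_ (hp0 t)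
          refine (pdf_le t).trans ?_
          have hMt : M ^ 2 ≤ t ^ 2 := by
            rw [Set.mem_Icc, ← abs_le] at ht
            push Not at ht
            rw [← sq_abs t]
            exact pow_le_pow_left₀ hM ht.le 2
          have : Real.exp (-t ^ 2 / 2) ≤ Real.exp (-M ^ 2 / 2) := Real.exp_le_exp.2 (by linarith)
          linarith
    _ ≤ _ := by
        rw [integral_add hj (h1.const_mul _), integral_const_mul]
        nlinarith

/-- one-dimensional kernel comparison -/
lemma kernel1 {q : ℝ → ℝ} (hq : Continuous q) (hq0 : ∀ t, 0 ≤ q t) {K : ℝ} (hK : ∀ t, |q t| ≤ K)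
    {ρ σ M N s : ℝ} (hρ : 0 ≤ ρ) (hσ : 0 < σ) (h1 : ρ ^ 2 + σ ^ 2 = 1) (hM : 1 ≤ M) (hN : 1 ≤ N)
    (hMN : ρ * (M * N) ≤ 1 / 8) (hs : |s| ≤ M) :
    Real.exp (-1) * ∫ y in Set.Icc (-N) N, q y ∂_root_.stdGaussian ≤
      ∫ t, q (ρ * s + σ * t) ∂_root_.stdGaussian := by
  have hi0 : Integrable q _root_.stdGaussian := bdd_int _ hq hK
  have hi2 : Integrable (fun t => q (ρ * s + σ * t)) _root_.stdGaussian :=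
    bdd_int _ (by fun_prop) fun t => hK _
  have hi2' := (std_integrable_iff _).1 hi2
  have hj := (std_integrable_iff _).1 (hi0.indicator (measurableSet_Icc (a := -N) (b := N)))
  rw [← integral_indicator measurableSet_Icc, std_integral, std_integral]
  set ψ : ℝ → ℝ := fun y => gaussianPDFReal 0 1 y * (Set.Icc (-N) N).indicator q y with hψ
  have hcv : ∫ t, ψ (ρ * s + σ * t) = σ⁻¹ * ∫ y, ψ y := by
    rw [Measure.integral_comp_mul_left (fun y => ψ (ρ * s + y)) σ,
      integral_add_left_eq_self ψ (ρ * s), abs_of_pos (inv_pos.2 hσ), smul_eq_mul]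
  have hcvi : Integrable (fun t => ψ (ρ * s + σ * t)) := by
    have := hj.comp_add_left (ρ * s)
    exact this.comp_mul_left' hσ.ne'
  have hψ2 : ∫ y, ψ y = ∫ t, σ * ψ (ρ * s + σ * t) := by
    rw [integral_const_mul, hcv]; field_simp
  rw [hψ2, ← integral_const_mul]
  refine integral_mono ((hcvi.const_mul _).const_mul _) hi2' fun t => ?_
  simp only [hψ]
  have hpos : 0 ≤ gaussianPDFReal 0 1 t := gaussianPDFReal_nonneg _ _ _
  by_cases hy : ρ * s + σ * t ∈ Set.Icc (-N) N
  · rw [Set.indicator_of_mem hy]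
    have hσ1 : σ ≤ 1 := by nlinarith [sq_nonneg ρ]
    have hle : Real.exp (-1) * gaussianPDFReal 0 1 (ρ * s + σ * t) ≤ gaussianPDFReal 0 1 t := by
      rw [pdf_eq, pdf_eq, mul_left_comm, ← Real.exp_add]
      refine mul_le_mul_of_nonneg_left (Real.exp_le_exp.2 ?_) (by positivity)
      rw [Set.mem_Icc, ← abs_le] at hy
      set y := ρ * s + σ * t with hyd
      have hρs : ρ * |s| ≤ 1 / 8 := by
        have : ρ * |s| ≤ ρ * (M * N) := mul_le_mul_of_nonneg_left (by nlinarith) hρ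
        linarith
      have hρy : ρ * |y| ≤ 1 / 8 := by
        have : ρ * |y| ≤ ρ * (M * N) := mul_le_mul_of_nonneg_left (by nlinarith) hρ
        linarith
      have hρ1 : ρ ≤ 1 / 8 := by
        have : ρ * 1 ≤ ρ * (M * N) := mul_le_mul_of_nonneg_left (by nlinarith) hρ
        linarith
      have hsy : ρ * (|s| * |y|) ≤ 1 / 8 := by
        have : ρ * (|s| * |y|) ≤ ρ * (M * N) := mul_le_mul_of_nonneg_left
          (mul_le_mul hs hy (abs_nonneg _) (by linarith)) hρ
        linarith
      have e1 : (ρ * s) ^ 2 ≤ 1 / 64 := by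
        rw [mul_pow, ← sq_abs s, ← mul_pow]
        have := mul_nonneg hρ (abs_nonneg s); nlinarith
      have e2 : (ρ * y) ^ 2 ≤ 1 / 64 := by
        rw [mul_pow, ← sq_abs y, ← mul_pow]
        have := mul_nonneg hρ (abs_nonneg y); nlinarith
      have e3 : -(ρ * (s * y)) ≤ 1 / 8 := by
        rw [← abs_mul] at hsy
        have := mul_le_mul_of_nonneg_left (neg_le_abs (s * y)) hρ
        linarith
      have hσ2 : 63 / 64 ≤ σ ^ 2 := by nlinarith
      have ht : (σ * t) ^ 2 = (y - ρ * s) ^ 2 := by rw [hyd]; ring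
      -- σ² (t² - y²) = ρ² y² - 2 ρ s y + ρ² s²
      have e4 : σ ^ 2 * (t ^ 2 - y ^ 2) ≤ σ ^ 2 * 2 := by
        have : σ ^ 2 * (t ^ 2 - y ^ 2) = (ρ * y) ^ 2 - 2 * (ρ * (s * y)) + (ρ * s) ^ 2 := by
          linear_combination ht - y ^ 2 * h1
        rw [this]; linarith
      have e5 := le_of_mul_le_mul_left e4 (by positivity)
      linarith
    have hq' := hq0 (ρ * s + σ * t)
    have h5 := mul_le_mul_of_nonneg_right hle hq'
    have h6 : 0 ≤ Real.exp (-1) * gaussianPDFReal 0 1 (ρ * s + σ * t) * q (ρ * s + σ * t) :=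
      mul_nonneg (mul_nonneg (Real.exp_pos _).le (gaussianPDFReal_nonneg _ _ _)) hq'
    nlinarith
  · rw [Set.indicator_of_notMem hy]
    simp only [mul_zero]
    exact mul_nonneg hpos (hq0 _)

/-- truncated averaging in the coordinate `i` -/
noncomputable def tr (M : ℝ) (i : Fin n) (p : (Fin n → ℝ) → ℝ) (x : Fin n → ℝ) : ℝ :=
  ∫ t in Set.Icc (-M) M, p (Function.update x i t) ∂_root_.stdGaussian

lemma tr_cont (M : ℝ) (i : Fin n) {p : (Fin n → ℝ) → ℝ} (hp : Continuous p) {K : ℝ}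
    (hK : ∀ x, |p x| ≤ K) : Continuous (tr M i p) := by
  unfold tr
  refine continuous_of_dominated (bound := fun _ => K) (fun w => ?_)
    (fun w => Eventually.of_forall fun z => hK _) (integrable_const _)
    (Eventually.of_forall fun z => ?_)
  · apply Continuous.aestronglyMeasurable
    exact hp.comp (continuous_const.update i continuous_id)
  · exact hp.comp (continuous_id.update i continuous_const)

lemma BB_eq (θ : ℝ) {p q : (Fin n → ℝ) → ℝ} (hp : Continuous p) (hq : Continuous q) {C D : ℝ}
    (hC : ∀ x, |p x| ≤ C) (hD : ∀ x, |q x| ≤ D) :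
    BB θ p q = ∫ x, p x * TT θ q x ∂(gaussianPi n) := by
  rw [BB, integral_prod]
  · refine integral_congr_ae (Eventually.of_forall fun x => ?_)
    simp only
    rw [integral_const_mul]; rfl
  · refine bdd_int _ (by fun_prop) (C := C * D) fun z => ?_
    rw [abs_mul]
    exact mul_le_mul (hC _) (hD _) (abs_nonneg _) ((abs_nonneg _).trans (hC 0))

lemma upd_comb (i : Fin n) (x z : Fin n → ℝ) (ρ σ s t : ℝ) :
    ρ • Function.update x i s + σ • Function.update z i t =
      Function.update (ρ • x + σ • z) i (ρ * s + σ * t) := by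
  ext j
  by_cases h : j = i
  · subst h; simp
  · simp [h]

lemma kernelN (i : Fin n) {p q : (Fin n → ℝ) → ℝ} (hp : Continuous p) (hq : Continuous q)
    (hp0 : ∀ x, 0 ≤ p x) (hq0 : ∀ x, 0 ≤ q x) {C D : ℝ}
    (hC : ∀ x, |p x| ≤ C) (hD : ∀ x, |q x| ≤ D) {θ M N : ℝ} (hc : 0 ≤ Real.cos θ)
    (hs : 0 < Real.sin θ) (hM : 1 ≤ M) (hN : 1 ≤ N) (hMN : Real.cos θ * (M * N) ≤ 1 / 8)
    {C' D' : ℝ} (hC' : ∀ x, |tr M i p x| ≤ C') (hD' : ∀ x, |tr N i q x| ≤ D') :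
    Real.exp (-1) * BB θ (tr M i p) (tr N i q) ≤ BB θ p q := by
  have hpc := tr_cont M i hp hC
  have hqc := tr_cont N i hq hD
  have hTq := TT_cont θ hq hD
  have hTqb := TT_bd θ hD
  have hS := TT_cont θ hqc hD'
  have hSb := TT_bd θ hD'
  have hC0 := (abs_nonneg _).trans (hC 0)
  have hC0' := (abs_nonneg _).trans (hC' 0)
  have hTq0 : ∀ x, 0 ≤ TT θ q x := fun x => integral_nonneg fun z => hq0 _
  rw [BB_eq θ hp hq hC hD, BB_eq θ hpc hqc hC' hD', ← integral_const_mul]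
  have hpTb : ∀ x, |p x * TT θ q x| ≤ C * D := fun x => by
    rw [abs_mul]; exact mul_le_mul (hC _) (hTqb _) (abs_nonneg _) hC0
  have hpTi : Integrable (fun x => p x * TT θ q x) (gaussianPi n) := bdd_int _ (by fun_prop) hpTb
  rw [integral_update i hpTi]
  have hint2 := ((update_mp n i).integrable_comp_of_integrable hpTi).integral_prod_left
  refine integral_mono (bdd_int _ (by fun_prop) (C := Real.exp (-1) * (C' * D')) fun x => ?_)
    hint2 fun x => ?_
  · rw [abs_mul, abs_mul, abs_of_pos (Real.exp_pos _)]
    exact mul_le_mul_of_nonneg_left (mul_le_mul (hC' _) (hSb _) (abs_nonneg _) hC0')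
      (Real.exp_pos _).le
  simp only [Function.comp]
  have hcx : Continuous (fun s : ℝ => Function.update x i s) := continuous_const.update i continuous_id
  -- lower bound for the noise operator
  have key : ∀ s ∈ Set.Icc (-M) M, Real.exp (-1) * TT θ (tr N i q) x ≤
      TT θ q (Function.update x i s) := by
    intro s hsM
    have hz : Integrable (fun z => q (Real.cos θ • Function.update x i s + Real.sin θ • z))
        (gaussianPi n) := bdd_int _ (by fun_prop) fun z => hD _
    unfold TT
    rw [integral_update i hz, ← integral_const_mul]
    refine integral_mono (bdd_int _ (by fun_prop) (C := Real.exp (-1) * D') fun z => ?_)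
      ((update_mp n i).integrable_comp_of_integrable hz).integral_prod_left fun z => ?_
    · rw [abs_mul, abs_of_pos (Real.exp_pos _)]
      exact mul_le_mul_of_nonneg_left (hD' _) (Real.exp_pos _).le
    simp only [Function.comp, upd_comb]
    have hcz : Continuous (fun s : ℝ => Function.update (Real.cos θ • x + Real.sin θ • z) i s) :=
      continuous_const.update i continuous_id
    exact kernel1 (hq.comp hcz) (fun t => hq0 _) (fun t => hD _) hc hs
      (by rw [add_comm]; exact Real.sin_sq_add_cos_sq θ) hM hN hMN (abs_le.2 hsM)
  have hpi : Integrable (fun s => p (Function.update x i s)) _root_.stdGaussian :=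
    bdd_int _ (hp.comp hcx) fun s => hC _
  have hpti : Integrable (fun s => p (Function.update x i s) * TT θ q (Function.update x i s))
      _root_.stdGaussian :=
    bdd_int _ ((hp.comp hcx).mul (hTq.comp hcx)) fun s => hpTb _
  calc Real.exp (-1) * (tr M i p x * TT θ (tr N i q) x)
      = ∫ s in Set.Icc (-M) M, p (Function.update x i s) * (Real.exp (-1) * TT θ (tr N i q) x)
          ∂_root_.stdGaussian := by rw [integral_mul_const]; unfold tr; ring
    _ ≤ ∫ s in Set.Icc (-M) M, p (Function.update x i s) * TT θ q (Function.update x i s)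
          ∂_root_.stdGaussian := by
        refine setIntegral_mono_on (hpi.integrableOn.mul_const _) hpti.integrableOn
          measurableSet_Icc fun s hs => mul_le_mul_of_nonneg_left (key s hs) (hp0 _)
    _ ≤ _ := setIntegral_le_integral hpti
          (Eventually.of_forall fun s => mul_nonneg (hp0 _) (hTq0 _))

end GT

open MeasureTheory ProbabilityTheory Filter Pointwise
open scoped Topology

namespace GT
variable {n : ℕ}

lemma pderiv_nonneg {f : (Fin n → ℝ) → ℝ} (hf : Differentiable ℝ f) (hm : Monotone f) (i : Fin n)
    (x : Fin n → ℝ) : 0 ≤ pderiv f i x := by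
  have h := fiber_deriv hf i x (x i)
  rw [Function.update_eq_self] at h
  have hmono : Monotone (fun t => f (Function.update x i t)) :=
    fun s t hst => hm (update_le_update_iff.2 ⟨hst, fun _ _ => le_rfl⟩)
  rw [← h.deriv]
  exact hmono.deriv_nonneg

/-- Everything needed about one function and one coordinate. -/
lemma tr_facts {f : (Fin n → ℝ) → ℝ} (hf : Nice f) (hm : Monotone f) (h1 : ∀ x, |f x| ≤ 1)
    (i : Fin n) {M : ℝ} (hM : 0 ≤ M) :
    (∀ x, 0 ≤ tr M i (pderiv f i) x) ∧ (∀ x, tr M i (pderiv f i) x ≤ 1) ∧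
    (∫ x, pderiv f i x ∂(gaussianPi n) ≤ 1) ∧
    (∫ x, pderiv f i x ∂(gaussianPi n) - Real.exp (-M ^ 2 / 2) ≤
      ∫ x, tr M i (pderiv f i) x ∂(gaussianPi n)) := by
  obtain ⟨K, hK0, hK⟩ := hf.pbd
  have hpc := hf.pcont i
  have hp0 := pderiv_nonneg hf.diff hm i
  have hcx : ∀ x, Continuous (fun s : ℝ => pderiv f i (Function.update x i s)) :=
    fun x => hpc.comp (continuous_const.update i continuous_id)
  have hbd : ∀ x, ∫ t, pderiv f i (Function.update x i t) ∂_root_.stdGaussian ≤ 1 := fun x =>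
    line_bd (fiber_deriv hf.diff i x) (hcx x) (fun t => hp0 _) (fun t => h1 _) (fun t => hK i _)
  have htl : ∀ x, ∫ t, pderiv f i (Function.update x i t) ∂_root_.stdGaussian ≤
      tr M i (pderiv f i) x + Real.exp (-M ^ 2 / 2) := fun x =>
    line_tail (fiber_deriv hf.diff i x) (hcx x) (fun t => hp0 _) (fun t => h1 _) (fun t => hK i _) hM
  have hIntg : Integrable (pderiv f i) (gaussianPi n) := bdd_int _ hpc (hK i)
  have hint2 := ((update_mp n i).integrable_comp_of_integrable hIntg).integral_prod_left
  have t0 : ∀ x, 0 ≤ tr M i (pderiv f i) x := fun x => integral_nonneg fun t => hp0 _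
  have t1 : ∀ x, tr M i (pderiv f i) x ≤ 1 := fun x =>
    (setIntegral_le_integral (bdd_int _ (hcx x) fun t => hK i _)
      (Eventually.of_forall fun t => hp0 _)).trans (hbd x)
  have hti : Integrable (tr M i (pderiv f i)) (gaussianPi n) :=
    bdd_int _ (tr_cont M i hpc (hK i)) (C := 1) fun x => by rw [abs_of_nonneg (t0 x)]; exact t1 x
  refine ⟨t0, t1, ?_, ?_⟩
  · rw [integral_update i hIntg]
    refine (integral_mono hint2 (integrable_const 1) hbd).trans ?_
    simp
  · rw [integral_update i hIntg, sub_le_iff_le_add]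
    have hr : Integrable (fun x => tr M i (pderiv f i) x + Real.exp (-M ^ 2 / 2)) (gaussianPi n) :=
      hti.add (integrable_const _)
    refine (integral_mono hint2 hr htl).trans ?_
    rw [integral_add hti (integrable_const _)]
    simp

lemma tr_log {f : (Fin n → ℝ) → ℝ} (hf : Nice f) (hm : Monotone f) (h1 : ∀ x, |f x| ≤ 1)
    (i : Fin n) {a α : ℝ} (ha : a = ∫ x, pderiv f i x ∂(gaussianPi n)) (ha0 : 0 < a)
    (hα : α = √(Real.log (Real.exp 1 / a))) :
    1 ≤ α ∧ a / 2 ≤ ∫ x, tr (√2 * α) i (pderiv f i) x ∂(gaussianPi n) ∧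
    Real.log (1 / ∫ x, tr (√2 * α) i (pderiv f i) x ∂(gaussianPi n)) ≤ α ^ 2 := by
  have hα0 : 0 ≤ α := hα ▸ Real.sqrt_nonneg _
  obtain ⟨-, -, ha1, ht⟩ := tr_facts hf hm h1 i (M := √2 * α) (by positivity)
  rw [← ha] at ha1 ht
  have hl : Real.log (Real.exp 1 / a) = 1 - Real.log a := by
    rw [Real.log_div (Real.exp_pos _).ne' ha0.ne', Real.log_exp]
  have hl1 : 1 ≤ Real.log (Real.exp 1 / a) := by
    rw [hl]; linarith [Real.log_nonpos ha0.le ha1]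
  have hα2 : α ^ 2 = Real.log (Real.exp 1 / a) := by
    rw [hα, Real.sq_sqrt (by linarith)]
  have he2 : 2 ≤ Real.exp 1 := by linarith [Real.add_one_le_exp 1]
  have hexp : Real.exp (-(√2 * α) ^ 2 / 2) = a / Real.exp 1 := by
    rw [mul_pow, Real.sq_sqrt (by norm_num), hα2,
      show -(2 * Real.log (Real.exp 1 / a)) / 2 = -Real.log (Real.exp 1 / a) by ring,
      Real.exp_neg, Real.exp_log (by positivity), inv_div]
  have hae : a / Real.exp 1 ≤ a / 2 := by gcongr
  have hI : a / 2 ≤ ∫ x, tr (√2 * α) i (pderiv f i) x ∂(gaussianPi n) := by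
    rw [hexp] at ht; linarith
  refine ⟨?_, hI, ?_⟩
  · rw [hα]; exact Real.one_le_sqrt.2 hl1
  · rw [hα2]
    have hIp : 0 < ∫ x, tr (√2 * α) i (pderiv f i) x ∂(gaussianPi n) := by linarith
    refine Real.log_le_log (by positivity) ?_
    rw [div_le_div_iff₀ hIp ha0]
    nlinarith

lemma BB_lower {f g : (Fin n → ℝ) → ℝ} (hf : Nice f) (hg : Nice g) (hfm : Monotone f)
    (hgm : Monotone g) (hf1 : ∀ x, |f x| ≤ 1) (hg1 : ∀ x, |g x| ≤ 1) (i : Fin n) {a b α β : ℝ}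
    (ha : a = ∫ x, pderiv f i x ∂(gaussianPi n)) (ha0 : 0 < a)
    (hα : α = √(Real.log (Real.exp 1 / a)))
    (hb : b = ∫ x, pderiv g i x ∂(gaussianPi n)) (hb0 : 0 < b)
    (hβ : β = √(Real.log (Real.exp 1 / b))) {θ : ℝ} (hθ : θ ∈ Set.Icc 0 (Real.pi / 2))
    (hc : Real.cos θ ≤ 1 / (16 * (α * β))) :
    Real.exp (-1) * (a * b / 8) ≤ BB θ (pderiv f i) (pderiv g i) := by
  obtain ⟨hα1, hI, hlI⟩ := tr_log hf hfm hf1 i ha ha0 hα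
  obtain ⟨hβ1, hJ, hlJ⟩ := tr_log hg hgm hg1 i hb hb0 hβ
  obtain ⟨p0, p1, -, -⟩ := tr_facts hf hfm hf1 i (M := √2 * α) (by positivity)
  obtain ⟨q0, q1, -, -⟩ := tr_facts hg hgm hg1 i (M := √2 * β) (by positivity)
  obtain ⟨K, hK0, hK⟩ := hf.pbd
  obtain ⟨L, hL0, hL⟩ := hg.pbd
  have hc0 : 0 ≤ Real.cos θ := Real.cos_nonneg_of_mem_Icc ⟨by linarith [hθ.1, Real.pi_pos], hθ.2⟩
  have hαβ : 1 ≤ α * β := by nlinarith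
  have hcm : Real.cos θ * (α * β) ≤ 1 / 16 := by
    rw [le_div_iff₀ (by positivity)] at hc; linarith
  have hs : 0 < Real.sin θ := by
    have h1 := Real.sin_sq_add_cos_sq θ
    have h2 : 0 ≤ Real.sin θ := Real.sin_nonneg_of_mem_Icc ⟨hθ.1, by linarith [hθ.2, Real.pi_pos]⟩
    have h3 : Real.cos θ ≤ 1 / 16 := by nlinarith
    rcases h2.eq_or_lt with h | h
    · rw [← h] at h1; nlinarith
    · exact h
  have h2 : 1 ≤ √2 := Real.one_le_sqrt.2 (by norm_num)
  have h22 : √2 * √2 = 2 := Real.mul_self_sqrt (by norm_num)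
  have hk := kernelN i (hf.pcont i) (hg.pcont i) (pderiv_nonneg hf.diff hfm i)
    (pderiv_nonneg hg.diff hgm i) (hK i) (hL i) (θ := θ) (M := √2 * α) (N := √2 * β) hc0 hs
    (by nlinarith) (by nlinarith)
    (by
      have : Real.cos θ * (√2 * α * (√2 * β)) = (√2 * √2) * (Real.cos θ * (α * β)) := by ring
      rw [this, h22]; linarith)
    (C' := 1) (D' := 1) (fun x => by rw [abs_of_nonneg (p0 x)]; exact p1 x)
    (fun x => by rw [abs_of_nonneg (q0 x)]; exact q1 x)
  refine le_trans (mul_le_mul_of_nonneg_left ?_ (Real.exp_pos _).le) hk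
  refine le_trans ?_ (stab (tr_cont _ i (hf.pcont i) (hK i)) (tr_cont _ i (hg.pcont i) (hL i))
    p0 p1 q0 q1 (by linarith) (by linarith) hα1 hβ1 hlI hlJ hθ hc)
  have := mul_le_mul hI hJ (by linarith) (by linarith)
  linarith

lemma BB_cont {p q : (Fin n → ℝ) → ℝ} (hp : Continuous p) (hq : Continuous q) {C D : ℝ}
    (hC : ∀ x, |p x| ≤ C) (hD : ∀ x, |q x| ≤ D) : Continuous (fun θ => BB θ p q) := by
  unfold BB
  refine continuous_of_dominated (bound := fun _ => C * D) (fun θ => ?_)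
    (fun θ => Eventually.of_forall fun z => ?_) (integrable_const _)
    (Eventually.of_forall fun z => by fun_prop)
  · apply Continuous.aestronglyMeasurable; fun_prop
  · rw [norm_mul]
    exact mul_le_mul (hC _) (hD _) (abs_nonneg _) ((abs_nonneg _).trans (hC 0))

/-- the summand -/
noncomputable def term (a b : ℝ) : ℝ :=
  a * b / √(Real.log (Real.exp 1 / a) * Real.log (Real.exp 1 / b))

lemma nice_case {f g : (Fin n → ℝ) → ℝ} (hf : Nice f) (hg : Nice g) (hfm : Monotone f)
    (hgm : Monotone g) (hf1 : ∀ x, |f x| ≤ 1) (hg1 : ∀ x, |g x| ≤ 1) :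
    Real.exp (-1) / 128 * ∑ i, term (∫ x, pderiv f i x ∂(gaussianPi n))
      (∫ x, pderiv g i x ∂(gaussianPi n)) ≤
    (∫ x, f x * g x ∂(gaussianPi n)) -
      (∫ x, f x ∂(gaussianPi n)) * (∫ x, g x ∂(gaussianPi n)) := by
  obtain ⟨K, hK0, hK⟩ := hf.pbd
  obtain ⟨L, hL0, hL⟩ := hg.pbd
  have hcont : ∀ i, Continuous (fun θ => Real.sin θ * BB θ (pderiv f i) (pderiv g i)) := fun i =>
    Real.continuous_sin.mul (BB_cont (hf.pcont i) (hg.pcont i) (hK i) (hL i))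
  have hBB0 : ∀ i θ, 0 ≤ BB θ (pderiv f i) (pderiv g i) := fun i θ =>
    integral_nonneg fun z => mul_nonneg (pderiv_nonneg hf.diff hfm i _)
      (pderiv_nonneg hg.diff hgm i _)
  have hftc : ∫ θ in (0 : ℝ)..(Real.pi / 2),
      ∑ i, Real.sin θ * BB θ (pderiv f i) (pderiv g i) =
      BB 0 f g - BB (Real.pi / 2) f g := by
    rw [intervalIntegral.integral_eq_sub_of_hasDerivAt (f := fun θ => -BB θ f g)]
    · ring
    · intro θ _
      refine (hasDeriv_BB hf hg θ).neg.congr_deriv ?_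
      rw [neg_mul, neg_neg, Finset.mul_sum]
    · exact (continuous_finsetSum _ fun i _ => hcont i).intervalIntegrable _ _
  rw [← BB_zero, ← BB_pi_half, ← hftc,
    intervalIntegral.integral_finsetSum fun i _ => (hcont i).intervalIntegrable _ _, Finset.mul_sum]
  refine Finset.sum_le_sum fun i _ => ?_
  have hpi := Real.pi_pos
  have hsn : ∀ θ ∈ Set.Icc 0 (Real.pi / 2), 0 ≤ Real.sin θ * BB θ (pderiv f i) (pderiv g i) :=
    fun θ hθ => mul_nonneg (Real.sin_nonneg_of_mem_Icc ⟨hθ.1, by linarith [hθ.2]⟩) (hBB0 i θ)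
  have ha0 : 0 ≤ ∫ x, pderiv f i x ∂(gaussianPi n) :=
    integral_nonneg fun x => pderiv_nonneg hf.diff hfm i x
  have hb0 : 0 ≤ ∫ x, pderiv g i x ∂(gaussianPi n) :=
    integral_nonneg fun x => pderiv_nonneg hg.diff hgm i x
  obtain ⟨a, ha⟩ : ∃ a, a = ∫ x, pderiv f i x ∂(gaussianPi n) := ⟨_, rfl⟩
  obtain ⟨b, hb⟩ : ∃ b, b = ∫ x, pderiv g i x ∂(gaussianPi n) := ⟨_, rfl⟩
  rw [← ha] at ha0
  rw [← hb] at hb0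
  rw [← ha, ← hb]
  have hnn : 0 ≤ ∫ θ in (0 : ℝ)..(Real.pi / 2), Real.sin θ * BB θ (pderiv f i) (pderiv g i) :=
    intervalIntegral.integral_nonneg (by positivity) hsn
  rcases ha0.eq_or_lt with h | ha0
  · rw [← h]; simpa [term] using hnn
  rcases hb0.eq_or_lt with h | hb0
  · rw [← h]; simpa [term] using hnn
  obtain ⟨α, hα⟩ : ∃ α, α = √(Real.log (Real.exp 1 / a)) := ⟨_, rfl⟩
  obtain ⟨β, hβ⟩ : ∃ β, β = √(Real.log (Real.exp 1 / b)) := ⟨_, rfl⟩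
  obtain ⟨hα1, -, -⟩ := tr_log hf hfm hf1 i ha ha0 hα
  obtain ⟨hβ1, -, -⟩ := tr_log hg hgm hg1 i hb hb0 hβ
  have hαβ : 1 ≤ α * β := by nlinarith
  have hterm : term a b = a * b / (α * β) := by
    have : 0 ≤ Real.log (Real.exp 1 / a) := by
      by_contra hcon
      push Not at hcon
      rw [Real.sqrt_eq_zero_of_nonpos hcon.le] at hα
      linarith
    rw [term, Real.sqrt_mul this, ← hα, ← hβ]
  set r := 1 / (16 * (α * β)) with hr
  have hr0 : 0 < r := by positivity
  have hr1 : r ≤ 1 := by rw [hr, div_le_one (by positivity)]; linarith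
  have hcr : Real.cos (Real.arccos r) = r := Real.cos_arccos (by linarith) hr1
  have hle : Real.arccos r ≤ Real.pi / 2 := Real.arccos_le_pi_div_two.2 hr0.le
  have h0 := Real.arccos_nonneg r
  have hci := fun u v => (hcont i).intervalIntegrable (μ := volume) u v
  rw [← intervalIntegral.integral_add_adjacent_intervals (hci 0 (Real.arccos r))
    (hci (Real.arccos r) (Real.pi / 2))]
  have A : 0 ≤ ∫ θ in (0 : ℝ)..(Real.arccos r), Real.sin θ * BB θ (pderiv f i) (pderiv g i) :=
    intervalIntegral.integral_nonneg h0 fun θ hθ => hsn θ ⟨hθ.1, hθ.2.trans hle⟩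
  have B : ∫ θ in (Real.arccos r)..(Real.pi / 2), Real.sin θ * (Real.exp (-1) * (a * b / 8)) ≤
      ∫ θ in (Real.arccos r)..(Real.pi / 2), Real.sin θ * BB θ (pderiv f i) (pderiv g i) := by
    refine intervalIntegral.integral_mono_on hle
      ((Real.continuous_sin.mul continuous_const).intervalIntegrable _ _) (hci _ _) fun θ hθ => ?_
    have hmem : θ ∈ Set.Icc 0 (Real.pi / 2) := ⟨h0.trans hθ.1, hθ.2⟩
    refine mul_le_mul_of_nonneg_left ?_
      (Real.sin_nonneg_of_mem_Icc ⟨hmem.1, by linarith [hmem.2]⟩)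
    refine BB_lower hf hg hfm hgm hf1 hg1 i ha ha0 hα hb hb0 hβ hmem ?_
    rw [← hr, ← hcr]
    exact Real.cos_le_cos_of_nonneg_of_le_pi h0 (by linarith [hθ.2]) hθ.1
  rw [intervalIntegral.integral_mul_const, integral_sin, hcr, Real.cos_pi_div_two] at B
  have hfin : Real.exp (-1) / 128 * term a b = (r - 0) * (Real.exp (-1) * (a * b / 8)) := by
    rw [hterm, hr]; field_simp; norm_num
  rw [hfin]
  linarith

lemma term_nonneg {a b : ℝ} (ha : 0 ≤ a) (hb : 0 ≤ b) : 0 ≤ term a b :=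
  div_nonneg (mul_nonneg ha hb) (Real.sqrt_nonneg _)

lemma term_tendsto {A B : ℕ → ℝ} {a b : ℝ} (hA : Tendsto A atTop (𝓝 a)) (hB : Tendsto B atTop (𝓝 b))
    (ha : 0 < a) (hb : 0 < b) (ha1 : a ≤ 1) (hb1 : b ≤ 1) :
    Tendsto (fun k => term (A k) (B k)) atTop (𝓝 (term a b)) := by
  have hl : ∀ {c : ℝ}, 0 < c → c ≤ 1 → 0 < Real.log (Real.exp 1 / c) := by
    intro c hc hc1
    rw [Real.log_div (Real.exp_pos _).ne' hc.ne', Real.log_exp]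
    linarith [Real.log_nonpos hc.le hc1]
  have ht : ∀ {C : ℕ → ℝ} {c : ℝ}, Tendsto C atTop (𝓝 c) → 0 < c →
      Tendsto (fun k => Real.log (Real.exp 1 / C k)) atTop (𝓝 (Real.log (Real.exp 1 / c))) := by
    intro C c hC hc
    exact (tendsto_const_nhds.div hC hc.ne').log (by positivity)
  refine (hA.mul hB).div ((ht hA ha).mul (ht hB hb)).sqrt ?_
  exact (Real.sqrt_pos.2 (mul_pos (hl ha ha1) (hl hb hb1))).ne'

lemma abs_le_one {f : (Fin n → ℝ) → ℝ} (h : ∀ x, f x ∈ Set.Icc (-1 : ℝ) 1) (x : Fin n → ℝ) :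
    |f x| ≤ 1 := abs_le.2 (h x)

/-- convergence of mean partial derivatives under mollification -/
lemma mean_tendsto {f : (Fin n → ℝ) → ℝ} (hf : Differentiable ℝ f) (hf1 : ∀ x, |f x| ≤ 1)
    {F : ℕ → (Fin n → ℝ) → ℝ} (hF : ∀ k, Nice (F k)) (hFm : ∀ k, Monotone (F k))
    (hF1 : ∀ k x, |F k x| ≤ 1)
    (hFf : ∀ x, Tendsto (fun k => F k x) atTop (𝓝 (f x))) (i : Fin n)
    (h : ∫ x, pderiv f i x ∂(gaussianPi n) ≠ 0) :
    Tendsto (fun k => ∫ x, pderiv (F k) i x ∂(gaussianPi n)) atTop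
      (𝓝 (∫ x, pderiv f i x ∂(gaussianPi n))) ∧ ∫ x, pderiv f i x ∂(gaussianPi n) ≤ 1 := by
  have hIntg : Integrable (pderiv f i) (gaussianPi n) := by
    by_contra hcon
    exact h (integral_undef hcon)
  have ht : Tendsto (fun k => ∫ x, pderiv (F k) i x ∂(gaussianPi n)) atTop
      (𝓝 (∫ x, pderiv f i x ∂(gaussianPi n))) := by
    rw [ibp i hf hf1 hIntg]
    simp only [fun k => (hF k).ibp i]
    refine tendsto_integral_of_dominated_convergence (fun x => ‖x i‖) (fun k => ?_)
      (coord_int n i).norm (fun k => Eventually.of_forall fun x => ?_)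
      (Eventually.of_forall fun x => (hFf x).const_mul _)
    · have := (hF k).diff.continuous
      apply Continuous.aestronglyMeasurable; fun_prop
    · rw [norm_mul]
      exact mul_le_of_le_one_right (norm_nonneg _) (hF1 k x)
  exact ⟨ht, le_of_tendsto ht (Eventually.of_forall fun k =>
    (tr_facts (hF k) (hFm k) (hF1 k) i le_rfl).2.2.1)⟩

lemma general_case {f g : (Fin n → ℝ) → ℝ} (hf : ContDiff ℝ 1 f) (hg : ContDiff ℝ 1 g)
    (hfm : Monotone f) (hgm : Monotone g) (hf1 : ∀ x, f x ∈ Set.Icc (-1 : ℝ) 1)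
    (hg1 : ∀ x, g x ∈ Set.Icc (-1 : ℝ) 1) :
    Real.exp (-1) / 128 * ∑ i, term (∫ x, pderiv f i x ∂(gaussianPi n))
      (∫ x, pderiv g i x ∂(gaussianPi n)) ≤
    (∫ x, f x * g x ∂(gaussianPi n)) -
      (∫ x, f x ∂(gaussianPi n)) * (∫ x, g x ∂(gaussianPi n)) := by
  classical
  obtain ⟨F, hF, hFr, hFf, hFm⟩ := mollify hf.continuous hf1
  obtain ⟨G, hG, hGr, hGg, hGm⟩ := mollify hg.continuous hg1
  have hFm := hFm hfm
  have hGm := hGm hgm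
  have hFb := fun k => abs_le_one (hFr k)
  have hGb := fun k => abs_le_one (hGr k)
  have hfd : Differentiable ℝ f := hf.differentiable one_ne_zero
  have hgd : Differentiable ℝ g := hg.differentiable one_ne_zero
  have hFc := fun k => (hF k).diff.continuous
  have hGc := fun k => (hG k).diff.continuous
  have hcov : Tendsto (fun k => (∫ x, F k x * G k x ∂(gaussianPi n)) -
      (∫ x, F k x ∂(gaussianPi n)) * (∫ x, G k x ∂(gaussianPi n))) atTop
      (𝓝 ((∫ x, f x * g x ∂(gaussianPi n)) -
      (∫ x, f x ∂(gaussianPi n)) * (∫ x, g x ∂(gaussianPi n)))) := by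
    have h1 := BB_tendsto 0 hFc hGc hFb hGb hFf hGg
    simp only [BB_zero] at h1
    exact h1.sub ((int_tendsto hFc hFb hFf).mul (int_tendsto hGc hGb hGg))
  let τ : ℕ → Fin n → ℝ := fun k i =>
    if ∫ x, pderiv f i x ∂(gaussianPi n) ≠ 0 ∧ ∫ x, pderiv g i x ∂(gaussianPi n) ≠ 0 then
      term (∫ x, pderiv (F k) i x ∂(gaussianPi n)) (∫ x, pderiv (G k) i x ∂(gaussianPi n)) else 0
  have hτ : ∀ i, Tendsto (fun k => τ k i) atTop (𝓝 (term (∫ x, pderiv f i x ∂(gaussianPi n))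
      (∫ x, pderiv g i x ∂(gaussianPi n)))) := by
    intro i
    by_cases h : ∫ x, pderiv f i x ∂(gaussianPi n) ≠ 0 ∧ ∫ x, pderiv g i x ∂(gaussianPi n) ≠ 0
    · simp only [τ, if_pos h]
      obtain ⟨tA, a1⟩ := mean_tendsto hfd (abs_le_one hf1) hF hFm hFb hFf i h.1
      obtain ⟨tB, b1⟩ := mean_tendsto hgd (abs_le_one hg1) hG hGm hGb hGg i h.2
      have a0 : 0 < ∫ x, pderiv f i x ∂(gaussianPi n) :=
        lt_of_le_of_ne (integral_nonneg fun x => pderiv_nonneg hfd hfm i x) h.1.symm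
      have b0 : 0 < ∫ x, pderiv g i x ∂(gaussianPi n) :=
        lt_of_le_of_ne (integral_nonneg fun x => pderiv_nonneg hgd hgm i x) h.2.symm
      exact term_tendsto tA tB a0 b0 a1 b1
    · simp only [τ, if_neg h]
      have : term (∫ x, pderiv f i x ∂(gaussianPi n)) (∫ x, pderiv g i x ∂(gaussianPi n)) = 0 := by
        rw [not_and_or, not_not, not_not] at h
        rcases h with h | h <;> simp [term, h]
      rw [this]
      exact tendsto_const_nhds
  refine le_of_tendsto_of_tendsto' ((tendsto_finsetSum _ fun i _ => hτ i).const_mul _) hcov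
    fun k => le_trans ?_ (nice_case (hF k) (hG k) (hFm k) (hGm k) (hFb k) (hGb k))
  refine mul_le_mul_of_nonneg_left (Finset.sum_le_sum fun i _ => ?_) (by positivity)
  have hn : 0 ≤ term (∫ x, pderiv (F k) i x ∂(gaussianPi n))
      (∫ x, pderiv (G k) i x ∂(gaussianPi n)) :=
    term_nonneg (integral_nonneg fun x => pderiv_nonneg (hF k).diff (hFm k) i x)
      (integral_nonneg fun x => pderiv_nonneg (hG k).diff (hGm k) i x)
  simp only [τ]
  split_ifs
  · exact le_rfl
  · exact hn

end GT

/-- **Theorem (alternative functional Gaussian Talagrand bound).**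
There is a universal constant `c > 0` such that for every `n ≥ 1` and every pair of
increasing `C¹` functions `f, g : ℝⁿ → [−1,1]`,
`E_μ[fg] − E_μ[f]·E_μ[g] ≥
  c·∑ i, E_μ[∂_i f]·E_μ[∂_i g] / √(log(e/E_μ[∂_i f])·log(e/E_μ[∂_i g]))`. -/
theorem gaussian_talagrand_functional_alt :
    ∃ c : ℝ, 0 < c ∧
      ∀ (n : ℕ), 1 ≤ n → ∀ (f g : (Fin n → ℝ) → ℝ),
        ContDiff ℝ 1 f → ContDiff ℝ 1 g → Monotone f → Monotone g →
        (∀ x, f x ∈ Set.Icc (-1 : ℝ) 1) → (∀ x, g x ∈ Set.Icc (-1 : ℝ) 1) →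
        (∫ x, f x * g x ∂(gaussianPi n)) -
            (∫ x, f x ∂(gaussianPi n)) * (∫ x, g x ∂(gaussianPi n)) ≥
          c * ∑ i, (∫ x, pderiv f i x ∂(gaussianPi n)) *
                    (∫ x, pderiv g i x ∂(gaussianPi n)) /
            Real.sqrt (Real.log (Real.exp 1 / ∫ x, pderiv f i x ∂(gaussianPi n)) *
              Real.log (Real.exp 1 / ∫ x, pderiv g i x ∂(gaussianPi n))) := by
  refine ⟨Real.exp (-1) / 128, by positivity, ?_⟩
  intro n _ f g hf hg hfm hgm hf1 hg1
  exact GT.general_case hf hg hfm hgm hf1 hg1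
end

section
/- Let f₁, f₂ : ℝ^n → ℝ₊ be smooth bounded nonnegative functions. Then for any p, q ∈ (0,1) and any t > 0 such that e^{−2t} ≤ (1−p)(1−q), one has E_μ[f₁ · P_t f₂] ≥ ‖f₁‖_p · ‖f₂‖_q, where the norms are taken with respect to μ^{⊗n}. -/
open MeasureTheory ProbabilityTheory Filter Pointwise

noncomputable section

/-- The Ornstein–Uhlenbeck semigroup:
`P_t f(x) = ∫ f(e^{−t}x + √(1−e^{−2t})·y) dμ⊗ⁿ(y)`. -/
def OU {n : ℕ} (t : ℝ) (f : (Fin n → ℝ) → ℝ) (x : Fin n → ℝ) : ℝ :=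
  ∫ y, f (fun i => Real.exp (-t) * x i +
    Real.sqrt (1 - Real.exp (-(2 * t))) * y i) ∂(gaussianPi n)

/-- The `p`-norm `‖h‖_p = (∫ |h|^p dμ⊗ⁿ)^{1/p}` w.r.t. the Gaussian measure, `p > 0`. -/
def pNorm {n : ℕ} (p : ℝ) (h : (Fin n → ℝ) → ℝ) : ℝ :=
  (∫ x, |h x| ^ p ∂(gaussianPi n)) ^ (1 / p)

end

/-- Second order lower bound from a lower bound on the second derivative. -/
lemma second_order_lower (φ φ' φ'' : ℝ → ℝ) (m : ℝ)
    (h1 : ∀ t ∈ Set.Icc (0:ℝ) 1, HasDerivAt φ (φ' t) t)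
    (h2 : ∀ t ∈ Set.Icc (0:ℝ) 1, HasDerivAt φ' (φ'' t) t)
    (hm : ∀ t ∈ Set.Icc (0:ℝ) 1, m ≤ φ'' t) :
    φ 0 + φ' 0 + m / 2 ≤ φ 1 := by
  have hA : ∀ t ∈ Set.Icc (0:ℝ) 1, φ' 0 + m * t ≤ φ' t := by
    have : MonotoneOn (fun t => φ' t - m * t) (Set.Icc (0:ℝ) 1) := by
      have hd : ∀ t ∈ Set.Icc (0:ℝ) 1, HasDerivAt (fun t => φ' t - m * t) (φ'' t - m) t := by
        intro t ht
        convert! (h2 t ht).sub ((hasDerivAt_id t).const_mul m) using 1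
        simp
      apply monotoneOn_of_deriv_nonneg (convex_Icc 0 1)
      · exact fun t ht => (hd t ht).continuousAt.continuousWithinAt
      · exact fun t ht => (hd t (interior_subset ht)).differentiableAt.differentiableWithinAt
      · intro t ht
        rw [(hd t (interior_subset ht)).deriv]
        linarith [hm t (interior_subset ht)]
    intro t ht
    have := this (by simp) ht ht.1
    simp at this
    linarith
  have : MonotoneOn (fun t => φ t - φ' 0 * t - m / 2 * t ^ 2) (Set.Icc (0:ℝ) 1) := by
    have hd : ∀ t ∈ Set.Icc (0:ℝ) 1,
        HasDerivAt (fun t => φ t - φ' 0 * t - m / 2 * t ^ 2) (φ' t - φ' 0 - m * t) t := by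
      intro t ht
      have := ((h1 t ht).sub ((hasDerivAt_id t).const_mul (φ' 0))).sub
        (((hasDerivAt_id t).pow 2).const_mul (m / 2))
      convert! this using 1
      simp
      ring
    apply monotoneOn_of_deriv_nonneg (convex_Icc 0 1)
    · exact fun t ht => (hd t ht).continuousAt.continuousWithinAt
    · exact fun t ht => (hd t (interior_subset ht)).differentiableAt.differentiableWithinAt
    · intro t ht
      rw [(hd t (interior_subset ht)).deriv]
      linarith [hA t (interior_subset ht)]
  have := this (a := 0) (b := 1) (by simp) (by simp) zero_le_one
  simp at this
  linarith

lemma rpow_lip (δ M c : ℝ) (hδ : 0 < δ) :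
    ∃ K, 0 ≤ K ∧ ∀ a ∈ Set.Icc δ M, ∀ b ∈ Set.Icc δ M, |a ^ c - b ^ c| ≤ K * |a - b| := by
  have hc : ContDiffOn ℝ 1 (fun x : ℝ => x ^ c) (Set.Icc δ M) := by
    intro x hx
    exact (Real.contDiffAt_rpow_const_of_ne (by linarith [hx.1] : x ≠ 0)).contDiffWithinAt
  obtain ⟨K, hK⟩ := hc.exists_lipschitzOnWith (by simp) (convex_Icc δ M) isCompact_Icc
  refine ⟨K, K.2, fun a ha b hb => ?_⟩
  have := hK.dist_le_mul a ha b hb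
  simpa [Real.dist_eq] using this

lemma rpow_bdd (δ M c : ℝ) (hδ : 0 < δ) :
    ∃ K, 0 ≤ K ∧ ∀ a ∈ Set.Icc δ M, |a ^ c| ≤ K := by
  have hc : ContinuousOn (fun x : ℝ => x ^ c) (Set.Icc δ M) := by
    intro x hx
    exact (Real.continuousAt_rpow_const _ _ (Or.inl (by linarith [hx.1]))).continuousWithinAt
  obtain ⟨K, hK⟩ := isCompact_Icc.exists_bound_of_continuousOn hc
  exact ⟨max K 0, le_max_right _ _, fun a ha => (hK a ha).trans (le_max_left _ _)⟩

lemma mono_bdd (δ M c d : ℝ) (hδ : 0 < δ) :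
    ∃ K, 0 ≤ K ∧ ∀ a ∈ Set.Icc δ M, ∀ b ∈ Set.Icc δ M, |a ^ c * b ^ d| ≤ K := by
  obtain ⟨K, hK0, hK⟩ := rpow_bdd δ M c hδ
  obtain ⟨K', hK0', hK'⟩ := rpow_bdd δ M d hδ
  refine ⟨K * K', by positivity, fun a ha b hb => ?_⟩
  rw [abs_mul]
  exact mul_le_mul (hK a ha) (hK' b hb) (abs_nonneg _) hK0

lemma mono_lip (δ M c d : ℝ) (hδ : 0 < δ) :
    ∃ K, 0 ≤ K ∧ ∀ a ∈ Set.Icc δ M, ∀ b ∈ Set.Icc δ M, ∀ a' ∈ Set.Icc δ M, ∀ b' ∈ Set.Icc δ M,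
      |a' ^ c * b' ^ d - a ^ c * b ^ d| ≤ K * (|a' - a| + |b' - b|) := by
  obtain ⟨K1, h10, h1⟩ := rpow_bdd δ M c hδ
  obtain ⟨K2, h20, h2⟩ := rpow_bdd δ M d hδ
  obtain ⟨K3, h30, h3⟩ := rpow_lip δ M c hδ
  obtain ⟨K4, h40, h4⟩ := rpow_lip δ M d hδ
  refine ⟨K3 * K2 + K1 * K4, by positivity, fun a ha b hb a' ha' b' hb' => ?_⟩
  have e : a' ^ c * b' ^ d - a ^ c * b ^ d
      = (a' ^ c - a ^ c) * b' ^ d + a ^ c * (b' ^ d - b ^ d) := by ring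
  have i1 : |(a' ^ c - a ^ c) * b' ^ d| ≤ (K3 * |a' - a|) * K2 := by
    rw [abs_mul]
    exact mul_le_mul (h3 _ ha' _ ha) (h2 _ hb') (abs_nonneg _) (by positivity)
  have i2 : |a ^ c * (b' ^ d - b ^ d)| ≤ K1 * (K4 * |b' - b|) := by
    rw [abs_mul]
    exact mul_le_mul (h1 _ ha) (h4 _ hb' _ hb) (abs_nonneg _) h10
  rw [e]
  refine (abs_add_le _ _).trans ?_
  have := abs_nonneg (a' - a)
  have := abs_nonneg (b' - b)
  nlinarith [mul_nonneg (mul_nonneg h30 h20) (abs_nonneg (b' - b)),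
    mul_nonneg (mul_nonneg h10 h40) (abs_nonneg (a' - a))]

/-- Derivative of a monomial along a segment. -/
lemma mono_deriv (c d a b α β t : ℝ) (ha : 0 < a + t * α) (hb : 0 < b + t * β) :
    HasDerivAt (fun t : ℝ => (a + t * α) ^ c * (b + t * β) ^ d)
      (c * (a + t * α) ^ (c - 1) * (b + t * β) ^ d * α
        + d * (a + t * α) ^ c * (b + t * β) ^ (d - 1) * β) t := by
  have h1 : HasDerivAt (fun t : ℝ => a + t * α) α t := by
    simpa using ((hasDerivAt_id t).mul_const α).const_add a
  have h2 : HasDerivAt (fun t : ℝ => b + t * β) β t := by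
    simpa using ((hasDerivAt_id t).mul_const β).const_add b
  have := (h1.rpow_const (p := c) (Or.inl ha.ne')).mul (h2.rpow_const (p := d) (Or.inl hb.ne'))
  convert! this using 1
  ring

lemma J_taylor (δ M r s : ℝ) (hδ : 0 < δ) :
    ∃ K, 0 ≤ K ∧ ∀ a ∈ Set.Icc δ M, ∀ b ∈ Set.Icc δ M, ∀ a' ∈ Set.Icc δ M, ∀ b' ∈ Set.Icc δ M,
      a ^ r * b ^ s + (r * (a ^ (r-1) * b ^ s)) * (a' - a) + (s * (a ^ r * b ^ (s-1))) * (b' - b)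
      + (r * (r - 1) * (a ^ (r-2) * b ^ s) * (a' - a) ^ 2
        + 2 * (r * s * (a ^ (r-1) * b ^ (s-1))) * ((a' - a) * (b' - b))
        + s * (s - 1) * (a ^ r * b ^ (s-2)) * (b' - b) ^ 2) / 2
      - K * (|a' - a| + |b' - b|) ^ 3 ≤ a' ^ r * b' ^ s := by
  obtain ⟨K1, h10, h1⟩ := mono_lip δ M (r-2) s hδ
  obtain ⟨K2, h20, h2⟩ := mono_lip δ M (r-1) (s-1) hδ
  obtain ⟨K3, h30, h3⟩ := mono_lip δ M r (s-2) hδ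
  refine ⟨(|r * (r-1)| * K1 + 2 * (|r * s| * K2) + |s * (s-1)| * K3) / 2, by positivity,
    fun a ha b hb a' ha' b' hb' => ?_⟩
  set α := a' - a with hα
  set β := b' - b with hβ
  set D := |α| + |β| with hD
  have hD0 : 0 ≤ D := by positivity
  have memA : ∀ t ∈ Set.Icc (0:ℝ) 1, a + t * α ∈ Set.Icc δ M := by
    intro t ht
    have : a + t * α = (1 - t) * a + t * a' := by rw [hα]; ring
    rw [this]
    have := convex_Icc δ M ha ha' (by linarith [ht.2] : 0 ≤ 1 - t) ht.1 (by ring)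
    simpa using this
  have memB : ∀ t ∈ Set.Icc (0:ℝ) 1, b + t * β ∈ Set.Icc δ M := by
    intro t ht
    have : b + t * β = (1 - t) * b + t * b' := by rw [hβ]; ring
    rw [this]
    have := convex_Icc δ M hb hb' (by linarith [ht.2] : 0 ≤ 1 - t) ht.1 (by ring)
    simpa using this
  have key := second_order_lower
    (fun t => (a + t * α) ^ r * (b + t * β) ^ s)
    (fun t => r * α * ((a + t * α) ^ (r-1) * (b + t * β) ^ s)
        + s * β * ((a + t * α) ^ r * (b + t * β) ^ (s - 1)))
    (fun t => r * (r - 1) * ((a + t * α) ^ (r-2) * (b + t * β) ^ s) * α ^ 2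
      + 2 * (r * s * ((a + t * α) ^ (r-1) * (b + t * β) ^ (s-1))) * (α * β)
      + s * (s - 1) * ((a + t * α) ^ r * (b + t * β) ^ (s-2)) * β ^ 2)
    (r * (r - 1) * (a ^ (r-2) * b ^ s) * α ^ 2
        + 2 * (r * s * (a ^ (r-1) * b ^ (s-1))) * (α * β)
        + s * (s - 1) * (a ^ r * b ^ (s-2)) * β ^ 2
      - (|r * (r-1)| * K1 + 2 * (|r * s| * K2) + |s * (s-1)| * K3) * D ^ 3)
    ?_ ?_ ?_
  · simp only [zero_mul, add_zero, one_mul] at key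
    have e1 : a + α = a' := by rw [hα]; ring
    have e2 : b + β = b' := by rw [hβ]; ring
    rw [e1, e2] at key
    linarith
  · intro t ht
    have pa : 0 < a + t * α := by linarith [(memA t ht).1]
    have pb : 0 < b + t * β := by linarith [(memB t ht).1]
    convert! mono_deriv r s a b α β t pa pb using 1
    ring
  · intro t ht
    have pa : 0 < a + t * α := by linarith [(memA t ht).1]
    have pb : 0 < b + t * β := by linarith [(memB t ht).1]
    convert! ((mono_deriv (r-1) s a b α β t pa pb).const_mul (r * α)).add
      ((mono_deriv r (s-1) a b α β t pa pb).const_mul (s * β)) using 1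
    rw [show r - 1 - 1 = r - 2 by ring, show s - 1 - 1 = s - 2 by ring]
    ring
  · intro t ht
    have ba : |a + t * α - a| + |b + t * β - b| ≤ D := by
      rw [add_sub_cancel_left, add_sub_cancel_left, abs_mul, abs_mul, abs_of_nonneg ht.1, hD]
      nlinarith [abs_nonneg α, abs_nonneg β, ht.2]
    have g : ∀ (k K X Y w : ℝ), 0 ≤ K → |X - Y| ≤ K * (|a + t * α - a| + |b + t * β - b|) →
        |w| ≤ D ^ 2 → k * Y * w - |k| * K * D ^ 3 ≤ k * X * w := by
      intro k K X Y w hK h hw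
      have i1 : |k * (X - Y) * w| ≤ |k| * (K * D) * D ^ 2 := by
        rw [abs_mul, abs_mul]
        have : |X - Y| ≤ K * D := h.trans (mul_le_mul_of_nonneg_left ba hK)
        gcongr
      have := (abs_le.mp i1).1
      nlinarith
    have w1 : |α ^ 2| ≤ D ^ 2 := by
      rw [abs_pow]; gcongr; rw [hD]; linarith [abs_nonneg β]
    have w3 : |β ^ 2| ≤ D ^ 2 := by
      rw [abs_pow]; gcongr; rw [hD]; linarith [abs_nonneg α]
    have w2 : |α * β| ≤ D ^ 2 := by
      rw [abs_mul, hD]; nlinarith [abs_nonneg α, abs_nonneg β]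
    have q1 := g (r * (r-1)) K1 _ _ _ h10 (h1 a ha b hb _ (memA t ht) _ (memB t ht)) w1
    have q2 := g (r * s) K2 _ _ _ h20 (h2 a ha b hb _ (memA t ht) _ (memB t ht)) w2
    have q3 := g (s * (s-1)) K3 _ _ _ h30 (h3 a ha b hb _ (memA t ht) _ (memB t ht)) w3
    linarith

section gaussianSteps

set_option linter.unusedSectionVars false

variable {X : Type*} [NormedAddCommGroup X] [NormedSpace ℝ X]

/-- A quantitative `C^{1,1}` class, stable under averaging. -/
structure KClass (N : Set X) (δ M L : ℝ) (u : X → ℝ) (d : X → X →L[ℝ] ℝ) : Prop where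
  cu : Continuous u
  cd : Continuous d
  lo : ∀ x, δ ≤ u x
  hi : ∀ x, u x ≤ M
  bd : ∀ x, ‖d x‖ ≤ L
  tay : ∀ x z, |u (x + z) - u x - d x z| ≤ L * ‖z‖ ^ 2
  ker : ∀ x, ∀ z ∈ N, d x z = 0

variable [MeasurableSpace X] [BorelSpace X] [SecondCountableTopology X] [CompleteSpace X]

lemma integrable_of_cont_bdd {F : Type*} [NormedAddCommGroup F] (ν : Measure X)
    [IsProbabilityMeasure ν] (φ : X → F) (hc : Continuous φ) (C : ℝ) (hb : ∀ x, ‖φ x‖ ≤ C) :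
    Integrable φ ν :=
  Integrable.of_bound hc.aestronglyMeasurable C (Eventually.of_forall hb)

/-- Averaging operator. -/
noncomputable def Tav (ν : Measure X) (c : ℝ) (u : X → ℝ) (x : X) : ℝ := ∫ w, u (x + c • w) ∂ν

lemma KClass.abs_le {N : Set X} {δ M L : ℝ} {u : X → ℝ} {d : X → X →L[ℝ] ℝ}
    (h : KClass N δ M L u d) (x : X) : ‖u x‖ ≤ |δ| + |M| := by
  rw [Real.norm_eq_abs, _root_.abs_le]
  have := h.lo x
  have := h.hi x
  constructor
  · linarith [neg_abs_le δ, abs_nonneg M]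
  · linarith [le_abs_self M, abs_nonneg δ]

lemma KClass.integrable {N : Set X} {δ M L : ℝ} {u : X → ℝ} {d : X → X →L[ℝ] ℝ}
    (h : KClass N δ M L u d) (ν : Measure X) [IsProbabilityMeasure ν] (x : X) (c : ℝ) :
    Integrable (fun w => u (x + c • w)) ν := by
  have := h.cu
  exact integrable_of_cont_bdd ν _ (by fun_prop) _ (fun w => h.abs_le _)

lemma KClass.integrable_d {N : Set X} {δ M L : ℝ} {u : X → ℝ} {d : X → X →L[ℝ] ℝ}
    (h : KClass N δ M L u d) (ν : Measure X) [IsProbabilityMeasure ν] (x : X) (c : ℝ) :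
    Integrable (fun w => d (x + c • w)) ν := by
  have := h.cd
  exact integrable_of_cont_bdd ν _ (by fun_prop) _ (fun w => h.bd _)

lemma KClass.Tav {N : Set X} {δ M L : ℝ} {u : X → ℝ} {d : X → X →L[ℝ] ℝ}
    (h : KClass N δ M L u d) (ν : Measure X) [IsProbabilityMeasure ν] (c : ℝ) :
    KClass N δ M L (Tav ν c u) (fun x => ∫ w, d (x + c • w) ∂ν) := by
  have hcu := h.cu
  have hcd := h.cd
  constructor
  · apply continuous_of_dominated (bound := fun _ => |δ| + |M|)
    · intro x; exact (h.integrable ν x c).aestronglyMeasurable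
    · intro x; exact Eventually.of_forall fun w => h.abs_le _
    · exact integrable_const _
    · exact Eventually.of_forall fun w => by fun_prop
  · apply continuous_of_dominated (bound := fun _ => L)
    · intro x; exact (h.integrable_d ν x c).aestronglyMeasurable
    · intro x; exact Eventually.of_forall fun w => h.bd _
    · exact integrable_const _
    · exact Eventually.of_forall fun w => by fun_prop
  · intro x
    have := integral_mono (integrable_const δ) (h.integrable ν x c) (fun w => h.lo _)
    simpa [_root_.Tav] using this
  · intro x
    have := integral_mono (h.integrable ν x c) (integrable_const M) (fun w => h.hi _)
    simpa [_root_.Tav] using this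
  · intro x
    have := norm_integral_le_of_norm_le_const (μ := ν)
      (Eventually.of_forall fun w => h.bd (x + c • w))
    simpa using this
  · intro x z
    have hd : Integrable (fun w => d (x + c • w) z) ν := (h.integrable_d ν x c).apply_continuousLinearMap z
    rw [ContinuousLinearMap.integral_apply (h.integrable_d ν x c)]
    unfold _root_.Tav
    rw [← integral_sub (h.integrable ν _ c) (h.integrable ν _ c),
      ← integral_sub (f := fun w => u (x + z + c • w) - u (x + c • w))
        ((h.integrable ν _ c).sub (h.integrable ν _ c)) hd]
    have := norm_integral_le_of_norm_le_const (μ := ν) (C := L * ‖z‖ ^ 2)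
      (f := fun w => u (x + z + c • w) - u (x + c • w) - d (x + c • w) z)
      (Eventually.of_forall fun w => by
        rw [show x + z + c • w = (x + c • w) + z by abel]
        exact h.tay _ _)
    simpa using this
  · intro x z hz
    rw [ContinuousLinearMap.integral_apply (h.integrable_d ν x c)]
    simp [h.ker _ z hz]

/-- Stability of centered Gaussian measures. -/
lemma gauss_rot (ν : Measure X) [IsGaussian ν] (h0 : ∀ l : StrongDual ℝ X, ∫ w, l w ∂ν = 0)
    (a b e : ℝ) (hab : a ^ 2 + b ^ 2 = e ^ 2) :
    (ν.prod ν).map (fun z : X × X => a • z.1 + b • z.2) = ν.map (fun w => e • w) := by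
  have e1 : (fun z : X × X => a • z.1 + b • z.2)
      = (a • ContinuousLinearMap.fst ℝ X X + b • ContinuousLinearMap.snd ℝ X X : X × X →L[ℝ] X) := by
    ext z; simp
  have e2 : (fun w : X => e • w) = (e • ContinuousLinearMap.id ℝ X : X →L[ℝ] X) := by
    ext z; simp
  rw [e1, e2]
  refine Measure.ext_of_charFunDual ?_
  ext l
  simp_rw [charFunDual_map, charFunDual_prod,
    IsGaussian.charFunDual_eq_of_forall_strongDual_eq_zero h0, ← Complex.exp_add]
  have hs : ∀ (c : ℝ), Var[(c • l : StrongDual ℝ X); ν] = c ^ 2 * Var[l; ν] := by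
    intro c
    have := variance_const_mul c l ν
    rw [← this]
    congr 1
  have f1 : (l.comp (a • ContinuousLinearMap.fst ℝ X X + b • ContinuousLinearMap.snd ℝ X X)).comp
      (.inl ℝ X X) = a • l := by ext; simp
  have f2 : (l.comp (a • ContinuousLinearMap.fst ℝ X X + b • ContinuousLinearMap.snd ℝ X X)).comp
      (.inr ℝ X X) = b • l := by ext; simp
  have f3 : l.comp (e • ContinuousLinearMap.id ℝ X) = e • l := by ext; simp
  rw [f1, f2, f3, hs, hs, hs, ← hab]
  congr 1
  push_cast
  ring

lemma gauss_rot_integral (ν : Measure X) [IsGaussian ν]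
    (h0 : ∀ l : StrongDual ℝ X, ∫ w, l w ∂ν = 0)
    (a b e : ℝ) (hab : a ^ 2 + b ^ 2 = e ^ 2) (φ : X → ℝ) (hc : Continuous φ) (C : ℝ)
    (hb : ∀ x, ‖φ x‖ ≤ C) :
    ∫ w, ∫ w', φ (a • w + b • w') ∂ν ∂ν = ∫ w, φ (e • w) ∂ν := by
  have hi : Integrable (fun z : X × X => φ (a • z.1 + b • z.2)) (ν.prod ν) :=
    integrable_of_cont_bdd _ _ (by fun_prop) C (fun z => hb _)
  rw [← integral_prod _ hi]
  have h1 := integral_map (μ := ν.prod ν) (φ := fun z : X × X => a • z.1 + b • z.2) (f := φ)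
    (by fun_prop) hc.aestronglyMeasurable
  have h2 := integral_map (μ := ν) (φ := fun w : X => e • w) (f := φ)
    (by fun_prop) hc.aestronglyMeasurable
  rw [← h1, ← h2, gauss_rot ν h0 a b e hab]

end gaussianSteps

section gaussianIteration

set_option linter.unusedSectionVars false

variable {X : Type*} [NormedAddCommGroup X] [NormedSpace ℝ X]
variable [MeasurableSpace X] [BorelSpace X] [SecondCountableTopology X] [CompleteSpace X]

/-- The correlation condition for two families of linear functionals. -/
def CorrCond (ν : Measure X) (N₁ N₂ : Set X) (κ : ℝ) : Prop :=
  ∀ d e : X →L[ℝ] ℝ, (∀ z ∈ N₁, d z = 0) → (∀ z ∈ N₂, e z = 0) →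
    ∀ A B C : ℝ, 0 ≤ A → 0 ≤ C → B ^ 2 * κ ≤ A * C →
      0 ≤ ∫ w, (A * d w ^ 2 + 2 * B * (d w * e w) + C * e w ^ 2) ∂ν

/-- Coefficients of the Hessian of `J` satisfy the discriminant condition. -/
lemma J_disc (r s κ a b : ℝ) (ha : 0 < a) (hb : 0 < b) (hr : 1 < r) (hs : 1 < s)
    (hκ : r * s * κ ≤ (r - 1) * (s - 1)) :
    (r * s * (a ^ (r-1) * b ^ (s-1))) ^ 2 * κ
      ≤ (r * (r - 1) * (a ^ (r-2) * b ^ s)) * (s * (s - 1) * (a ^ r * b ^ (s-2))) := by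
  have e1 : a ^ (r-2) * a ^ r = (a ^ (r-1)) ^ 2 := by
    rw [← Real.rpow_add ha, sq, ← Real.rpow_add ha]; congr 1; ring
  have e2 : b ^ (s-2) * b ^ s = (b ^ (s-1)) ^ 2 := by
    rw [← Real.rpow_add hb, sq, ← Real.rpow_add hb]; congr 1; ring
  have e3 : (r * (r - 1) * (a ^ (r-2) * b ^ s)) * (s * (s - 1) * (a ^ r * b ^ (s-2)))
      = (r * s * ((a ^ (r-1)) ^ 2 * (b ^ (s-1)) ^ 2)) * ((r - 1) * (s - 1)) := by
    rw [← e1, ← e2]; ring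
  rw [e3]
  have : 0 ≤ r * s * ((a ^ (r-1)) ^ 2 * (b ^ (s-1)) ^ 2) := by positivity
  calc _ = (r * s * ((a ^ (r-1)) ^ 2 * (b ^ (s-1)) ^ 2)) * (r * s * κ) := by ring
    _ ≤ _ := mul_le_mul_of_nonneg_left hκ this

lemma quad_err (A k c L R x y x' y' : ℝ) (hA : |A| ≤ k) (hc : 0 ≤ c) (hc1 : c ≤ 1)
    (hL : 0 ≤ L) (hR : 0 ≤ R)
    (hx' : |x'| ≤ L * R) (hy' : |y'| ≤ L * R)
    (hx : |x - c * x'| ≤ L * c ^ 2 * R) (hy : |y - c * y'| ≤ L * c ^ 2 * R) :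
    c ^ 2 * (A * (x' * y')) - c ^ 3 * (3 * k * L ^ 2 * R ^ 2) ≤ A * (x * y) := by
  have hy2 : |y| ≤ 2 * c * L * R := by
    have h1 : |y| ≤ |y - c * y'| + |c * y'| := by
      have := abs_add_le (y - c * y') (c * y'); simpa using this
    rw [abs_mul, abs_of_nonneg hc] at h1
    have h2 : c * |y'| ≤ c * (L * R) := mul_le_mul_of_nonneg_left hy' hc
    have h3 : L * c ^ 2 * R ≤ L * c * R := by
      have : c ^ 2 ≤ c := by nlinarith
      gcongr
    linarith
  have h1 : |(x - c * x') * y + (c * x') * (y - c * y')| ≤ c ^ 3 * (3 * L ^ 2 * R ^ 2) := by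
    refine (abs_add_le _ _).trans ?_
    rw [abs_mul, abs_mul, abs_mul c, abs_of_nonneg hc]
    have i1 : |x - c * x'| * |y| ≤ (L * c ^ 2 * R) * (2 * c * L * R) :=
      mul_le_mul hx hy2 (abs_nonneg _) (by positivity)
    have i2 : c * |x'| * |y - c * y'| ≤ (c * (L * R)) * (L * c ^ 2 * R) := by gcongr
    linarith
  have h2 : |A * ((x - c * x') * y + (c * x') * (y - c * y'))| ≤ k * (c ^ 3 * (3 * L ^ 2 * R ^ 2)) := by
    rw [abs_mul]
    exact mul_le_mul hA h1 (abs_nonneg _) ((abs_nonneg _).trans hA)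
  have := (abs_le.mp h2).1
  nlinarith

lemma KClass.dev {N : Set X} {δ M L : ℝ} {u : X → ℝ} {d : X → X →L[ℝ] ℝ}
    (h : KClass N δ M L u d) (ν : Measure X) [IsGaussian ν]
    (h0 : ∀ l : StrongDual ℝ X, ∫ w, l w ∂ν = 0) (c : ℝ) (x w : X) :
    |u (x + c • w) - _root_.Tav ν c u x - c * d x w|
      ≤ L * c ^ 2 * (‖w‖ ^ 2 + ∫ w, ‖w‖ ^ 2 ∂ν) := by
  have hi2 : Integrable (fun w : X => ‖w‖ ^ 2) ν := by
    have := (IsGaussian.memLp_id ν 2 (by simp)).integrable_norm_pow (p := 2) (by simp)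
    simpa using this
  have b1 : ∀ w, |u (x + c • w) - u x - c * d x w| ≤ L * c ^ 2 * ‖w‖ ^ 2 := by
    intro w
    have := h.tay x (c • w)
    rw [norm_smul, mul_pow, Real.norm_eq_abs, sq_abs, map_smul, smul_eq_mul] at this
    linarith
  have e : _root_.Tav ν c u x - u x = ∫ w, (u (x + c • w) - u x - c * d x w) ∂ν := by
    rw [integral_sub (f := fun w => u (x + c • w) - u x)
      ((h.integrable ν x c).sub (integrable_const _))
      ((IsGaussian.integrable_dual ν (d x)).const_mul c),
      integral_sub (h.integrable ν x c) (integrable_const _), integral_const_mul, h0]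
    simp [_root_.Tav]
  have b2 : |_root_.Tav ν c u x - u x| ≤ L * c ^ 2 * ∫ w, ‖w‖ ^ 2 ∂ν := by
    rw [e, ← integral_const_mul, ← Real.norm_eq_abs]
    exact norm_integral_le_of_norm_le (hi2.const_mul _) (Eventually.of_forall b1)
  have b1 := _root_.abs_le.mp (b1 w)
  have b2 := _root_.abs_le.mp b2
  rw [_root_.abs_le, mul_add]
  constructor <;> linarith [b1.1, b1.2, b2.1, b2.2]

set_option maxHeartbeats 2000000 in
lemma one_step (ν : Measure X) [IsGaussian ν] (h0 : ∀ l : StrongDual ℝ X, ∫ w, l w ∂ν = 0)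
    (N₁ N₂ : Set X) (κ : ℝ) (hcorr : CorrCond ν N₁ N₂ κ)
    (δ M L r s : ℝ) (hδ : 0 < δ) (hr : 1 < r) (hs : 1 < s)
    (hκ : r * s * κ ≤ (r - 1) * (s - 1)) (hL : 0 ≤ L) :
    ∃ K, ∀ u d v e, KClass N₁ δ M L u d → KClass N₂ δ M L v e → ∀ c : ℝ, 0 ≤ c → c ≤ 1 → ∀ x,
      Tav ν c u x ^ r * Tav ν c v x ^ s - K * c ^ 3
        ≤ ∫ w, u (x + c • w) ^ r * v (x + c • w) ^ s ∂ν := by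
  obtain ⟨K0, h00, hJ⟩ := J_taylor δ M r s hδ
  obtain ⟨KA, hA0, hA⟩ := mono_bdd δ M (r-2) s hδ
  obtain ⟨KB, hB0, hB⟩ := mono_bdd δ M (r-1) (s-1) hδ
  obtain ⟨KC, hC0, hC⟩ := mono_bdd δ M r (s-2) hδ
  obtain ⟨KJ, hJ0, hJb⟩ := mono_bdd δ M r s hδ
  set m2 := ∫ w, ‖w‖ ^ 2 ∂ν with hm2
  have hm0 : 0 ≤ m2 := integral_nonneg fun w => by positivity
  set R : X → ℝ := fun w => ‖w‖ + ‖w‖ ^ 2 + m2 with hR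
  have hRn : ∀ w, 0 ≤ R w := fun w => by positivity
  have hmem : ∀ k : ℕ, MemLp (fun w : X => ‖w‖ ^ (k+1)) 3 ν := by
    intro k
    have := (IsGaussian.memLp_id ν (3 * (k+1 : ℕ)) (by finiteness)).norm
    have := this.norm_rpow_div ((k+1 : ℕ) : ENNReal)
    convert! this using 1
    · ext w; rw [ENNReal.toReal_natCast, Real.rpow_natCast]; simp
    · rw [ENNReal.mul_div_cancel_right] <;> simp
  have hR3 : MemLp R 3 ν := by
    have h1 := hmem 0
    have h2 := hmem 1
    simp only [zero_add, pow_one, Nat.reduceAdd] at h1 h2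
    exact (h1.add h2).add (memLp_const m2)
  have hRi3 : Integrable (fun w => R w ^ 3) ν := by
    have := hR3.integrable_norm_pow (p := 3) (by simp)
    convert! this using 2 with w
    rw [Real.norm_of_nonneg (hRn w)]
  have hRi2 : Integrable (fun w => R w ^ 2) ν := by
    have := (hR3.mono_exponent (p := 2) (by norm_num)).integrable_norm_pow (p := 2) (by simp)
    convert! this using 2 with w
    rw [Real.norm_of_nonneg (hRn w)]
  set k1 := |r * (r-1)| * KA
  set k2 := |r * s| * KB
  set k3 := |s * (s-1)| * KC
  refine ⟨(3 * k1 * L ^ 2 / 2 + 3 * k2 * L ^ 2 + 3 * k3 * L ^ 2 / 2) * ∫ w, R w ^ 2 ∂ν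
    + K0 * (64 * L ^ 3) * ∫ w, R w ^ 3 ∂ν, ?_⟩
  intro u d v e hu hv c hc hc1 x
  set a := Tav ν c u x with ha
  set b := Tav ν c v x with hb
  have hTu := hu.Tav ν c
  have hTv := hv.Tav ν c
  have ha' : a ∈ Set.Icc δ M := ⟨hTu.lo x, hTu.hi x⟩
  have hb' : b ∈ Set.Icc δ M := ⟨hTv.lo x, hTv.hi x⟩
  have pa : 0 < a := hδ.trans_le ha'.1
  have pb : 0 < b := hδ.trans_le hb'.1
  set A := r * (r - 1) * (a ^ (r-2) * b ^ s) with hAdef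
  set B := r * s * (a ^ (r-1) * b ^ (s-1)) with hBdef
  set C := s * (s - 1) * (a ^ r * b ^ (s-2)) with hCdef
  have hAk : |A| ≤ k1 := by
    rw [hAdef, abs_mul]; exact mul_le_mul_of_nonneg_left (hA a ha' b hb') (abs_nonneg _)
  have hBk : |B| ≤ k2 := by
    rw [hBdef, abs_mul]; exact mul_le_mul_of_nonneg_left (hB a ha' b hb') (abs_nonneg _)
  have hCk : |C| ≤ k3 := by
    rw [hCdef, abs_mul]; exact mul_le_mul_of_nonneg_left (hC a ha' b hb') (abs_nonneg _)
  have hA0' : 0 ≤ A := by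
    have : 0 ≤ r - 1 := by linarith
    positivity
  have hC0' : 0 ≤ C := by
    have : 0 ≤ s - 1 := by linarith
    positivity
  have hquad := hcorr (d x) (e x) (hu.ker x) (hv.ker x) A B C hA0' hC0'
    (J_disc r s κ a b pa pb hr hs hκ)
  set Ja := r * (a ^ (r-1) * b ^ s)
  set Jb := s * (a ^ r * b ^ (s-1))
  set S1 := 3 * k1 * L ^ 2 / 2 + 3 * k2 * L ^ 2 + 3 * k3 * L ^ 2 / 2
  set S2 := K0 * (64 * L ^ 3)
  -- pointwise estimate
  have point : ∀ w, a ^ r * b ^ s + Ja * (u (x + c • w) - a) + Jb * (v (x + c • w) - b)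
      + c ^ 2 / 2 * (A * d x w ^ 2 + 2 * B * (d x w * e x w) + C * e x w ^ 2)
      - c ^ 3 * (S1 * R w ^ 2 + S2 * R w ^ 3) ≤ u (x + c • w) ^ r * v (x + c • w) ^ s := by
    intro w
    have t := hJ a ha' b hb' (u (x + c • w)) ⟨hu.lo _, hu.hi _⟩ (v (x + c • w)) ⟨hv.lo _, hv.hi _⟩
    set α := u (x + c • w) - a
    set β := v (x + c • w) - b
    have hn : 0 ≤ ‖w‖ := norm_nonneg w
    have dα : |α - c * d x w| ≤ L * c ^ 2 * R w := by
      refine (hu.dev ν h0 c x w).trans ?_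
      have : ‖w‖ ^ 2 + m2 ≤ R w := by simp only [hR]; linarith
      gcongr
    have dβ : |β - c * e x w| ≤ L * c ^ 2 * R w := by
      refine (hv.dev ν h0 c x w).trans ?_
      have : ‖w‖ ^ 2 + m2 ≤ R w := by simp only [hR]; linarith
      gcongr
    have hnR : ‖w‖ ≤ R w := by simp only [hR]; nlinarith
    have bα : |d x w| ≤ L * R w := by
      refine ((d x).le_opNorm w).trans ?_
      exact mul_le_mul (hu.bd x) hnR hn hL
    have bβ : |e x w| ≤ L * R w := by
      refine ((e x).le_opNorm w).trans ?_
      exact mul_le_mul (hv.bd x) hnR hn hL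
    have q1 := quad_err A k1 c L (R w) α α _ _ hAk hc hc1 hL (hRn w) bα bα dα dα
    have q2 := quad_err B k2 c L (R w) α β _ _ hBk hc hc1 hL (hRn w) bα bβ dα dβ
    have q3 := quad_err C k3 c L (R w) β β _ _ hCk hc hc1 hL (hRn w) bβ bβ dβ dβ
    have big : ∀ y y' : ℝ, |y'| ≤ L * R w → |y - c * y'| ≤ L * c ^ 2 * R w →
        |y| ≤ 2 * c * L * R w := by
      intro y y' hy' hy
      have h1 : |y| ≤ |y - c * y'| + |c * y'| := by
        have := abs_add_le (y - c * y') (c * y'); simpa using this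
      rw [abs_mul, abs_of_nonneg hc] at h1
      have h2 : c * |y'| ≤ c * (L * R w) := mul_le_mul_of_nonneg_left hy' hc
      have h3 : L * c ^ 2 * R w ≤ L * c * R w := by
        have : c ^ 2 ≤ c := by nlinarith
        have := hRn w
        gcongr
      linarith
    have cub : K0 * (|α| + |β|) ^ 3 ≤ K0 * (4 * c * L * R w) ^ 3 := by
      have : |α| + |β| ≤ 4 * c * L * R w := by
        linarith [big _ _ bα dα, big _ _ bβ dβ]
      gcongr
    have e1 : c ^ 3 * (S1 * R w ^ 2 + S2 * R w ^ 3) =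
        c ^ 3 * (3 * k1 * L ^ 2 * R w ^ 2) / 2 + c ^ 3 * (3 * k2 * L ^ 2 * R w ^ 2)
        + c ^ 3 * (3 * k3 * L ^ 2 * R w ^ 2) / 2 + K0 * (4 * c * L * R w) ^ 3 := by
      simp only [S1, S2]; ring
    rw [e1]
    linarith
  -- integrate
  have iu := hu.integrable ν x c
  have iv := hv.integrable ν x c
  have cu := hu.cu
  have cv := hv.cu
  have iJ : Integrable (fun w => u (x + c • w) ^ r * v (x + c • w) ^ s) ν := by
    refine integrable_of_cont_bdd ν _ ?_ KJ
      (fun w => hJb _ ⟨hu.lo _, hu.hi _⟩ _ ⟨hv.lo _, hv.hi _⟩)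
    refine Continuous.mul (Continuous.rpow_const (by fun_prop) fun w => Or.inr (by linarith))
      (Continuous.rpow_const (by fun_prop) fun w => Or.inr (by linarith))
  have id2 : Integrable (fun w => d x w ^ 2) ν := (IsGaussian.memLp_dual ν (d x) 2 (by simp)).integrable_sq
  have ie2 : Integrable (fun w => e x w ^ 2) ν := (IsGaussian.memLp_dual ν (e x) 2 (by simp)).integrable_sq
  have ide : Integrable (fun w => d x w * e x w) ν :=
    (IsGaussian.memLp_dual ν (d x) 2 (by simp)).integrable_mul
      (IsGaussian.memLp_dual ν (e x) 2 (by simp))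
  have iq : Integrable (fun w => A * d x w ^ 2 + 2 * B * (d x w * e x w) + C * e x w ^ 2) ν :=
    ((id2.const_mul A).add (ide.const_mul (2 * B))).add (ie2.const_mul C)
  have i1 : Integrable (fun w => Ja * (u (x + c • w) - a)) ν :=
    (iu.sub (integrable_const a)).const_mul Ja
  have i2 : Integrable (fun w => Jb * (v (x + c • w) - b)) ν :=
    (iv.sub (integrable_const b)).const_mul Jb
  have i3 : Integrable (fun w => c ^ 2 / 2 * (A * d x w ^ 2 + 2 * B * (d x w * e x w) + C * e x w ^ 2)) ν :=
    iq.const_mul _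
  have i4 : Integrable (fun w => c ^ 3 * (S1 * R w ^ 2 + S2 * R w ^ 3)) ν :=
    ((hRi2.const_mul S1).add (hRi3.const_mul S2)).const_mul _
  have e1 : ∫ w, Ja * (u (x + c • w) - a) ∂ν = 0 := by
    rw [integral_const_mul, integral_sub iu (integrable_const a), integral_const]
    simp [ha, Tav]
  have e2 : ∫ w, Jb * (v (x + c • w) - b) ∂ν = 0 := by
    rw [integral_const_mul, integral_sub iv (integrable_const b), integral_const]
    simp [hb, Tav]
  have e4 : ∫ w, c ^ 3 * (S1 * R w ^ 2 + S2 * R w ^ 3) ∂ν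
      = c ^ 3 * (S1 * ∫ w, R w ^ 2 ∂ν + S2 * ∫ w, R w ^ 3 ∂ν) := by
    rw [integral_const_mul, integral_add (hRi2.const_mul S1) (hRi3.const_mul S2),
      integral_const_mul, integral_const_mul]
  have j1 : Integrable (fun w => a ^ r * b ^ s + Ja * (u (x + c • w) - a)) ν :=
    (integrable_const _).add i1
  have j2 : Integrable (fun w => a ^ r * b ^ s + Ja * (u (x + c • w) - a)
    + Jb * (v (x + c • w) - b)) ν := j1.add i2
  have j3 : Integrable (fun w => a ^ r * b ^ s + Ja * (u (x + c • w) - a)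
    + Jb * (v (x + c • w) - b)
      + c ^ 2 / 2 * (A * d x w ^ 2 + 2 * B * (d x w * e x w) + C * e x w ^ 2)) ν := j2.add i3
  have fin := integral_mono (j3.sub i4) iJ point
  simp only [Pi.sub_apply] at fin
  rw [integral_sub j3 i4, integral_add j2 i3, integral_add j1 i2, integral_add (integrable_const _) i1,
    e1, e2, e4, integral_const_mul (c ^ 2 / 2)] at fin
  simp only [integral_const, probReal_univ, one_smul] at fin
  have : 0 ≤ c ^ 2 / 2 * ∫ w, (A * d x w ^ 2 + 2 * B * (d x w * e x w) + C * e x w ^ 2) ∂ν :=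
    mul_nonneg (by positivity) hquad
  linarith

lemma iterate_steps (ν : Measure X) [IsGaussian ν] (h0 : ∀ l : StrongDual ℝ X, ∫ w, l w ∂ν = 0)
    (N₁ N₂ : Set X) (δ M L r s K c : ℝ) (hδ : 0 < δ) (hr : 1 < r) (hs : 1 < s)
    (hc : 0 ≤ c) (hc1 : c ≤ 1)
    (hK : ∀ u d v e, KClass N₁ δ M L u d → KClass N₂ δ M L v e → ∀ c : ℝ, 0 ≤ c → c ≤ 1 → ∀ x : X,
      Tav ν c u x ^ r * Tav ν c v x ^ s - K * c ^ 3
        ≤ ∫ w, u (x + c • w) ^ r * v (x + c • w) ^ s ∂ν)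
    (u : X → ℝ) (d : X → X →L[ℝ] ℝ) (v : X → ℝ) (e : X → X →L[ℝ] ℝ)
    (hu : KClass N₁ δ M L u d) (hv : KClass N₂ δ M L v e) (k : ℕ) : ∀ x : X,
      Tav ν (√k * c) u x ^ r * Tav ν (√k * c) v x ^ s - k * (K * c ^ 3)
        ≤ ∫ w, u (x + (√k * c) • w) ^ r * v (x + (√k * c) • w) ^ s ∂ν := by
  have cu := hu.cu
  have cv := hv.cu
  obtain ⟨KJ, hJ0, hJb⟩ := mono_bdd δ M r s hδ
  induction k with
  | zero => intro x; simp [Tav]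
  | succ k ih =>
    intro x
    have hsq : c ^ 2 + (√k * c) ^ 2 = (√(k + 1 : ℕ) * c) ^ 2 := by
      rw [mul_pow, mul_pow, Real.sq_sqrt (by positivity), Real.sq_sqrt (by positivity)]
      push_cast; ring
    set c' := √k * c
    set c'' := √(k + 1 : ℕ) * c
    have hT : ∀ (N : Set X) (u : X → ℝ) (d : X → X →L[ℝ] ℝ), KClass N δ M L u d →
        Tav ν c'' u x = Tav ν c (Tav ν c' u) x := by
      intro N u d hu
      have cu := hu.cu
      have := gauss_rot_integral ν h0 c c' c'' hsq (fun w => u (x + w)) (by fun_prop) _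
        (fun w => hu.abs_le _)
      unfold Tav
      rw [← this]
      simp only [add_assoc]
    rw [hT N₁ u d hu, hT N₂ v e hv]
    have cJ : Continuous (fun w => u w ^ r * v w ^ s) :=
      Continuous.mul (Continuous.rpow_const (by fun_prop) fun w => Or.inr (by linarith))
        (Continuous.rpow_const (by fun_prop) fun w => Or.inr (by linarith))
    have bJ : ∀ w, ‖u w ^ r * v w ^ s‖ ≤ KJ :=
      fun w => hJb _ ⟨hu.lo _, hu.hi _⟩ _ ⟨hv.lo _, hv.hi _⟩
    have hJr := gauss_rot_integral ν h0 c c' c'' hsq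
      (fun w => u (x + w) ^ r * v (x + w) ^ s) (cJ.comp (continuous_const_add x)) KJ
        (fun w => bJ _)
    rw [← hJr]
    have s1 := hK _ _ _ _ (hu.Tav ν c') (hv.Tav ν c') c hc hc1 x
    have hTu := hu.Tav ν c'
    have hTv := hv.Tav ν c'
    have cTu := hTu.cu
    have cTv := hTv.cu
    have i1 : Integrable (fun w => Tav ν c' u (x + c • w) ^ r * Tav ν c' v (x + c • w) ^ s) ν := by
      refine integrable_of_cont_bdd ν _ ?_ KJ
        (fun w => hJb _ ⟨hTu.lo _, hTu.hi _⟩ _ ⟨hTv.lo _, hTv.hi _⟩)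
      exact Continuous.mul (Continuous.rpow_const (by fun_prop) fun w => Or.inr (by linarith))
        (Continuous.rpow_const (by fun_prop) fun w => Or.inr (by linarith))
    have i2 : Integrable (fun w => ∫ w', u (x + (c • w + c' • w')) ^ r
        * v (x + (c • w + c' • w')) ^ s ∂ν) ν := by
      have hi : Integrable (fun z : X × X => u (x + (c • z.1 + c' • z.2)) ^ r
        * v (x + (c • z.1 + c' • z.2)) ^ s) (ν.prod ν) :=
        integrable_of_cont_bdd _ _ (cJ.comp (g := fun w => u w ^ r * v w ^ s)
          (f := fun z : X × X => x + (c • z.1 + c' • z.2)) (by fun_prop)) KJ (fun z => bJ _)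
      exact hi.integral_prod_left
    have s2 := integral_mono (i1.sub (integrable_const (k * (K * c ^ 3)))) i2 (fun w => by
      have := ih (x + c • w)
      simp only [add_assoc] at this
      simpa only [Pi.sub_apply, add_assoc] using this)
    simp only [Pi.sub_apply] at s2
    rw [integral_sub i1 (integrable_const _)] at s2
    simp only [integral_const, probReal_univ, one_smul] at s2
    push_cast
    linarith

/-- The Gaussian two-function inequality for regular functions. -/
lemma regular_ineq (ν : Measure X) [IsGaussian ν] (h0 : ∀ l : StrongDual ℝ X, ∫ w, l w ∂ν = 0)
    (N₁ N₂ : Set X) (κ : ℝ) (hcorr : CorrCond ν N₁ N₂ κ)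
    (δ M L r s : ℝ) (hδ : 0 < δ) (hr : 1 < r) (hs : 1 < s)
    (hκ : r * s * κ ≤ (r - 1) * (s - 1)) (hL : 0 ≤ L)
    (u : X → ℝ) (d : X → X →L[ℝ] ℝ) (v : X → ℝ) (e : X → X →L[ℝ] ℝ)
    (hu : KClass N₁ δ M L u d) (hv : KClass N₂ δ M L v e) :
    (∫ w, u w ∂ν) ^ r * (∫ w, v w ∂ν) ^ s ≤ ∫ w, u w ^ r * v w ^ s ∂ν := by
  obtain ⟨K, hK⟩ := one_step ν h0 N₁ N₂ κ hcorr δ M L r s hδ hr hs hκ hL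
  have main : ∀ n : ℕ, (∫ w, u w ∂ν) ^ r * (∫ w, v w ∂ν) ^ s - K * (1 / √((n : ℝ) + 1))
      ≤ ∫ w, u w ^ r * v w ^ s ∂ν := by
    intro n
    have hp : (0:ℝ) < √((n : ℝ) + 1) := Real.sqrt_pos.mpr (by positivity)
    have h1 : (1:ℝ) ≤ √((n : ℝ) + 1) := by
      rw [Real.one_le_sqrt]; linarith [(Nat.cast_nonneg n : (0:ℝ) ≤ n)]
    have := iterate_steps ν h0 N₁ N₂ δ M L r s K (1 / √((n : ℝ) + 1)) hδ hr hs (by positivity)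
      (by rw [div_le_one hp]; exact h1) hK u d v e hu hv (n + 1) 0
    push_cast at this
    have e1 : √((n:ℝ) + 1) * (1 / √((n : ℝ) + 1)) = 1 := by field_simp
    have e2 : ((n:ℝ) + 1) * (K * (1 / √((n : ℝ) + 1)) ^ 3) = K * (1 / √((n : ℝ) + 1)) := by
      have : ((n:ℝ) + 1) = √((n : ℝ) + 1) ^ 2 := (Real.sq_sqrt (by positivity)).symm
      nth_rewrite 1 [this]
      field_simp
    rw [e1, e2] at this
    simpa [Tav] using this
  have lim : Tendsto (fun n : ℕ => (∫ w, u w ∂ν) ^ r * (∫ w, v w ∂ν) ^ s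
      - K * (1 / √((n : ℝ) + 1))) atTop
      (nhds ((∫ w, u w ∂ν) ^ r * (∫ w, v w ∂ν) ^ s - K * 0)) := by
    refine tendsto_const_nhds.sub (Tendsto.const_mul K ?_)
    simp only [one_div]
    refine tendsto_inv_atTop_zero.comp (Real.tendsto_sqrt_atTop.comp ?_)
    exact tendsto_atTop_add_const_right _ _ tendsto_natCast_atTop_atTop
  simpa using le_of_tendsto' lim main

end gaussianIteration

section gaussianMain

set_option linter.unusedSectionVars false

variable {E : Type*} [NormedAddCommGroup E] [NormedSpace ℝ E]
variable [MeasurableSpace E] [BorelSpace E] [SecondCountableTopology E] [CompleteSpace E]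

lemma corrCond_prod (γ : Measure E) [IsGaussian γ] (h0 : ∀ l : StrongDual ℝ E, ∫ w, l w ∂γ = 0)
    (ρ σ : ℝ) (hρσ : ρ ^ 2 + σ ^ 2 = 1) :
    CorrCond (γ.prod γ) {z : E × E | z.1 = 0} {z : E × E | ρ • z.1 + σ • z.2 = 0} (ρ ^ 2) := by
  intro d e hd he A B C hA hC hB
  set d1 : E →L[ℝ] ℝ := d.comp (.inl ℝ E E) with hd1
  set e1 : E →L[ℝ] ℝ := e.comp (ρ • .inl ℝ E E + σ • .inr ℝ E E) with he1
  have ed : ∀ z : E × E, d z = d1 z.1 := by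
    intro z
    have h1 : d (z - (z.1, 0)) = 0 := hd _ (by simp)
    rw [map_sub] at h1
    simp [hd1]; linarith
  have ee : ∀ z : E × E, e z = ρ * e1 z.1 + σ * e1 z.2 := by
    intro z
    have h1 : e (z - (ρ • (ρ • z.1 + σ • z.2), σ • (ρ • z.1 + σ • z.2))) = 0 := by
      apply he
      simp only [Set.mem_ofPred_eq, Prod.fst_sub, Prod.snd_sub]
      have : ρ • (z.1 - ρ • (ρ • z.1 + σ • z.2)) + σ • (z.2 - σ • (ρ • z.1 + σ • z.2))
        = (1 - (ρ ^ 2 + σ ^ 2)) • (ρ • z.1 + σ • z.2) := by module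
      rw [this, hρσ]; simp
    rw [map_sub] at h1
    have h2 : e (ρ • (ρ • z.1 + σ • z.2), σ • (ρ • z.1 + σ • z.2)) = e1 (ρ • z.1 + σ • z.2) := by
      simp only [he1, ContinuousLinearMap.comp_apply]
      congr 1
      simp
    rw [h2, map_add, map_smul, map_smul, smul_eq_mul, smul_eq_mul] at h1
    linarith
  simp_rw [ed, ee]
  have m1 := IsGaussian.memLp_dual γ d1 2 (by simp)
  have m2 := IsGaussian.memLp_dual γ e1 2 (by simp)
  have n1 := IsGaussian.integrable_dual γ d1
  have n2 := IsGaussian.integrable_dual γ e1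
  have i1 : Integrable (fun x => d1 x ^ 2) γ := m1.integrable_sq
  have i2 : Integrable (fun x => e1 x ^ 2) γ := m2.integrable_sq
  have i3 : Integrable (fun x => d1 x * e1 x) γ := m1.integrable_mul m2
  have iF : Integrable (fun x => A * d1 x ^ 2 + 2 * B * ρ * (d1 x * e1 x) + C * ρ ^ 2 * e1 x ^ 2) γ :=
    ((i1.const_mul A).add (i3.const_mul (2 * B * ρ))).add (i2.const_mul (C * ρ ^ 2))
  have j1 : Integrable (fun z : E × E => A * d1 z.1 ^ 2 + 2 * B * ρ * (d1 z.1 * e1 z.1)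
      + C * ρ ^ 2 * e1 z.1 ^ 2) (γ.prod γ) := iF.comp_fst γ
  have j2 : Integrable (fun z : E × E => C * σ ^ 2 * e1 z.2 ^ 2) (γ.prod γ) :=
    (i2.const_mul (C * σ ^ 2)).comp_snd γ
  have j3 : Integrable (fun z : E × E => 2 * B * σ * (d1 z.1 * e1 z.2)) (γ.prod γ) :=
    (n1.mul_prod n2).const_mul _
  have j4 : Integrable (fun z : E × E => 2 * C * ρ * σ * (e1 z.1 * e1 z.2)) (γ.prod γ) :=
    (n2.mul_prod n2).const_mul _
  have eq : ∀ z : E × E, A * d1 z.1 ^ 2 + 2 * B * (d1 z.1 * (ρ * e1 z.1 + σ * e1 z.2))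
      + C * (ρ * e1 z.1 + σ * e1 z.2) ^ 2
      = ((A * d1 z.1 ^ 2 + 2 * B * ρ * (d1 z.1 * e1 z.1) + C * ρ ^ 2 * e1 z.1 ^ 2)
        + C * σ ^ 2 * e1 z.2 ^ 2) + (2 * B * σ * (d1 z.1 * e1 z.2)
        + 2 * C * ρ * σ * (e1 z.1 * e1 z.2)) := fun z => by ring
  simp_rw [eq]
  have j12 := j1.add j2
  have j34 := j3.add j4
  simp only [Pi.add_def] at j12 j34
  rw [integral_add j12 j34, integral_add j1 j2, integral_add j3 j4,
    integral_const_mul, integral_const_mul, integral_const_mul,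
    integral_prod_mul (fun x => d1 x) (fun y => e1 y),
    integral_prod_mul (fun x => e1 x) (fun y => e1 y), h0, h0]
  rw [integral_fun_fst (μ := γ) (ν := γ) (fun x => A * d1 x ^ 2 + 2 * B * ρ * (d1 x * e1 x)
      + C * ρ ^ 2 * e1 x ^ 2), integral_fun_snd (μ := γ) (ν := γ) (fun x => e1 x ^ 2)]
  simp only [probReal_univ, one_smul, mul_zero, add_zero]
  rw [← integral_const_mul, ← integral_add iF (i2.const_mul _)]
  refine integral_nonneg fun x => ?_
  have : A * d1 x ^ 2 + 2 * B * ρ * (d1 x * e1 x) + C * ρ ^ 2 * e1 x ^ 2 + C * σ ^ 2 * e1 x ^ 2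
    = A * d1 x ^ 2 + 2 * (B * ρ) * (d1 x * e1 x) + C * e1 x ^ 2 := by
    have : C = C * (ρ ^ 2 + σ ^ 2) := by rw [hρσ, mul_one]
    nth_rewrite 3 [this]; ring
  simp only [Pi.zero_apply]
  rw [this]
  have hB' : (B * ρ) ^ 2 ≤ A * C := by rw [mul_pow]; exact hB
  rcases hA.eq_or_lt with h | h
  · have : B * ρ = 0 := by
      rw [← h, zero_mul] at hB'
      exact pow_eq_zero_iff (two_ne_zero) |>.mp (le_antisymm hB' (sq_nonneg _))
    rw [← h, this]
    have := mul_nonneg hC (sq_nonneg (e1 x))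
    linarith
  · have h2 : 0 ≤ A * (A * d1 x ^ 2 + 2 * (B * ρ) * (d1 x * e1 x) + C * e1 x ^ 2) := by
      nlinarith [sq_nonneg (A * d1 x + B * ρ * e1 x),
        mul_nonneg (sub_nonneg.mpr hB') (sq_nonneg (e1 x))]
    exact nonneg_of_mul_nonneg_right h2 h

variable [FiniteDimensional ℝ E]

/-- Smooth compactly supported perturbations of constants are in the class. -/
lemma KClass_of_smooth {X : Type*} [NormedAddCommGroup X] [NormedSpace ℝ X] (π : X →L[ℝ] E)
    (g : E → ℝ) (hg : ContDiff ℝ (⊤ : ℕ∞) g) (hs : HasCompactSupport g)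
    (δ M : ℝ) (hlo : ∀ x, 0 ≤ g x) (hhi : ∀ x, δ + g x ≤ M) :
    ∃ L0, ∀ L, L0 ≤ L → KClass {z : X | π z = 0} δ M L (fun x => δ + g (π x))
      (fun x => (fderiv ℝ g (π x)).comp π) := by
  have hgd : Differentiable ℝ g := hg.differentiable (by simp)
  have hg' : ContDiff ℝ 1 (fderiv ℝ g) := hg.fderiv_right (by norm_cast)
  obtain ⟨K1, h1⟩ := (hs.fderiv ℝ).exists_bound_of_continuous hg'.continuous
  obtain ⟨K2, h2⟩ := ContDiff.lipschitzWith_of_hasCompactSupport (hs.fderiv ℝ) hg' (by simp)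
  refine ⟨max (K1 * ‖π‖) (K2 * ‖π‖ ^ 2), fun L hL => ?_⟩
  have hL1 := (le_max_left _ _).trans hL
  have hL2 := (le_max_right _ _).trans hL
  have cg := hg.continuous
  have cg' := hg'.continuous
  constructor
  · fun_prop
  · exact (cg'.comp π.continuous).clm_comp continuous_const
  · intro x; linarith [hlo (π x)]
  · intro x; exact hhi _
  · intro x
    refine (ContinuousLinearMap.opNorm_comp_le _ _).trans (le_trans ?_ hL1)
    exact mul_le_mul_of_nonneg_right (h1 _) (norm_nonneg _)
  · intro x z
    have hb : ∀ y ∈ Metric.closedBall (π x) ‖π z‖, ‖fderiv ℝ g y - fderiv ℝ g (π x)‖ ≤ K2 * ‖π z‖ := by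
      intro y hy
      have := h2.dist_le_mul y (π x)
      rw [dist_eq_norm] at this
      exact this.trans (mul_le_mul_of_nonneg_left hy K2.2)
    have := (convex_closedBall (π x) ‖π z‖).norm_image_sub_le_of_norm_fderiv_le' (𝕜 := ℝ)
      (fun y _ => hgd y) hb
      (Metric.mem_closedBall_self (norm_nonneg _)) (y := π x + π z) (by simp)
    rw [add_sub_cancel_left, Real.norm_eq_abs] at this
    have e : δ + g (π (x + z)) - (δ + g (π x)) - ((fderiv ℝ g (π x)).comp π) z
      = g (π x + π z) - g (π x) - fderiv ℝ g (π x) (π z) := by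
      rw [map_add]; simp
    rw [e]
    refine this.trans ?_
    have hπ := π.le_opNorm z
    have : ‖π z‖ * ‖π z‖ ≤ (‖π‖ * ‖z‖) * (‖π‖ * ‖z‖) := by gcongr
    calc K2 * ‖π z‖ * ‖π z‖ = K2 * (‖π z‖ * ‖π z‖) := by ring
      _ ≤ K2 * ((‖π‖ * ‖z‖) * (‖π‖ * ‖z‖)) := mul_le_mul_of_nonneg_left this K2.2
      _ = (K2 * ‖π‖ ^ 2) * ‖z‖ ^ 2 := by ring
      _ ≤ _ := by gcongr
  · intro x z hz
    have : π z = 0 := hz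
    simp [this]

/-- Cutoff functions. -/
noncomputable def bumpK (E : Type*) [NormedAddCommGroup E] [NormedSpace ℝ E] (k : ℕ) : ContDiffBump (0 : E) :=
  ⟨(k : ℝ) + 1, (k : ℝ) + 2, by positivity, by linarith⟩

/-- The compactly supported part of the approximation to `f ^ p`. -/
noncomputable def apx (p : ℝ) (f : E → ℝ) (k : ℕ) (x : E) : ℝ :=
  bumpK E k x * (f x + 1 / ((k : ℝ) + 1)) ^ p

lemma apx_props (p : ℝ) (hp : p ∈ Set.Ioo (0:ℝ) 1) (f : E → ℝ) (hf : ContDiff ℝ (⊤ : ℕ∞) f)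
    (hpos : ∀ x, 0 ≤ f x) (C : ℝ) (hC : ∀ x, f x ≤ C) (k : ℕ) :
    ContDiff ℝ (⊤ : ℕ∞) (apx p f k) ∧ HasCompactSupport (apx p f k) ∧ (∀ x, 0 ≤ apx p f k x) ∧
      (∀ x, 1 / ((k:ℝ) + 1) + apx p f k x ≤ 1 + (C + 1) ^ p) := by
  have hk : (0:ℝ) < 1 / ((k:ℝ) + 1) := by positivity
  have hk1 : 1 / ((k:ℝ) + 1) ≤ 1 := by
    rw [div_le_one (by positivity)]; linarith [(Nat.cast_nonneg k : (0:ℝ) ≤ k)]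
  have hq : ∀ x, 0 < f x + 1 / ((k:ℝ) + 1) := fun x => by linarith [hpos x]
  refine ⟨?_, ?_, ?_, ?_⟩
  · refine ContDiff.mul (bumpK E k).contDiff ?_
    exact (hf.add contDiff_const).rpow_const_of_ne fun x => (hq x).ne'
  · exact (bumpK E k).hasCompactSupport.mul_right
  · intro x
    exact mul_nonneg (bumpK E k).nonneg (Real.rpow_nonneg (hq x).le _)
  · intro x
    have h1 : (f x + 1 / ((k:ℝ) + 1)) ^ p ≤ (C + 1) ^ p :=
      Real.rpow_le_rpow (hq x).le (by linarith [hC x]) hp.1.le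
    have h2 : apx p f k x ≤ 1 * (f x + 1 / ((k:ℝ) + 1)) ^ p :=
      mul_le_mul_of_nonneg_right (bumpK E k).le_one (Real.rpow_nonneg (hq x).le _)
    linarith

lemma apx_tendsto (p : ℝ) (hp : p ∈ Set.Ioo (0:ℝ) 1) (f : E → ℝ) (x : E) :
    Tendsto (fun k : ℕ => 1 / ((k:ℝ) + 1) + apx p f k x) atTop (nhds (f x ^ p)) := by
  have h0 : Tendsto (fun k : ℕ => 1 / ((k:ℝ) + 1)) atTop (nhds 0) :=
    tendsto_one_div_add_atTop_nhds_zero_nat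
  have h1 : Tendsto (fun k : ℕ => 1 / ((k:ℝ) + 1) + (f x + 1 / ((k:ℝ) + 1)) ^ p) atTop
      (nhds (0 + (f x + 0) ^ p)) :=
    h0.add ((tendsto_const_nhds.add h0).rpow_const (Or.inr hp.1.le))
  rw [zero_add, add_zero] at h1
  refine h1.congr' ?_
  filter_upwards [eventually_ge_atTop ⌈‖x‖⌉₊] with k hk
  have : bumpK E k x = 1 := by
    apply (bumpK E k).one_of_mem_closedBall
    rw [mem_closedBall_zero_iff]
    have : ‖x‖ ≤ k := (Nat.le_ceil _).trans (by exact_mod_cast hk)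
    change ‖x‖ ≤ (k:ℝ) + 1
    linarith
  rw [apx, this, one_mul]

lemma gauss_main (γ : Measure E) [IsGaussian γ] (h0 : ∀ l : StrongDual ℝ E, ∫ w, l w ∂γ = 0)
    (ρ σ : ℝ) (hρσ : ρ ^ 2 + σ ^ 2 = 1) (p q : ℝ) (hp : p ∈ Set.Ioo (0:ℝ) 1)
    (hq : q ∈ Set.Ioo (0:ℝ) 1) (hpq : ρ ^ 2 ≤ (1 - p) * (1 - q)) (f g : E → ℝ)
    (hf : ContDiff ℝ (⊤ : ℕ∞) f) (hg : ContDiff ℝ (⊤ : ℕ∞) g)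
    (hpf : ∀ x, 0 ≤ f x) (hpg : ∀ x, 0 ≤ g x)
    (Cf Cg : ℝ) (hCf : ∀ x, f x ≤ Cf) (hCg : ∀ x, g x ≤ Cg) :
    (∫ x, f x ^ p ∂γ) ^ (1 / p) * (∫ x, g x ^ q ∂γ) ^ (1 / q)
      ≤ ∫ x, f x * ∫ y, g (ρ • x + σ • y) ∂γ ∂γ := by
  set ν := γ.prod γ with hν
  have h0' : ∀ l : StrongDual ℝ (E × E), ∫ w, l w ∂ν = 0 := by
    intro l
    rw [integral_continuousLinearMap_prod' (IsGaussian.integrable_dual γ (l.comp (.inl ℝ E E)))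
      (IsGaussian.integrable_dual γ (l.comp (.inr ℝ E E))), h0, h0, add_zero]
  set π : E × E →L[ℝ] E := ρ • ContinuousLinearMap.fst ℝ E E + σ • ContinuousLinearMap.snd ℝ E E
    with hπ
  have hπa : ∀ z : E × E, π z = ρ • z.1 + σ • z.2 := fun z => by simp [hπ]
  have hr : 1 < 1 / p := by rw [lt_div_iff₀ hp.1]; linarith [hp.2]
  have hs : 1 < 1 / q := by rw [lt_div_iff₀ hq.1]; linarith [hq.2]
  have hp0 := hp.1
  have hq0 := hq.1
  have hκ : 1 / p * (1 / q) * ρ ^ 2 ≤ (1 / p - 1) * (1 / q - 1) := by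
    have : (1 / p - 1) * (1 / q - 1) = 1 / p * (1 / q) * ((1 - p) * (1 - q)) := by
      field_simp
    rw [this]
    exact mul_le_mul_of_nonneg_left hpq (by positivity)
  have hcorr := corrCond_prod γ h0 ρ σ hρσ
  set M := max (1 + (Cf + 1) ^ p) (1 + (Cg + 1) ^ q) with hM
  set U : ℕ → E × E → ℝ := fun k z => 1 / ((k:ℝ) + 1) + apx p f k z.1 with hU
  set V : ℕ → E × E → ℝ := fun k z => 1 / ((k:ℝ) + 1) + apx q g k (π z) with hV
  have Uprop : ∀ k, Continuous (U k) ∧ ∀ z, 0 ≤ U k z ∧ U k z ≤ M := by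
    intro k
    obtain ⟨a1, a2, a3, a4⟩ := apx_props p hp f hf hpf Cf hCf k
    have := a1.continuous
    refine ⟨by fun_prop, fun z => ⟨add_nonneg (by positivity) (a3 _), (a4 _).trans (le_max_left _ _)⟩⟩
  have Vprop : ∀ k, Continuous (V k) ∧ ∀ z, 0 ≤ V k z ∧ V k z ≤ M := by
    intro k
    obtain ⟨a1, a2, a3, a4⟩ := apx_props q hq g hg hpg Cg hCg k
    have := a1.continuous
    refine ⟨by fun_prop, fun z => ⟨add_nonneg (by positivity) (a3 _), (a4 _).trans (le_max_right _ _)⟩⟩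
  have ineq : ∀ k, (∫ z, U k z ∂ν) ^ (1 / p) * (∫ z, V k z ∂ν) ^ (1 / q)
      ≤ ∫ z, U k z ^ (1 / p) * V k z ^ (1 / q) ∂ν := by
    intro k
    obtain ⟨a1, a2, a3, a4⟩ := apx_props p hp f hf hpf Cf hCf k
    obtain ⟨b1, b2, b3, b4⟩ := apx_props q hq g hg hpg Cg hCg k
    obtain ⟨L1, hL1⟩ := KClass_of_smooth (ContinuousLinearMap.fst ℝ E E) _ a1 a2
      (1 / ((k:ℝ) + 1)) M a3 (fun x => (a4 x).trans (le_max_left _ _))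
    obtain ⟨L2, hL2⟩ := KClass_of_smooth π _ b1 b2
      (1 / ((k:ℝ) + 1)) M b3 (fun x => (b4 x).trans (le_max_right _ _))
    have K1 := hL1 (max (max L1 L2) 0) ((le_max_left _ _).trans (le_max_left _ _))
    have K2 := hL2 (max (max L1 L2) 0) ((le_max_right _ _).trans (le_max_left _ _))
    have hcorr' : CorrCond ν {z : E × E | (ContinuousLinearMap.fst ℝ E E) z = 0}
        {z : E × E | π z = 0} (ρ ^ 2) := by
      simpa only [hπa, ContinuousLinearMap.coe_fst'] using hcorr
    exact regular_ineq ν h0' _ _ (ρ ^ 2) hcorr' _ M _ (1 / p) (1 / q) (by positivity) hr hs hκ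
      (le_max_right _ _) _ _ _ _ K1 K2
  have tU : ∀ z, Tendsto (fun k => U k z) atTop (nhds (f z.1 ^ p)) := fun z => apx_tendsto p hp f z.1
  have tV : ∀ z, Tendsto (fun k => V k z) atTop (nhds (g (π z) ^ q)) :=
    fun z => apx_tendsto q hq g (π z)
  have l1 : Tendsto (fun k => ∫ z, U k z ∂ν) atTop (nhds (∫ z, f z.1 ^ p ∂ν)) := by
    refine tendsto_integral_of_dominated_convergence (fun _ => M)
      (fun k => (Uprop k).1.aestronglyMeasurable) (integrable_const _) (fun k => ?_) ?_
    · exact Eventually.of_forall fun z => by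
        rw [Real.norm_of_nonneg ((Uprop k).2 z).1]; exact ((Uprop k).2 z).2
    · exact Eventually.of_forall tU
  have l2 : Tendsto (fun k => ∫ z, V k z ∂ν) atTop (nhds (∫ z, g (π z) ^ q ∂ν)) := by
    refine tendsto_integral_of_dominated_convergence (fun _ => M)
      (fun k => (Vprop k).1.aestronglyMeasurable) (integrable_const _) (fun k => ?_) ?_
    · exact Eventually.of_forall fun z => by
        rw [Real.norm_of_nonneg ((Vprop k).2 z).1]; exact ((Vprop k).2 z).2
    · exact Eventually.of_forall tV
  have l3 : Tendsto (fun k => ∫ z, U k z ^ (1 / p) * V k z ^ (1 / q) ∂ν) atTop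
      (nhds (∫ z, f z.1 * g (π z) ∂ν)) := by
    refine tendsto_integral_of_dominated_convergence (fun _ => M ^ (1 / p) * M ^ (1 / q))
      (fun k => ?_) (integrable_const _) (fun k => ?_) ?_
    · exact (((Uprop k).1.rpow_const fun _ => Or.inr (by positivity)).mul
        ((Vprop k).1.rpow_const fun _ => Or.inr (by positivity))).aestronglyMeasurable
    · refine Eventually.of_forall fun z => ?_
      have hu := (Uprop k).2 z
      have hv := (Vprop k).2 z
      have i1 := Real.rpow_le_rpow hu.1 hu.2 (by positivity : 0 ≤ 1 / p)
      have i2 := Real.rpow_le_rpow hv.1 hv.2 (by positivity : 0 ≤ 1 / q)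
      have n1 := Real.rpow_nonneg hu.1 (1 / p)
      have n2 := Real.rpow_nonneg hv.1 (1 / q)
      rw [Real.norm_of_nonneg (mul_nonneg n1 n2)]
      exact mul_le_mul i1 i2 n2 (n1.trans i1)
    · refine Eventually.of_forall fun z => ?_
      have i1 := (tU z).rpow_const (p := 1 / p) (Or.inr (by positivity))
      have i2 := (tV z).rpow_const (p := 1 / q) (Or.inr (by positivity))
      rw [← Real.rpow_mul (hpf _), mul_one_div_cancel hp0.ne', Real.rpow_one] at i1
      rw [← Real.rpow_mul (hpg _), mul_one_div_cancel hq0.ne', Real.rpow_one] at i2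
      exact i1.mul i2
  have fin := le_of_tendsto_of_tendsto' ((l1.rpow_const (p := 1 / p) (Or.inr (by positivity))).mul
    (l2.rpow_const (p := 1 / q) (Or.inr (by positivity)))) l3 ineq
  have cf := hf.continuous
  have cg := hg.continuous
  have e1 : ∫ z, f z.1 ^ p ∂ν = ∫ x, f x ^ p ∂γ := by
    rw [hν, integral_fun_fst (μ := γ) (ν := γ) (fun x => f x ^ p)]; simp
  have e2 : ∫ z, g (π z) ^ q ∂ν = ∫ x, g x ^ q ∂γ := by
    have cgq : Continuous (fun x => g x ^ q) := cg.rpow_const fun _ => Or.inr hq0.le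
    have bgq : ∀ x, ‖g x ^ q‖ ≤ Cg ^ q := fun x => by
      rw [Real.norm_of_nonneg (Real.rpow_nonneg (hpg x) _)]
      exact Real.rpow_le_rpow (hpg x) (hCg x) hq0.le
    have := gauss_rot_integral γ h0 ρ σ 1 (by rw [hρσ]; norm_num) (fun x => g x ^ q) cgq _ bgq
    simp only [one_smul] at this
    rw [← this, hν, integral_prod]
    · simp only [hπa]
    · exact integrable_of_cont_bdd _ _ (cgq.comp π.continuous) _ (fun z => bgq (π z))
  have e3 : ∫ z, f z.1 * g (π z) ∂ν = ∫ x, f x * ∫ y, g (ρ • x + σ • y) ∂γ ∂γ := by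
    rw [hν, integral_prod]
    · simp only [hπa, integral_const_mul]
    · refine integrable_of_cont_bdd _ _ (by fun_prop) (Cf * Cg) (fun z => ?_)
      rw [Real.norm_of_nonneg (mul_nonneg (hpf _) (hpg _))]
      exact mul_le_mul (hCf _) (hCg _) (hpg _) ((hpf z.1).trans (hCf _))
  rwa [e1, e2, e3] at fin

end gaussianMain

lemma gaussianPi_isGaussian (n : ℕ) : IsGaussian (gaussianPi n) := by
  have h := map_pi_eq_stdGaussian (ι := Fin n)
  have : IsGaussian ((gaussianPi n).map (WithLp.toLp 2)) := by
    unfold gaussianPi _root_.stdGaussian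
    rw [h]; infer_instance
  exact (isGaussian_map_equiv_iff (μ := gaussianPi n) (EuclideanSpace.equiv (Fin n) ℝ).symm).mp this

lemma gaussianPi_centered (n : ℕ) (l : StrongDual ℝ (Fin n → ℝ)) : ∫ w, l w ∂(gaussianPi n) = 0 := by
  have hl : ∀ w, l w = ∑ i, l (Pi.single i 1) * w i := by
    intro w
    conv_lhs => rw [← Finset.univ_sum_single w]
    rw [map_sum]
    refine Finset.sum_congr rfl fun i _ => ?_
    rw [show (Pi.single i (w i) : Fin n → ℝ) = w i • Pi.single i 1 by
      rw [← Pi.single_smul]; simp, map_smul, smul_eq_mul, mul_comm]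
  rw [integral_congr_ae (Eventually.of_forall hl)]
  haveI := gaussianPi_isGaussian n
  rw [integral_finset_sum]
  · refine Finset.sum_eq_zero fun i _ => ?_
    rw [integral_const_mul]
    have : ∫ w : Fin n → ℝ, w i ∂(gaussianPi n) = 0 := by
      unfold gaussianPi _root_.stdGaussian
      have := integral_comp_eval (μ := fun _ : Fin n => gaussianReal 0 1) (i := i)
        (f := fun x : ℝ => x) (by fun_prop)
      rw [this]; simp
    rw [this, mul_zero]
  · intro i _
    exact (IsGaussian.integrable_dual (gaussianPi n) (ContinuousLinearMap.proj i)).const_mul _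

/-- **Theorem (Gaussian reverse hypercontractivity).**
Let `f₁, f₂ : ℝⁿ → ℝ₊` be smooth bounded nonnegative functions. Then for any
`p, q ∈ (0,1)` and any `t > 0` with `e^{−2t} ≤ (1−p)(1−q)`,
`E_μ[f₁ · P_t f₂] ≥ ‖f₁‖_p · ‖f₂‖_q`. -/
theorem gaussian_reverse_hypercontractivity
    (n : ℕ) (f₁ f₂ : (Fin n → ℝ) → ℝ)
    (hf₁ : ContDiff ℝ (⊤ : ℕ∞) f₁) (hf₂ : ContDiff ℝ (⊤ : ℕ∞) f₂)
    (hpos₁ : ∀ x, 0 ≤ f₁ x) (hpos₂ : ∀ x, 0 ≤ f₂ x)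
    (C₁ C₂ : ℝ) (hb₁ : ∀ x, f₁ x ≤ C₁) (hb₂ : ∀ x, f₂ x ≤ C₂)
    (p q : ℝ) (hp : p ∈ Set.Ioo (0 : ℝ) 1) (hq : q ∈ Set.Ioo (0 : ℝ) 1)
    (t : ℝ) (ht : 0 < t) (hpq : Real.exp (-(2 * t)) ≤ (1 - p) * (1 - q)) :
    ∫ x, f₁ x * OU t f₂ x ∂(gaussianPi n) ≥ pNorm p f₁ * pNorm q f₂ := by
  haveI := gaussianPi_isGaussian n
  have he : Real.exp (-(2 * t)) = Real.exp (-t) ^ 2 := by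
    rw [← Real.exp_nat_mul]; congr 1; push_cast; ring
  have hle : Real.exp (-(2 * t)) ≤ 1 := Real.exp_le_one_iff.mpr (by linarith)
  have h := gauss_main (gaussianPi n) (gaussianPi_centered n) (Real.exp (-t))
    (Real.sqrt (1 - Real.exp (-(2 * t))))
    (by rw [Real.sq_sqrt (by linarith), he]; ring) p q hp hq (by rw [← he]; exact hpq)
    f₁ f₂ hf₁ hf₂ hpos₁ hpos₂ C₁ C₂ hb₁ hb₂
  unfold pNorm OU
  simp only [abs_of_nonneg (hpos₁ _), abs_of_nonneg (hpos₂ _)]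
  exact h
end

section
/- Let A_ℓ ⊆ ℝ^{n_ℓ} be a sequence of increasing Borel sets. If for every ρ ∈ (0,1) one has VAR^G(A_ℓ, ρ) → 0 as ℓ → ∞, then ∑_{i=1}^{n_ℓ} I_i^G(A_ℓ)² → 0 as ℓ → ∞. -/
open MeasureTheory ProbabilityTheory Filter Pointwise

noncomputable section

/-- For a pair `p = (w, w')` of points of `ℝⁿ`, the `ρ`-noised point
`W^ρ = √(1−ρ²)·w + ρ·w'`. -/
def noised {n : ℕ} (ρ : ℝ) (p : (Fin n → ℝ) × (Fin n → ℝ)) : Fin n → ℝ :=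
  fun i => Real.sqrt (1 - ρ ^ 2) * p.1 i + ρ * p.2 i

/-- `Z^G(f, ρ) = E[f(W)·f(W^ρ)]` where `W, W'` are i.i.d. standard Gaussian vectors. -/
def gaussZ {n : ℕ} (f : (Fin n → ℝ) → ℝ) (ρ : ℝ) : ℝ :=
  ∫ p, f p.1 * f (noised ρ p) ∂((gaussianPi n).prod (gaussianPi n))

/-- `VAR^G(f, ρ) = Z^G(f, ρ) − (E f(W))²`. -/
def gaussVAR {n : ℕ} (f : (Fin n → ℝ) → ℝ) (ρ : ℝ) : ℝ :=
  gaussZ f ρ - (∫ x, f x ∂(gaussianPi n)) ^ 2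

end

section helper

instance stdG_prob : IsProbabilityMeasure (_root_.stdGaussian) := by
  unfold _root_.stdGaussian; infer_instance

instance gPi_prob (n : ℕ) : IsProbabilityMeasure (gaussianPi n) := by
  unfold gaussianPi; infer_instance

instance gPi_gauss (n : ℕ) : IsGaussian (gaussianPi n) := by
  have hI : iIndepFun (fun (i : Fin n) (x : Fin n → ℝ) => x i) (gaussianPi n) :=
    iIndepFun_pi (μ := fun _ : Fin n => _root_.stdGaussian) (X := fun _ x => x)
      (fun i => aemeasurable_id)
  have hG : ∀ i : Fin n, HasGaussianLaw (fun x : Fin n → ℝ => x i) (gaussianPi n) := by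
    intro i
    refine ⟨?_⟩
    have : (gaussianPi n).map (fun x : Fin n → ℝ => x i) = gaussianReal 0 1 :=
      (measurePreserving_eval (fun _ : Fin n => _root_.stdGaussian) i).map_eq
    rw [this]; infer_instance
  have := (iIndepFun.hasGaussianLaw hG hI).isGaussian_map
  have e : (fun (ω : Fin n → ℝ) (x : Fin n) => ω x) = id := rfl
  rw [e, Measure.map_id] at this
  exact this

lemma integral_coord {n : ℕ} (i : Fin n) : ∫ x, x i ∂(gaussianPi n) = 0 := by
  have := integral_comp_eval (μ := fun _ : Fin n => _root_.stdGaussian) (i := i) (f := fun y : ℝ => y)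
    aestronglyMeasurable_id
  unfold gaussianPi
  rw [this]
  exact integral_id_gaussianReal

lemma memLp_coord {n : ℕ} (i : Fin n) : MemLp (fun x : Fin n → ℝ => x i) 2 (gaussianPi n) := by
  have h : MemLp (fun y : ℝ => y) 2 (_root_.stdGaussian) := memLp_id_gaussianReal' 2 (by simp)
  exact h.comp_measurePreserving (measurePreserving_eval (fun _ : Fin n => _root_.stdGaussian) i)

lemma integrable_coord {n : ℕ} (i : Fin n) : Integrable (fun x : Fin n → ℝ => x i) (gaussianPi n) :=
  (memLp_coord i).integrable (by norm_num)

lemma integral_coord_mul {n : ℕ} (i j : Fin n) :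
    ∫ x, x i * x j ∂(gaussianPi n) = if i = j then 1 else 0 := by
  split_ifs with h
  · subst h
    have := integral_comp_eval (μ := fun _ : Fin n => _root_.stdGaussian) (i := i)
      (f := fun y : ℝ => y * y) (by fun_prop)
    unfold gaussianPi
    rw [this]
    have hv := variance_fun_id_gaussianReal (μ := 0) (v := 1)
    rw [variance_of_integral_eq_zero (by fun_prop) (by simp [integral_id_gaussianReal])] at hv
    simpa [_root_.stdGaussian, pow_two] using hv
  · have hI : iIndepFun (fun (i : Fin n) (x : Fin n → ℝ) => x i) (gaussianPi n) :=
      iIndepFun_pi (μ := fun _ : Fin n => _root_.stdGaussian) (X := fun _ x => x)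
        (fun i => aemeasurable_id)
    have := (hI.indepFun h).integral_fun_mul_eq_mul_integral
      (integrable_coord i).aestronglyMeasurable (integrable_coord j).aestronglyMeasurable
    rw [this, integral_coord, zero_mul]

lemma exists_angle {c s : ℝ} (h : c ^ 2 + s ^ 2 = 1) : ∃ θ : ℝ, Real.cos θ = c ∧ Real.sin θ = s := by
  have hn : ‖(⟨c, s⟩ : ℂ)‖ = 1 := by
    rw [Complex.norm_eq_sqrt_sq_add_sq]; simp [h]
  refine ⟨Complex.arg ⟨c, s⟩, ?_, ?_⟩
  · have := Complex.norm_mul_cos_arg ⟨c, s⟩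
    simpa [hn] using this
  · have := Complex.norm_mul_sin_arg ⟨c, s⟩
    simpa [hn] using this

lemma rot {n : ℕ} {c s : ℝ} (h : c ^ 2 + s ^ 2 = 1) (G : (Fin n → ℝ) × (Fin n → ℝ) → ℝ)
    (hG : Measurable G) :
    ∫ p, G (c • p.1 + s • p.2, -s • p.1 + c • p.2) ∂((gaussianPi n).prod (gaussianPi n))
      = ∫ p, G p ∂((gaussianPi n).prod (gaussianPi n)) := by
  obtain ⟨θ, rfl, rfl⟩ := exists_angle h
  have hz : (gaussianPi n)[id] = 0 := by
    ext i
    have := ContinuousLinearMap.integral_comp_comm (ContinuousLinearMap.proj (R := ℝ) (φ := fun _ : Fin n => ℝ) i)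
      (IsGaussian.integrable_id (μ := gaussianPi n))
    simp only [ContinuousLinearMap.proj_apply, id] at this
    simp only [id, Pi.zero_apply]
    rw [← this, integral_coord]
  have := IsGaussian.map_rotation_eq_self (μ := gaussianPi n) hz θ
  conv_rhs => rw [← this]
  rw [integral_map (by fun_prop) hG.aestronglyMeasurable]
  rfl

end helper

section mink

lemma pdf_hasDeriv (x : ℝ) :
    HasDerivAt (fun y => -gaussianPDFReal 0 1 y) (gaussianPDFReal 0 1 x * x) x := by
  have h : HasDerivAt (fun y : ℝ => -((√(2 * Real.pi))⁻¹ * Real.exp (-y ^ 2 / 2)))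
      (-((√(2 * Real.pi))⁻¹ * (Real.exp (-x ^ 2 / 2) * (-(2 * x) / 2)))) x := by
    have h1 : HasDerivAt (fun y : ℝ => -y ^ 2 / 2) (-(2 * x) / 2) x := by
      simpa using ((hasDerivAt_pow 2 x).neg.div_const 2)
    exact ((h1.exp).const_mul _).neg
  have e : (fun y => -gaussianPDFReal 0 1 y) =
      (fun y : ℝ => -((√(2 * Real.pi))⁻¹ * Real.exp (-y ^ 2 / 2))) := by
    funext y; simp [gaussianPDFReal]
  rw [e]
  convert h using 1
  simp [gaussianPDFReal]; ring

lemma pdf_cont : Continuous (gaussianPDFReal 0 1) := by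
  rw [gaussianPDFReal_def]; fun_prop

lemma pdf_mul_integrable : Integrable (fun x => gaussianPDFReal 0 1 x * x) := by
  have := (integrable_mul_exp_neg_mul_sq (b := 1 / 2) (by norm_num)).const_mul (√(2 * Real.pi))⁻¹
  convert this using 2 with x
  simp [gaussianPDFReal]
  ring_nf

lemma pdf_tendsto : Tendsto (fun y => -gaussianPDFReal 0 1 y) atTop (nhds 0) := by
  have h : Tendsto (fun y : ℝ => Real.exp (-y ^ 2 / 2)) atTop (nhds 0) := by
    refine Real.tendsto_exp_atBot.comp ?_
    have : Tendsto (fun y : ℝ => y ^ 2 * (1 / 2)) atTop atTop :=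
      (tendsto_pow_atTop (by norm_num)).atTop_mul_const (by norm_num)
    convert tendsto_neg_atTop_atBot.comp this using 2 with y
    simp; ring
  have h2 := (h.const_mul (√(2 * Real.pi))⁻¹).neg
  simp only [mul_zero, neg_zero] at h2
  convert h2 using 2 with y
  simp [gaussianPDFReal]

lemma integral_Ioi_std (t : ℝ) :
    ∫ y in Set.Ioi t, y ∂(_root_.stdGaussian) = gaussianPDFReal 0 1 t := by
  rw [← integral_indicator measurableSet_Ioi]
  unfold _root_.stdGaussian
  rw [integral_gaussianReal_eq_integral_smul (by norm_num)]
  have e : (fun x => gaussianPDFReal 0 1 x • (Set.Ioi t).indicator (fun y => y) x)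
      = (Set.Ioi t).indicator (fun x => gaussianPDFReal 0 1 x * x) := by
    funext x; by_cases hx : x ∈ Set.Ioi t <;> simp [hx]
  rw [e, integral_indicator measurableSet_Ioi,
    integral_Ioi_of_hasDerivAt_of_tendsto' (fun x _ => pdf_hasDeriv x)
      pdf_mul_integrable.integrableOn pdf_tendsto]
  ring

instance stdG_noAtoms : NullSingletonClass (_root_.stdGaussian) := nullSingletonClass_gaussianReal (by norm_num)

lemma tendsto_quot (t : ℝ) :
    Tendsto (fun r : ℝ => ((_root_.stdGaussian (Set.Ioi (t - r))).toReal
      - (_root_.stdGaussian (Set.Ioi t)).toReal) / r) (nhdsWithin 0 (Set.Ioi 0))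
      (nhds (gaussianPDFReal 0 1 t)) := by
  have key : ∀ r : ℝ, 0 < r → (_root_.stdGaussian (Set.Ioi (t - r))).toReal
      - (_root_.stdGaussian (Set.Ioi t)).toReal = ∫ y in (t - r)..t, gaussianPDFReal 0 1 y := by
    intro r hr
    have h1 : ∀ u, (_root_.stdGaussian (Set.Ioi u)).toReal
        = ∫ y in Set.Ioi u, gaussianPDFReal 0 1 y := by
      intro u
      unfold _root_.stdGaussian
      rw [gaussianReal_apply_eq_integral _ (by norm_num), ENNReal.toReal_ofReal]
      exact integral_nonneg fun y => gaussianPDFReal_nonneg _ _ _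
    rw [h1, h1, intervalIntegral.integral_Ioi_sub_Ioi (integrable_gaussianPDFReal _ _).integrableOn
      (by linarith)]
  have hd : HasDerivAt (fun r : ℝ => ∫ y in (t - r)..t, gaussianPDFReal 0 1 y)
      (gaussianPDFReal 0 1 t) 0 := by
    have h0 : HasDerivAt (fun u : ℝ => ∫ y in u..t, gaussianPDFReal 0 1 y)
        (-gaussianPDFReal 0 1 (t - 0)) (t - 0) :=
      intervalIntegral.integral_hasDerivAt_left (pdf_cont.intervalIntegrable _ _)
        (pdf_cont.stronglyMeasurableAtFilter _ _) pdf_cont.continuousAt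
    have := h0.comp (0 : ℝ) ((hasDerivAt_id (0 : ℝ)).const_sub t)
    simpa [Function.comp_def] using this
  have hs := (hasDerivAt_iff_tendsto_slope.1 hd).mono_left
    (nhdsWithin_mono (0 : ℝ) (fun x (hx : 0 < x) => (ne_of_gt hx : x ≠ 0)))
  refine hs.congr' ?_
  filter_upwards [self_mem_nhdsWithin] with r hr
  rw [key r hr]
  simp [slope_def_field]

lemma mink_upper {S : Set ℝ} (hS : IsUpperSet S) :
    minkContent S = ∫ y, S.indicator (fun y => y) y ∂(_root_.stdGaussian) := by
  rcases S.eq_empty_or_nonempty with rfl | hne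
  · simp [minkContent]
  by_cases hb : BddBelow S
  · set t := sInf S with ht
    have hsub : Set.Ioi t ⊆ S := by
      intro y hy
      obtain ⟨z, hz, hzy⟩ := exists_lt_of_csInf_lt hne hy
      exact hS hzy.le hz
    have hsup : S ⊆ Set.Ici t := fun y hy => csInf_le hb hy
    have hae : S =ᵐ[_root_.stdGaussian] Set.Ioi t :=
      (Filter.EventuallyLE.antisymm (hsup.eventuallyLE.trans Ioi_ae_eq_Ici.symm.le)
        hsub.eventuallyLE)
    have h2 : ∀ r : ℝ, 0 < r → S + Set.Icc (-r) r =ᵐ[_root_.stdGaussian] Set.Ioi (t - r) := by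
      intro r hr
      have a1 : S + Set.Icc (-r) r ⊆ Set.Ici (t - r) := by
        rintro _ ⟨y, hy, z, hz, rfl⟩
        have := hsup hy
        simp only [Set.mem_Ici, Set.mem_Icc] at *
        linarith [hz.1]
      have a2 : Set.Ioi (t - r) ⊆ S + Set.Icc (-r) r := by
        intro y hy
        refine ⟨y + r, hsub ?_, -r, ?_, by simp⟩
        · simp only [Set.mem_Ioi] at *; linarith
        · constructor <;> linarith
      exact Filter.EventuallyLE.antisymm (a1.eventuallyLE.trans Ioi_ae_eq_Ici.symm.le)
        a2.eventuallyLE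
    have hm : minkContent S = gaussianPDFReal 0 1 t := by
      refine Tendsto.liminf_eq ((tendsto_quot t).congr' ?_)
      filter_upwards [self_mem_nhdsWithin] with r hr
      rw [measure_congr (h2 r hr), measure_congr hae]
    rw [hm, ← integral_Ioi_std, ← integral_indicator measurableSet_Ioi]
    refine integral_congr_ae ?_
    exact (indicator_ae_eq_of_ae_eq_set hae).symm
  · have hu : S = Set.univ := by
      ext y
      simp only [Set.mem_univ, iff_true]
      by_contra hy
      exact hb ⟨y, fun z hz => le_of_not_ge fun h => hy (hS h hz)⟩
    subst hu
    have h0 : minkContent Set.univ = 0 := by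
      refine Tendsto.liminf_eq ((tendsto_const_nhds (x := (0:ℝ))).congr' ?_)
      filter_upwards [self_mem_nhdsWithin] with r hr
      have : (Set.univ : Set ℝ) + Set.Icc (-r) r = Set.univ := by
        ext y
        simp only [Set.mem_univ, iff_true]
        exact ⟨y, trivial, 0, ⟨by simpa using (le_of_lt hr), le_of_lt hr⟩, by simp⟩
      rw [this]; simp
    rw [h0]
    simp only [Set.indicator_univ]
    exact integral_id_gaussianReal.symm

end mink

section main

lemma mp_update {n : ℕ} (i : Fin n) :
    MeasurePreserving (fun p : (Fin n → ℝ) × ℝ => Function.update p.1 i p.2)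
      ((gaussianPi n).prod (_root_.stdGaussian)) (gaussianPi n) := by
  have hm : Measurable (fun p : (Fin n → ℝ) × ℝ => Function.update p.1 i p.2) := by
    rw [measurable_pi_iff]
    intro j
    by_cases h : j = i
    · subst h; simpa using measurable_snd
    · simp only [Function.update_of_ne h]; fun_prop
  refine ⟨hm, ?_⟩
  symm
  refine Measure.pi_eq fun s hs => ?_
  rw [Measure.map_apply hm (MeasurableSet.univ_pi hs)]
  have e : (fun p : (Fin n → ℝ) × ℝ => Function.update p.1 i p.2) ⁻¹' (Set.univ.pi s)
      = (Set.univ.pi (Function.update s i Set.univ)) ×ˢ (s i) := by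
    ext ⟨x, y⟩
    simp only [Set.mem_preimage, Set.mem_pi, Set.mem_univ, true_imp_iff, Set.mem_prod]
    constructor
    · intro h
      refine ⟨fun j => ?_, by simpa using h i⟩
      by_cases hj : j = i
      · subst hj; simp
      · simpa [Function.update_of_ne hj] using h j
    · rintro ⟨h1, h2⟩ j
      by_cases hj : j = i
      · subst hj; simpa using h2
      · simpa [Function.update_of_ne hj] using h1 j
  rw [e, Measure.prod_prod]
  unfold gaussianPi
  rw [Measure.pi_pi, ← Finset.mul_prod_erase _ _ (Finset.mem_univ i),
    ← Finset.mul_prod_erase Finset.univ (fun j => _root_.stdGaussian (s j)) (Finset.mem_univ i)]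
  simp only [Function.update_self, measure_univ, one_mul]
  rw [mul_comm]
  congr 1
  refine Finset.prod_congr rfl fun j hj => ?_
  rw [Function.update_of_ne (Finset.ne_of_mem_erase hj)]

lemma geom_eq {n : ℕ} {A : Set (Fin n → ℝ)} (hA : MeasurableSet A) (hi : IncreasingSet A)
    (i : Fin n) :
    geomInfluence A i = ∫ x, x i * A.indicator 1 x ∂(gaussianPi n) := by
  have hint : Integrable (fun x : Fin n → ℝ => x i * A.indicator 1 x) (gaussianPi n) := by
    refine (integrable_coord i).mul_bdd (c := 1) ?_ ?_
    · exact (measurable_one.indicator hA).aestronglyMeasurable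
    · filter_upwards with x
      by_cases hx : x ∈ A <;> simp [hx]
  have hp := mp_update i
  rw [← hp.map_eq, integral_map hp.measurable.aemeasurable
    (by rw [hp.map_eq]; exact hint.aestronglyMeasurable)]
  have hint2 : Integrable (fun p : (Fin n → ℝ) × ℝ => Function.update p.1 i p.2 i *
      A.indicator 1 (Function.update p.1 i p.2)) ((gaussianPi n).prod (_root_.stdGaussian)) :=
    hp.integrable_comp_of_integrable hint
  rw [integral_prod _ hint2]
  refine integral_congr_ae ?_
  filter_upwards with x
  have hu : IsUpperSet (fiber A i x) := by
    intro a b hab ha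
    exact hi (update_le_update_iff.2 ⟨hab, fun _ _ => le_rfl⟩) ha
  rw [mink_upper hu]
  refine integral_congr_ae ?_
  filter_upwards with y
  by_cases hy : Function.update x i y ∈ A
  · have : y ∈ fiber A i x := hy
    simp [hy, this]
  · have : y ∉ fiber A i x := hy
    simp [hy, this]

lemma bdd_int {α : Type*} [MeasurableSpace α] {μ : Measure α} [IsProbabilityMeasure μ]
    {g : α → ℝ} (hg : Measurable g) (hb : ∀ x, |g x| ≤ 1) : Integrable g μ :=
  Integrable.of_bound hg.aestronglyMeasurable 1 (ae_of_all _ hb)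

lemma bessel {n : ℕ} (h : (Fin n → ℝ) → ℝ) (hm : Measurable h) (hb : ∀ x, |h x| ≤ 1) :
    (∫ x, h x ∂(gaussianPi n)) ^ 2 + ∑ i, (∫ x, x i * h x ∂(gaussianPi n)) ^ 2
      ≤ ∫ x, h x * h x ∂(gaussianPi n) := by
  set μ := gaussianPi n
  set m := ∫ x, h x ∂μ with hmdef
  set a : Fin n → ℝ := fun i => ∫ x, x i * h x ∂μ with ha
  have ih : Integrable h μ := bdd_int hm hb
  have hbn : ∀ᵐ x ∂μ, ‖h x‖ ≤ 1 := ae_of_all _ hb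
  have ihh : Integrable (fun x => h x * h x) μ := ih.mul_bdd hm.aestronglyMeasurable hbn
  have ixh : ∀ i, Integrable (fun x => x i * h x) μ := fun i =>
    (integrable_coord i).mul_bdd hm.aestronglyMeasurable hbn
  have ixx : ∀ i j, Integrable (fun x => x i * x j) μ := fun i j =>
    (memLp_coord i).integrable_mul (memLp_coord j)
  have key : 0 ≤ ∫ x, (h x - m - ∑ i, a i * x i) ^ 2 ∂μ := integral_nonneg fun x => sq_nonneg _
  have e : (fun x : Fin n → ℝ => (h x - m - ∑ i, a i * x i) ^ 2)
      = fun x => (((h x * h x + m ^ 2) + ∑ i, ∑ j, (a i * a j) * (x i * x j)) - (2 * m) * h x)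
        - ∑ i, (2 * a i) * (x i * h x) + ∑ i, (2 * m * a i) * x i := by
    funext x
    have e1 : ∑ i, ∑ j, (a i * a j) * (x i * x j) = (∑ i, a i * x i) ^ 2 := by
      rw [pow_two, Finset.sum_mul_sum]
      refine Finset.sum_congr rfl fun i _ => Finset.sum_congr rfl fun j _ => by ring
    have e2 : ∑ i, (2 * a i) * (x i * h x) = 2 * h x * ∑ i, a i * x i := by
      rw [Finset.mul_sum]; exact Finset.sum_congr rfl fun i _ => by ring
    have e3 : ∑ i, (2 * m * a i) * x i = 2 * m * ∑ i, a i * x i := by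
      rw [Finset.mul_sum]; exact Finset.sum_congr rfl fun i _ => by ring
    rw [e1, e2, e3]; ring
  have i1 : Integrable (fun x : Fin n → ℝ => h x * h x + m ^ 2) μ := ihh.add (integrable_const _)
  have i2a : ∀ i, Integrable (fun x : Fin n → ℝ => ∑ j, (a i * a j) * (x i * x j)) μ := fun i =>
    integrable_finsetSum _ fun j _ => (ixx i j).const_mul _
  have i2 : Integrable (fun x : Fin n → ℝ => ∑ i, ∑ j, (a i * a j) * (x i * x j)) μ :=
    integrable_finsetSum _ fun i _ => i2a i
  have i3 : Integrable (fun x : Fin n → ℝ => (2 * m) * h x) μ := ih.const_mul _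
  have i4 : Integrable (fun x : Fin n → ℝ => ∑ i, (2 * a i) * (x i * h x)) μ :=
    integrable_finsetSum _ fun i _ => (ixh i).const_mul _
  have i5 : Integrable (fun x : Fin n → ℝ => ∑ i, (2 * m * a i) * x i) μ :=
    integrable_finsetSum _ fun i _ => (integrable_coord i).const_mul _
  have k2 : Integrable (fun x : Fin n → ℝ => (h x * h x + m ^ 2)
      + ∑ i, ∑ j, (a i * a j) * (x i * x j)) μ := i1.add i2
  have k3 : Integrable (fun x : Fin n → ℝ => ((h x * h x + m ^ 2)
      + ∑ i, ∑ j, (a i * a j) * (x i * x j)) - (2 * m) * h x) μ := k2.sub i3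
  have k4 : Integrable (fun x : Fin n → ℝ => (((h x * h x + m ^ 2)
      + ∑ i, ∑ j, (a i * a j) * (x i * x j)) - (2 * m) * h x)
      - ∑ i, (2 * a i) * (x i * h x)) μ := k3.sub i4
  rw [e, integral_add k4 i5, integral_sub k3 i4,
    integral_sub k2 i3, integral_add i1 i2, integral_add ihh (integrable_const _),
    integral_finsetSum _ (fun i _ => i2a i),
    integral_finsetSum _ (fun i _ => (ixh i).const_mul _),
    integral_finsetSum _ (fun i _ => (integrable_coord i).const_mul _)] at key
  have s1 : ∀ i, ∫ x, ∑ j, (a i * a j) * (x i * x j) ∂μ = a i ^ 2 := by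
    intro i
    rw [integral_finsetSum _ (fun j _ => (ixx i j).const_mul _)]
    simp only [integral_const_mul]
    simp only [μ, integral_coord_mul]
    simp [pow_two]
  have s2 : ∀ i, ∫ x, (2 * a i) * (x i * h x) ∂μ = 2 * a i ^ 2 := by
    intro i
    rw [integral_const_mul]
    change 2 * a i * a i = _
    ring
  simp only [s1, s2, integral_const_mul, ← Finset.mul_sum] at key
  rw [← hmdef] at key
  simp only [integral_const, probReal_univ, integral_coord, mul_zero, Finset.sum_const_zero,
    smul_eq_mul] at key
  have : ∑ i, (a i) ^ 2 = ∑ i, (∫ x, x i * h x ∂μ) ^ 2 := rfl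
  nlinarith [key]

/-- Averaged function. -/
noncomputable def avg {n : ℕ} (c s : ℝ) (f : (Fin n → ℝ) → ℝ) (u : Fin n → ℝ) : ℝ :=
  ∫ v, f (c • u + s • v) ∂(gaussianPi n)

lemma avg_meas {n : ℕ} (c s : ℝ) {f : (Fin n → ℝ) → ℝ} (hf : Measurable f) :
    Measurable (avg c s f) := by
  have : Measurable (fun p : (Fin n → ℝ) × (Fin n → ℝ) => f (c • p.1 + s • p.2)) := by fun_prop
  exact (this.stronglyMeasurable.integral_prod_right (ν := gaussianPi n)).measurable

lemma avg_bdd {n : ℕ} (c s : ℝ) {f : (Fin n → ℝ) → ℝ} (hb : ∀ x, |f x| ≤ 1) (u : Fin n → ℝ) :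
    |avg c s f u| ≤ 1 := by
  have := norm_integral_le_of_norm_le_const (μ := gaussianPi n) (f := fun v => f (c • u + s • v))
    (C := 1) (ae_of_all _ fun v => hb _)
  simpa [avg] using this

lemma avg_integral {n : ℕ} {c s : ℝ} (hcs : c ^ 2 + s ^ 2 = 1) {f : (Fin n → ℝ) → ℝ}
    (hf : Measurable f) (hb : ∀ x, |f x| ≤ 1) :
    ∫ u, avg c s f u ∂(gaussianPi n) = ∫ x, f x ∂(gaussianPi n) := by
  unfold avg
  rw [integral_integral (f := fun u v => f (c • u + s • v))
    (bdd_int (by fun_prop) (fun _ => hb _))]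
  have := rot hcs (fun p => f p.1) (by fun_prop)
  simp only at this
  rw [this, integral_prod _ (bdd_int (by fun_prop) (fun _ => hb _))]
  simp

lemma avg_coord {n : ℕ} {c s : ℝ} (hcs : c ^ 2 + s ^ 2 = 1) {f : (Fin n → ℝ) → ℝ}
    (hf : Measurable f) (hb : ∀ x, |f x| ≤ 1) (i : Fin n) :
    ∫ u, u i * avg c s f u ∂(gaussianPi n) = c * ∫ x, x i * f x ∂(gaussianPi n) := by
  unfold avg
  simp only [← integral_const_mul]
  have hfst : Integrable (fun p : (Fin n → ℝ) × (Fin n → ℝ) => p.1 i)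
      ((gaussianPi n).prod (gaussianPi n)) := (integrable_coord i).comp_fst _
  have hsnd : Integrable (fun p : (Fin n → ℝ) × (Fin n → ℝ) => p.2 i)
      ((gaussianPi n).prod (gaussianPi n)) := (integrable_coord i).comp_snd _
  rw [integral_integral (f := fun u v => u i * f (c • u + s • v))
    (hfst.mul_bdd (c := 1) (Measurable.aestronglyMeasurable (by fun_prop))
      (ae_of_all _ fun _ => hb _))]
  have := rot hcs (fun p => (c * p.1 i - s * p.2 i) * f p.1) (by fun_prop)
  have e : ∀ p : (Fin n → ℝ) × (Fin n → ℝ),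
      c * (c • p.1 + s • p.2) i - s * (-s • p.1 + c • p.2) i = p.1 i := by
    intro p
    simp only [Pi.add_apply, Pi.smul_apply, smul_eq_mul]
    linear_combination (p.1 i) * hcs
  simp only [e] at this
  rw [this]
  have j1 : Integrable (fun p : (Fin n → ℝ) × (Fin n → ℝ) => c * (p.1 i * f p.1))
      ((gaussianPi n).prod (gaussianPi n)) :=
    (hfst.mul_bdd (c := 1) (Measurable.aestronglyMeasurable (by fun_prop))
      (ae_of_all _ fun _ => hb _)).const_mul c
  have j2 : Integrable (fun p : (Fin n → ℝ) × (Fin n → ℝ) => s * (f p.1 * p.2 i))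
      ((gaussianPi n).prod (gaussianPi n)) :=
    (hsnd.bdd_mul (c := 1) (Measurable.aestronglyMeasurable (by fun_prop))
      (ae_of_all _ fun _ => hb _)).const_mul s
  have e2 : (fun p : (Fin n → ℝ) × (Fin n → ℝ) => (c * p.1 i - s * p.2 i) * f p.1)
      = fun p => c * (p.1 i * f p.1) - s * (f p.1 * p.2 i) := by
    funext p; ring
  rw [e2, integral_sub j1 j2, integral_const_mul, integral_const_mul,
    integral_prod_mul (μ := gaussianPi n) (ν := gaussianPi n) f (fun y : Fin n → ℝ => y i),
    integral_coord, integral_prod _ (by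
      exact (hfst.mul_bdd (c := 1) (Measurable.aestronglyMeasurable (by fun_prop))
      (ae_of_all _ fun _ => hb _)))]
  simp [integral_const_mul]

lemma gaussZ_eq {n : ℕ} {c s ρ : ℝ} (hcs : c ^ 2 + s ^ 2 = 1) (hρ : ρ ≠ 0)
    (hρ2 : ρ ^ 2 = 1 - (c ^ 2) ^ 2) {f : (Fin n → ℝ) → ℝ}
    (hf : Measurable f) (hb : ∀ x, |f x| ≤ 1) :
    gaussZ f ρ = ∫ u, avg c s f u * avg c s f u ∂(gaussianPi n) := by
  have hbb : ∀ x y, |f x * f y| ≤ 1 := fun x y => by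
    rw [abs_mul]; exact mul_le_one₀ (hb x) (abs_nonneg _) (hb y)
  have hsq : √(1 - ρ ^ 2) = c ^ 2 := by
    rw [hρ2, sub_sub_cancel]; exact Real.sqrt_sq (sq_nonneg c)
  set μ := gaussianPi n
  -- right side as a triple integral
  have r1 : ∫ u, avg c s f u * avg c s f u ∂μ
      = ∫ v', ∫ p, f (c • p.1 + s • p.2) * f (c • p.1 + s • v') ∂(μ.prod μ) ∂μ := by
    have a1 : ∀ u, avg c s f u * avg c s f u
        = ∫ v', ∫ v, f (c • u + s • v) * f (c • u + s • v') ∂μ ∂μ := by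
      intro u
      simp only [integral_mul_const, integral_const_mul]
      rfl
    simp only [a1]
    rw [integral_integral_swap]
    · refine integral_congr_ae (ae_of_all _ fun v' => ?_)
      dsimp only
      exact integral_integral (f := fun u v => f (c • u + s • v) * f (c • u + s • v'))
        (bdd_int (by fun_prop) (fun _ => hbb _ _))
    · have hm : Measurable (fun q : ((Fin n → ℝ) × (Fin n → ℝ)) × (Fin n → ℝ) =>
          f (c • q.1.1 + s • q.2) * f (c • q.1.1 + s • q.1.2)) := by fun_prop
      refine bdd_int ((hm.stronglyMeasurable.integral_prod_right (ν := μ)).measurable) ?_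
      intro p
      have := norm_integral_le_of_norm_le_const (μ := μ)
        (f := fun v => f (c • p.1 + s • v) * f (c • p.1 + s • p.2))
        (C := 1) (ae_of_all _ fun v => hbb _ _)
      simpa [Function.uncurry] using this
  have r2 : ∀ v', ∫ p, f (c • p.1 + s • p.2) * f (c • p.1 + s • v') ∂(μ.prod μ)
      = ∫ w, ∫ z, f w * f (c • (c • w - s • z) + s • v') ∂μ ∂μ := by
    intro v'
    have := rot hcs (fun p => f p.1 * f (c • (c • p.1 - s • p.2) + s • v')) (by fun_prop)
    have e : ∀ p : (Fin n → ℝ) × (Fin n → ℝ),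
        c • (c • p.1 + s • p.2) - s • (-s • p.1 + c • p.2) = p.1 := by
      intro p
      ext i
      simp only [Pi.add_apply, Pi.sub_apply, Pi.smul_apply, smul_eq_mul]
      linear_combination (p.1 i) * hcs
    simp only [e] at this
    rw [this, integral_prod _ (bdd_int (by fun_prop) (fun _ => hbb _ _))]
  have r3 : ∀ w, ∫ v', ∫ z, f w * f (c • (c • w - s • z) + s • v') ∂μ ∂μ
      = ∫ z, f w * f (c ^ 2 • w + ρ • z) ∂μ := by
    intro w
    have hψ : (-(c * s) / ρ) ^ 2 + (s / ρ) ^ 2 = 1 := by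
      field_simp
      rw [hρ2]
      have : s ^ 2 = 1 - c ^ 2 := by linarith
      linear_combination (c ^ 2 + 1) * this
    have := rot hψ (fun p : (Fin n → ℝ) × (Fin n → ℝ) => f w * f (c ^ 2 • w + ρ • p.1))
      (by fun_prop)
    rw [integral_integral_swap (f := fun v' z => f w * f (c • (c • w - s • z) + s • v'))
      (bdd_int (by fun_prop) (fun _ => hbb _ _)),
      integral_integral (f := fun z v' => f w * f (c • (c • w - s • z) + s • v'))
      (bdd_int (by fun_prop) (fun _ => hbb _ _))]
    have e : ∀ p : (Fin n → ℝ) × (Fin n → ℝ),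
        c • (c • w - s • p.1) + s • p.2
          = c ^ 2 • w + ρ • ((-(c * s) / ρ) • p.1 + (s / ρ) • p.2) := by
      intro p
      ext i
      simp only [Pi.add_apply, Pi.sub_apply, Pi.smul_apply, smul_eq_mul]
      field_simp
      ring
    simp only [e]
    rw [this, integral_prod _ (bdd_int (by fun_prop) (fun _ => hbb _ _))]
    simp [μ]
  rw [r1]
  simp only [r2]
  rw [integral_integral_swap]
  · simp only [r3]
    rw [integral_integral (f := fun w z => f w * f (c ^ 2 • w + ρ • z))
      (bdd_int (by fun_prop) (fun _ => hbb _ _))]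
    unfold gaussZ
    refine integral_congr_ae (ae_of_all _ fun p => ?_)
    have : noised ρ p = c ^ 2 • p.1 + ρ • p.2 := by
      ext i
      simp [noised, hsq]
    simp only [this]
  · have hm : Measurable (fun q : ((Fin n → ℝ) × (Fin n → ℝ)) × (Fin n → ℝ) =>
        f q.1.2 * f (c • (c • q.1.2 - s • q.2) + s • q.1.1)) := by fun_prop
    refine bdd_int ((hm.stronglyMeasurable.integral_prod_right (ν := μ)).measurable) ?_
    intro p
    have := norm_integral_le_of_norm_le_const (μ := μ)
      (f := fun z => f p.2 * f (c • (c • p.2 - s • z) + s • p.1))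
      (C := 1) (ae_of_all _ fun v => hbb _ _)
    simpa [Function.uncurry] using this

lemma key_ineq {n : ℕ} {A : Set (Fin n → ℝ)} (hA : MeasurableSet A) (hi : IncreasingSet A) :
    ∑ i, geomInfluence A i ^ 2 ≤ 2 * gaussVAR (A.indicator 1) (√3 / 2) := by
  set f : (Fin n → ℝ) → ℝ := A.indicator 1 with hfdef
  have hf : Measurable f := measurable_one.indicator hA
  have hb : ∀ x, |f x| ≤ 1 := fun x => by by_cases hx : x ∈ A <;> simp [hfdef, hx]
  have h2 : (√2 / 2 : ℝ) ^ 2 = 1 / 2 := by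
    rw [div_pow, Real.sq_sqrt (by norm_num)]; norm_num
  have h3 : (√3 / 2 : ℝ) ^ 2 = 3 / 4 := by
    rw [div_pow, Real.sq_sqrt (by norm_num)]; norm_num
  have hcs : (√2 / 2 : ℝ) ^ 2 + (√2 / 2 : ℝ) ^ 2 = 1 := by rw [h2]; norm_num
  have hZ := gaussZ_eq (n := n) hcs (ρ := √3 / 2) (by positivity) (by rw [h2, h3]; norm_num) hf hb
  have hB := bessel (avg (√2 / 2) (√2 / 2) f) (avg_meas _ _ hf) (avg_bdd _ _ hb)
  simp only [avg_integral hcs hf hb, avg_coord hcs hf hb, mul_pow, ← Finset.mul_sum, h2] at hB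
  simp only [geom_eq hA hi]
  unfold gaussVAR
  rw [hZ]
  linarith

end main

/-- **Corollary (inverse Gaussian BKS for increasing sets).**
Let `A_ℓ ⊆ ℝ^{n_ℓ}` be a sequence of increasing Borel sets. If `VAR^G(A_ℓ, ρ) → 0` for
every `ρ ∈ (0,1)`, then `∑ i, I_i^G(A_ℓ)² → 0` as `ℓ → ∞`. -/
theorem gaussian_inverse_BKS_sets
    (N : ℕ → ℕ) (A : ∀ ℓ : ℕ, Set (Fin (N ℓ) → ℝ))
    (hmeas : ∀ ℓ, MeasurableSet (A ℓ)) (hincr : ∀ ℓ, IncreasingSet (A ℓ))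
    (hns : ∀ ρ : ℝ, ρ ∈ Set.Ioo (0 : ℝ) 1 →
      Filter.Tendsto (fun ℓ => gaussVAR ((A ℓ).indicator 1) ρ) Filter.atTop (nhds 0)) :
    Filter.Tendsto (fun ℓ => ∑ i, geomInfluence (A ℓ) i ^ 2) Filter.atTop (nhds 0) := by
  have h := (hns (√3 / 2) ⟨by positivity, by
    have : √3 < 2 := by
      rw [Real.sqrt_lt' (by norm_num)]; norm_num
    linarith⟩).const_mul 2
  rw [mul_zero] at h
  exact squeeze_zero (fun ℓ => Finset.sum_nonneg fun i _ => sq_nonneg _)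
    (fun ℓ => key_ineq (hmeas ℓ) (hincr ℓ)) h
end
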